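/- arXiv:1002.2129 — 2 statements merged into one kernel-verified Lean document; each statement's English description precedes it below -/
import Mathlib

section
/- Let 𝒩 be a non-empty set of positive integers that is closed under taking divisors (if n ∈ 𝒩 and m divides n, then m ∈ 𝒩). Then there exists a countable subfield K of ℂ (in particular, a countable field of characteristic zero) such that the set of orders of finite subgroups of the group of field automorphisms of K equals 𝒩, i.e. { |G| : G is a finite subgroup of Aut(K) } = 𝒩. -/
namespace Monoid.CoprodI

variable {ι : Type*} {M : ι → Type*} [∀ i, Group (M i)]

/-- A list of letters is reduced when no letter is trivial and adjacent letters have different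
indices. -/
def IsReducedList (l : List (Σ i, M i)) : Prop :=
  (∀ p ∈ l, p.2 ≠ 1) ∧ l.IsChain fun p q => p.1 ≠ q.1

/-- The product of a list of letters. -/
def listProd (l : List (Σ i, M i)) : CoprodI M := (l.map fun p => of p.2).prod

@[simp] lemma listProd_nil : listProd ([] : List (Σ i, M i)) = 1 := rfl

@[simp] lemma listProd_cons (p : Σ i, M i) (l : List (Σ i, M i)) :
    listProd (p :: l) = of p.2 * listProd l := by
  simp [listProd]

@[simp] lemma listProd_append (l k : List (Σ i, M i)) :
    listProd (l ++ k) = listProd l * listProd k := by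
  simp [listProd]

lemma exists_listProd_eq (g : CoprodI M) : ∃ l, IsReducedList l ∧ listProd l = g := by
  classical
  refine ⟨(Word.equiv g).toList, ⟨(Word.equiv g).ne_one, (Word.equiv g).chain_ne⟩, ?_⟩
  exact Word.equiv.left_inv g

lemma listProd_inj {l k : List (Σ i, M i)} (hl : IsReducedList l) (hk : IsReducedList k)
    (h : listProd l = listProd k) : l = k := by
  classical
  have : (⟨l, hl.1, hl.2⟩ : Word M) = ⟨k, hk.1, hk.2⟩ := Word.equiv.symm.injective h
  exact congrArg Word.toList this

/-- The list of letters representing the inverse. -/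
def listInv (l : List (Σ i, M i)) : List (Σ i, M i) :=
  (l.map fun p => (⟨p.1, p.2⁻¹⟩ : Σ i, M i)).reverse

lemma listProd_listInv (l : List (Σ i, M i)) : listProd (listInv l) = (listProd l)⁻¹ := by
  induction l with
  | nil => simp [listInv]
  | cons p l ih =>
    simp only [listInv, List.map_cons, List.reverse_cons, listProd_append] at ih ⊢
    simp [ih]

lemma IsReducedList.listInv {l : List (Σ i, M i)} (hl : IsReducedList l) :
    IsReducedList (listInv l) := by
  refine ⟨?_, ?_⟩
  · intro p hp
    simp only [CoprodI.listInv, List.mem_reverse, List.mem_map] at hp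
    obtain ⟨q, hq, rfl⟩ := hp
    simpa using hl.1 q hq
  · rw [CoprodI.listInv, List.isChain_reverse, List.isChain_map]
    exact hl.2.imp fun p q h => h.symm

/-- A subgroup of a free product whose elements have bounded length is conjugate into one of the
factors. -/
lemma exists_conj_of_length_le [Nonempty ι] (n : ℕ) :
    ∀ H : Subgroup (CoprodI M),
      (∀ l, IsReducedList l → listProd l ∈ H → l.length ≤ n) →
      ∃ (g : CoprodI M) (i : ι), ∀ h ∈ H, ∃ x : M i, h = g * of x * g⁻¹ := by
  induction n using Nat.strong_induction_on with
  | _ n ih =>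
  intro H hH
  by_cases htriv : ∀ l, IsReducedList l → listProd l ∈ H → l = []
  · refine ⟨1, Classical.arbitrary ι, fun h hh => ⟨1, ?_⟩⟩
    obtain ⟨l, hl, rfl⟩ := exists_listProd_eq h
    simp [htriv l hl hh]
  by_cases hmax : ∀ l, IsReducedList l → listProd l ∈ H → l.length ≠ n
  · have hn : n ≠ 0 := by
      rintro rfl
      exact hmax [] ⟨by simp, by simp⟩ H.one_mem rfl
    refine ih (n - 1) (by omega) H fun l hl hlH => ?_
    have := hH l hl hlH
    have := hmax l hl hlH
    omega
  push Not at htriv hmax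
  obtain ⟨h, hh, hhH, hlen⟩ := hmax
  have hn : n ≠ 0 := by
    rintro rfl
    obtain ⟨l, hl, hlH, hne⟩ := htriv
    exact hne (List.length_eq_zero_iff.1 (Nat.le_zero.1 (hH l hl hlH)))
  obtain ⟨h₀, ⟨i, b⟩, rfl⟩ : ∃ h₀ p, h = h₀ ++ [p] := by
    rcases List.eq_nil_or_concat h with rfl | ⟨L, b, rfl⟩
    · simp at hlen; omega
    · exact ⟨L, b, by simp⟩
  -- every nontrivial reduced list starts in index `i`
  have hstart : ∀ p k, IsReducedList (p :: k) → listProd (p :: k) ∈ H → p.1 = i := by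
    intro p k hk hkH
    by_contra hne
    have h1 : IsReducedList ((h₀ ++ [⟨i, b⟩]) ++ p :: k) := by
      refine ⟨fun q hq => ?_, hh.2.append hk.2 ?_⟩
      · rcases List.mem_append.1 hq with hq | hq
        exacts [hh.1 q hq, hk.1 q hq]
      · intro x hx y hy
        simp only [List.getLast?_append, List.getLast?_singleton, Option.some_or, Option.mem_def,
          Option.some.injEq, List.head?_cons] at hx hy
        subst hx hy
        exact Ne.symm hne
    have := hH _ h1 (by rw [listProd_append]; exact H.mul_mem hhH hkH)
    simp only [List.length_append, List.length_cons, List.length_nil] at this hlen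
    omega
  have hend : ∀ p k, IsReducedList (k ++ [p]) → listProd (k ++ [p]) ∈ H → p.1 = i := by
    intro p k hk hkH
    have h1 := hk.listInv
    have h2 : listProd (listInv (k ++ [p])) ∈ H := by
      rw [listProd_listInv]; exact H.inv_mem hkH
    simp only [listInv, List.map_append, List.map_cons, List.map_nil, List.reverse_append,
      List.reverse_cons, List.reverse_nil, List.nil_append, List.singleton_append] at h1 h2
    exact hstart ⟨p.1, p.2⁻¹⟩ _ h1 h2
  by_cases hn1 : n = 1
  · refine ⟨1, i, fun x hx => ?_⟩
    obtain ⟨l, hl, rfl⟩ := exists_listProd_eq x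
    have := hH l hl hx
    match l, hl, hx, this with
    | [], _, _, _ => exact ⟨1, by simp⟩
    | [⟨j, y⟩], hl, hx, _ =>
      obtain rfl : j = i := hstart _ _ hl hx
      exact ⟨y, by simp⟩
    | p :: q :: l, _, _, h' => simp [hn1] at h'
  -- two letter cancellation at the junction
  have hjoin : ∀ (m : List (Σ i, M i)) (b c : M i) (k : List (Σ i, M i)),
      IsReducedList (m ++ [⟨i, b⟩]) → listProd (m ++ [⟨i, b⟩]) ∈ H →
      IsReducedList (⟨i, c⟩ :: k) → listProd (⟨i, c⟩ :: k) ∈ H → b * c ≠ 1 →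
      IsReducedList (m ++ ⟨i, b * c⟩ :: k) ∧ listProd (m ++ ⟨i, b * c⟩ :: k) ∈ H := by
    intro m b c k hm hmH hk hkH hbc
    refine ⟨⟨fun q hq => ?_, ?_⟩, ?_⟩
    · rcases List.mem_append.1 hq with hq | hq
      · exact hm.1 q (by simp [hq])
      · rcases List.mem_cons.1 hq with rfl | hq
        · exact hbc
        · exact hk.1 q (by simp [hq])
    · have h1 := hm.2
      have h2 := hk.2
      rw [List.isChain_append] at h1 ⊢
      refine ⟨h1.1, ?_, ?_⟩
      · rw [List.isChain_cons] at h2 ⊢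
        exact h2
      · simpa using h1.2.2
    · have := H.mul_mem hmH hkH
      simpa [mul_assoc] using this
  have hhead : ∀ m (b c : M i) k, IsReducedList (m ++ [⟨i, b⟩]) → listProd (m ++ [⟨i, b⟩]) ∈ H →
      (m ++ [(⟨i, b⟩ : Σ i, M i)]).length = n →
      IsReducedList (⟨i, c⟩ :: k) → listProd (⟨i, c⟩ :: k) ∈ H → k ≠ [] → b * c = 1 := by
    intro m b c k hm hmH hml hk hkH hk0
    by_contra hbc
    obtain ⟨h1, h2⟩ := hjoin m b c k hm hmH hk hkH hbc
    have := hH _ h1 h2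
    have := List.length_pos_iff.2 hk0
    simp only [List.length_append, List.length_cons, List.length_nil] at *
    omega
  obtain ⟨⟨j, a⟩, m, rfl⟩ : ∃ p m, h₀ = p :: m := by
    cases h₀ with
    | nil => simp at hlen; omega
    | cons p m => exact ⟨p, m, rfl⟩
  obtain rfl : j = i := hstart ⟨j, a⟩ (m ++ [⟨i, b⟩]) (by simpa using hh) (by simpa using hhH)
  have hba : b * a = 1 := hhead _ b a (m ++ [⟨j, b⟩]) hh hhH hlen (by simpa using hh)
    (by simpa using hhH) (by simp)
  have hno : ∀ c : M j, IsReducedList [(⟨j, c⟩ : Σ i, M i)] →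
      listProd [(⟨j, c⟩ : Σ i, M i)] ∉ H := by
    intro c hc hcH
    by_cases hbc : b * c = 1
    · have h1 : listProd ((⟨j, a⟩ : Σ i, M i) :: m) ∈ H := by
        have := H.mul_mem hhH hcH
        simpa [mul_assoc, ← map_mul, hbc] using this
      have h2 : IsReducedList ((⟨j, a⟩ : Σ i, M i) :: m) :=
        ⟨fun q hq => hh.1 q (List.mem_append_left _ hq), (List.isChain_append.1 hh.2).1⟩
      rcases List.eq_nil_or_concat ((⟨j, a⟩ : Σ i, M i) :: m) with h0 | ⟨L, q, h0⟩
      · simp at h0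
      · rw [List.concat_eq_append] at h0
        have h3 := hh.2
        rw [h0] at h1 h2 h3
        have := hend q L h2 h1
        rw [List.isChain_append] at h3
        exact h3.2.2 q (by simp) ⟨j, b⟩ (by simp) this
    · obtain ⟨h1, h2⟩ := hjoin _ b c [] hh hhH hc hcH hbc
      have h3 := hhead _ (b * c) a _ h1 h2 (by simpa using hlen) hh hhH (by simp)
      have h4 : a * (b * c) = 1 := by
        rw [mul_eq_one_iff_eq_inv] at h3 ⊢
        rw [h3, inv_inv]
      rw [← mul_assoc, mul_eq_one_iff_eq_inv.1 hba, mul_inv_cancel, one_mul] at h4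
      exact hc.1 ⟨j, c⟩ (by simp) h4
  have hform : ∀ l, IsReducedList l → listProd l ∈ H → l ≠ [] →
      ∃ k, l = ⟨j, a⟩ :: k ++ [⟨j, a⁻¹⟩] := by
    have hfirst : ∀ p l, IsReducedList (p :: l) → listProd (p :: l) ∈ H → p = ⟨j, a⟩ := by
      rintro ⟨j', c⟩ l hl hlH
      obtain rfl : j' = j := hstart _ _ hl hlH
      have hl0 : l ≠ [] := by
        rintro rfl
        exact hno c hl hlH
      have := hhead _ b c l hh hhH hlen hl hlH hl0
      rw [← hba, mul_right_inj] at this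
      rw [this]
    intro l hl hlH hl0
    obtain ⟨p, l', rfl⟩ := List.exists_cons_of_ne_nil hl0
    have hp := hfirst p l' hl hlH
    subst hp
    rcases List.eq_nil_or_concat l' with rfl | ⟨k, q, rfl⟩
    · exact absurd hlH (hno a hl)
    rw [List.concat_eq_append] at *
    refine ⟨k, ?_⟩
    have h1 := hl.listInv
    have h2 : listProd (listInv (⟨j, a⟩ :: (k ++ [q]))) ∈ H := by
      rw [listProd_listInv]; exact H.inv_mem hlH
    simp only [listInv, List.map_append, List.map_cons, List.map_nil, List.reverse_append,
      List.reverse_cons, List.reverse_nil, List.nil_append,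
      List.cons_append] at h1 h2
    have := hfirst _ _ h1 h2
    obtain ⟨j', d⟩ := q
    obtain rfl : j' = j := congrArg Sigma.fst this
    simp only [Sigma.mk.injEq, heq_eq_eq, true_and] at this
    simp [← this]
  -- conjugating by `a` shortens everything
  obtain ⟨g, i, hg⟩ := ih (n - 1) (by omega) (H.map (MulAut.conj (of a)⁻¹).toMonoidHom) (by
    intro l hl hlH
    obtain ⟨x, hx, hxl⟩ := Subgroup.mem_map.1 hlH
    obtain ⟨k, hk, rfl⟩ := exists_listProd_eq x
    by_cases hk0 : k = []
    · subst hk0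
      have : l = [] := listProd_inj hl ⟨by simp, by simp⟩ (by rw [← hxl]; simp)
      simp [this]
    obtain ⟨k', rfl⟩ := hform k hk hx hk0
    have hk' : IsReducedList k' :=
      ⟨fun q hq => hk.1 q (by simp [hq]),
        (List.isChain_append.1 hk.2).1.tail⟩
    have : l = k' := listProd_inj hl hk' (by rw [← hxl]; simp [mul_assoc])
    have h3 := hH _ hk hx
    simp only [List.length_append, List.length_cons, List.length_nil] at h3
    rw [this]
    omega)
  refine ⟨of a * g, i, fun x hx => ?_⟩
  obtain ⟨y, hy⟩ := hg _ (Subgroup.mem_map_of_mem _ hx)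
  refine ⟨y, ?_⟩
  simp only [MulEquiv.coe_toMonoidHom, MulAut.conj_apply, inv_inv] at hy
  have : x = of a * ((of a)⁻¹ * x * of a) * (of a)⁻¹ := by group
  rw [this, hy]
  group

/-- A finite subgroup of a free product is conjugate into one of the factors. -/
lemma exists_conj_of_finite [Nonempty ι] (H : Subgroup (CoprodI M)) [Finite H] :
    ∃ (g : CoprodI M) (i : ι), ∀ h ∈ H, ∃ x : M i, h = g * of x * g⁻¹ := by
  choose l hl hlp using fun h : H => exists_listProd_eq (h : CoprodI M)
  obtain ⟨n, hn⟩ := (Set.finite_range fun h : H => (l h).length).bddAbove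
  refine exists_conj_of_length_le n H fun k hk hkH => ?_
  have : k = l ⟨_, hkH⟩ := listProd_inj hk (hl _) (hlp ⟨_, hkH⟩).symm
  rw [this]
  exact hn ⟨_, rfl⟩

/-- The order of a finite subgroup of a free product divides the order of a factor. -/
lemma exists_card_dvd_of_finite [Nonempty ι] (H : Subgroup (CoprodI M)) [Finite H] :
    ∃ i : ι, Nat.card H ∣ Nat.card (M i) := by
  obtain ⟨g, i, hg⟩ := exists_conj_of_finite H
  refine ⟨i, ?_⟩
  have hle : H ≤ ((MulAut.conj g).toMonoidHom.comp (of : M i →* CoprodI M)).range := by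
    intro h hh
    obtain ⟨x, rfl⟩ := hg h hh
    exact ⟨x, by simp⟩
  refine (Subgroup.card_dvd_of_le hle).trans (dvd_of_eq ?_)
  refine (Nat.card_congr (MonoidHom.ofInjective ?_).toEquiv).symm
  intro x y hxy
  apply of_injective i
  simpa using hxy

end Monoid.CoprodI

namespace MvPolynomial

variable {σ k : Type*} [Field k]

lemma coeff_X_mul_pderiv_sub (i : σ) (c : k) (P : MvPolynomial σ k) (v : σ →₀ ℕ) :
    coeff v (X i * pderiv i P - C c * P) = ((v i : k) - c) * coeff v P := by
  classical
  induction P using MvPolynomial.induction_on' with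
  | monomial u a =>
    rw [X_mul_pderiv_monomial, C_mul_monomial, coeff_sub, coeff_smul, coeff_monomial,
      coeff_monomial]
    split_ifs with h
    · subst h; simp [sub_mul]
    · simp
  | add p q hp hq =>
    rw [map_add, mul_add, mul_add, add_sub_add_comm, coeff_add, hp, hq, coeff_add, mul_add]

lemma exists_eq_monomial_of_forall_prime_dvd {P : MvPolynomial σ k} (hP : P ≠ 0)
    (h : ∀ π : MvPolynomial σ k, Prime π → π ∣ P → ∃ i, π ∣ X i) :
    ∃ u, ∃ c ≠ 0, P = monomial u c := by
  induction P using UniqueFactorizationMonoid.induction_on_prime with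
  | h₁ => exact absurd rfl hP
  | h₂ x hx =>
    obtain ⟨c, hc, rfl⟩ := isUnit_iff_eq_C_of_isReduced.1 hx
    exact ⟨0, c, hc.ne_zero, rfl⟩
  | h₃ a p ha hp ih =>
    obtain ⟨i, hi⟩ := h p hp (dvd_mul_right p a)
    obtain ⟨u, c, hc, rfl⟩ := ih ha fun π hπ hd => h π hπ (hd.mul_left p)
    obtain ⟨d, hd⟩ := (hp.irreducible.associated_of_dvd (X_prime (i := i)).irreducible hi).symm
    obtain ⟨r, hr, hrd⟩ := isUnit_iff_eq_C_of_isReduced.1 d.isUnit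
    refine ⟨Finsupp.single i 1 + u, r * c, mul_ne_zero hr.ne_zero hc, ?_⟩
    rw [← hd, hrd, X, mul_comm (monomial _ _) (C r), C_mul_monomial, monomial_mul, mul_one]

lemma prime_dvd_monomial {π : MvPolynomial σ k} (hπ : Prime π) {u : σ →₀ ℕ} {c : k} (hc : c ≠ 0)
    (h : π ∣ monomial u c) : ∃ i, π ∣ X i := by
  rw [monomial_eq] at h
  rcases hπ.dvd_or_dvd h with h | h
  · exact absurd (isUnit_of_dvd_unit h (hc.isUnit.map C)) hπ.not_isUnit
  · obtain ⟨i, -, hi⟩ := (Prime.dvd_finsetProd_iff hπ _).1 h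
    exact ⟨i, hπ.dvd_of_dvd_pow hi⟩

/-- A prime which is not a variable divides a polynomial with fewer multiplicities than the
polynomial has terms. -/
lemma not_prime_pow_card_support_dvd [CharZero k] {π : MvPolynomial σ k} (hπ : Prime π)
    (hX : ∀ i, ¬ π ∣ X i) (n : ℕ) :
    ∀ P : MvPolynomial σ k, P ≠ 0 → P.support.card ≤ n → ¬ π ^ n ∣ P := by
  classical
  induction n with
  | zero =>
    intro P hP hc
    simp at hc
    exact absurd hc hP
  | succ n ih =>
    intro P hP hcard hdvd
    by_cases h1 : ∃ v₀ ∈ P.support, ∃ v₁ ∈ P.support, v₀ ≠ v₁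
    · obtain ⟨v₀, h₀, v₁, h₁, hne⟩ := h1
      obtain ⟨i, hi⟩ := DFunLike.ne_iff.1 hne
      set D := X i * pderiv i P - C (v₀ i : k) * P with hD
      have hco := fun v => coeff_X_mul_pderiv_sub i (v₀ i : k) P v
      refine ih D ?_ ?_ ?_
      · intro h0
        have := hco v₁
        rw [← hD, h0, coeff_zero, eq_comm, mul_eq_zero, sub_eq_zero, Nat.cast_inj] at this
        exact this.elim (fun h => hi h.symm) (mem_support_iff.1 h₁)
      · have hsub : D.support ⊆ P.support.erase v₀ := by
          intro v hv
          rw [mem_support_iff, hD, hco] at hv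
          refine Finset.mem_erase.2 ⟨?_, mem_support_iff.2 (right_ne_zero_of_mul hv)⟩
          rintro rfl
          simp at hv
        have := Finset.card_le_card hsub
        rw [Finset.card_erase_of_mem h₀] at this
        omega
      · obtain ⟨R, rfl⟩ := hdvd
        have h2 : π ^ n ∣ pderiv i (π ^ (n + 1) * R) := by
          rw [Derivation.leibniz, Derivation.leibniz_pow]
          refine dvd_add ?_ ?_
          · exact (pow_dvd_pow π n.le_succ).trans (by simp [smul_eq_mul])
          · simp only [Nat.add_sub_cancel, smul_eq_mul, nsmul_eq_mul]
            exact Dvd.dvd.mul_left (Dvd.dvd.mul_left (dvd_mul_right _ _) _) _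
        refine dvd_sub (h2.mul_left _) (Dvd.dvd.mul_left ?_ _)
        exact (pow_dvd_pow π n.le_succ).trans (dvd_mul_right _ _)
    · push Not at h1
      obtain ⟨v, hv⟩ := support_nonempty.2 hP
      have : P = monomial v (coeff v P) := by
        conv_lhs => rw [P.as_sum, show P.support = {v} from
          Finset.eq_singleton_iff_unique_mem.2 ⟨hv, fun w hw => h1 w hw v hv⟩]
        simp
      rw [this] at hdvd
      obtain ⟨i, hi⟩ := prime_dvd_monomial hπ (mem_support_iff.1 hv)
        ((dvd_pow_self π n.succ_ne_zero).trans hdvd)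
      exact hX i hi

/-- If the quotient of two polynomials with at most `N` terms is an `N`-th power, then it is a
Laurent monomial. -/
lemma exists_mul_monomial_eq_of_mul_pow_eq [CharZero k] {N : ℕ} {P Q B D : MvPolynomial σ k}
    (hP : P ≠ 0) (hQ : Q ≠ 0) (hB : B ≠ 0) (hD : D ≠ 0)
    (hPN : P.support.card ≤ N) (hQN : Q.support.card ≤ N) (h : P * D ^ N = Q * B ^ N) :
    ∃ u w, ∃ c ≠ 0, P * monomial u 1 = Q * monomial w c := by
  obtain ⟨P', Q', g, hrel, rfl, rfl⟩ := UniqueFactorizationMonoid.exists_reduced_factors' P Q hQ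
  obtain ⟨B', D', r, hrel', rfl, rfl⟩ := UniqueFactorizationMonoid.exists_reduced_factors' B D hD
  have hN : N ≠ 0 := by
    rintro rfl
    simp at hPN
    simp [hPN] at hP
  have hg := left_ne_zero_of_mul hP
  have hr := left_ne_zero_of_mul hB
  have hrel'' : IsRelPrime (B' ^ N) (D' ^ N) := hrel'.pow
  have h' : P' * D' ^ N = Q' * B' ^ N := by
    have h0 : g * r ^ N ≠ 0 := mul_ne_zero hg (pow_ne_zero _ hr)
    apply mul_left_cancel₀ h0
    linear_combination h
  have h1 : B' ^ N ∣ P' := hrel''.dvd_of_dvd_mul_right (h' ▸ dvd_mul_left _ _)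
  have h2 : D' ^ N ∣ Q' := hrel''.symm.dvd_of_dvd_mul_right (h' ▸ dvd_mul_left _ _)
  obtain ⟨t, ht⟩ := h1
  obtain ⟨s, hs⟩ := h2
  have hB' := right_ne_zero_of_mul hB
  have hD' := right_ne_zero_of_mul hD
  have hts : t = s := by
    have h0 : B' ^ N * D' ^ N ≠ 0 := mul_ne_zero (pow_ne_zero _ hB') (pow_ne_zero _ hD')
    apply mul_left_cancel₀ h0
    rw [ht, hs] at h'
    linear_combination h'
  have hmon : ∀ E R : MvPolynomial σ k, E ≠ 0 → g * R ≠ 0 → (g * R).support.card ≤ N → E ^ N ∣ R →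
      ∃ u, ∃ c ≠ 0, E = monomial u c := by
    intro E R hE hR hcard hdvd
    refine exists_eq_monomial_of_forall_prime_dvd hE fun π hπ hπE => ?_
    by_contra hX
    push Not at hX
    exact not_prime_pow_card_support_dvd hπ hX N _ hR hcard
      (((pow_dvd_pow_of_dvd hπE N).trans hdvd).mul_left g)
  obtain ⟨u, a, ha, hBu⟩ := hmon B' P' hB' hP hPN ⟨t, ht⟩
  obtain ⟨w, b, hb, hDw⟩ := hmon D' Q' hD' hQ hQN ⟨s, hs⟩
  refine ⟨N • w, N • u, (b ^ N)⁻¹ * a ^ N,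
    mul_ne_zero (inv_ne_zero (pow_ne_zero _ hb)) (pow_ne_zero _ ha), ?_⟩
  have e1 : monomial (N • w) (1 : k) = C (b ^ N)⁻¹ * D' ^ N := by
    rw [hDw, monomial_pow, C_mul_monomial, inv_mul_cancel₀ (pow_ne_zero _ hb)]
  have e2 : monomial (N • u) ((b ^ N)⁻¹ * a ^ N) = C (b ^ N)⁻¹ * B' ^ N := by
    rw [hBu, monomial_pow, C_mul_monomial]
  rw [e1, e2]
  linear_combination g * C (b ^ N)⁻¹ * h'

/-- If an `N`-th power of a quotient of polynomials is a Laurent monomial, then so is the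
quotient. -/
lemma exists_mul_monomial_eq_of_pow_mul_eq {N : ℕ} (hN : N ≠ 0) {R T : MvPolynomial σ k}
    (hR : R ≠ 0) (hT : T ≠ 0) {u w : σ →₀ ℕ} {c d : k} (hc : c ≠ 0) (hd : d ≠ 0)
    (h : R ^ N * monomial u c = T ^ N * monomial w d) :
    ∃ u' w', ∃ c' ≠ 0, R * monomial u' 1 = T * monomial w' c' := by
  obtain ⟨R', T', g, hrel, rfl, rfl⟩ := UniqueFactorizationMonoid.exists_reduced_factors' R T hT
  have hg := left_ne_zero_of_mul hR
  have hrel' : IsRelPrime (R' ^ N) (T' ^ N) := hrel.pow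
  have h' : R' ^ N * monomial u c = T' ^ N * monomial w d := by
    apply mul_left_cancel₀ (pow_ne_zero N hg)
    linear_combination h
  have h1 : R' ^ N ∣ monomial w d := hrel'.dvd_of_dvd_mul_left (h' ▸ dvd_mul_right _ _)
  have h2 : T' ^ N ∣ monomial u c := hrel'.symm.dvd_of_dvd_mul_left (h' ▸ dvd_mul_right _ _)
  have hmon : ∀ (E : MvPolynomial σ k) (v : σ →₀ ℕ) (r : k), E ≠ 0 → r ≠ 0 →
      E ^ N ∣ monomial v r → ∃ u, ∃ c ≠ 0, E = monomial u c := by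
    intro E v r hE hr hdvd
    refine exists_eq_monomial_of_forall_prime_dvd hE fun π hπ hπE => ?_
    exact prime_dvd_monomial hπ hr ((hπE.trans (dvd_pow_self E hN)).trans hdvd)
  obtain ⟨u', a, ha, hu'⟩ := hmon R' w d (right_ne_zero_of_mul hR) hd h1
  obtain ⟨w', b, hb, hw'⟩ := hmon T' u c (right_ne_zero_of_mul hT) hc h2
  refine ⟨w', u', b⁻¹ * a, mul_ne_zero (inv_ne_zero hb) ha, ?_⟩
  rw [hu', hw', mul_assoc, mul_assoc, monomial_mul, monomial_mul, add_comm, ← mul_assoc b,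
    mul_inv_cancel₀ hb, one_mul, mul_one]

end MvPolynomial

section

open MvPolynomial

section LaurentMonomial

variable {J F E : Type*} [Field F] [Field E]

/-- The Laurent monomial with exponent vector `u` in the elements `x j`. -/
noncomputable def laurentMonomial (x : J → F) (u : J →₀ ℤ) : F := u.prod fun j z => x j ^ z

@[simp] lemma laurentMonomial_zero (x : J → F) : laurentMonomial x 0 = 1 := by
  simp [laurentMonomial]

lemma laurentMonomial_single (x : J → F) (j : J) (z : ℤ) :
    laurentMonomial x (Finsupp.single j z) = x j ^ z := by
  simp [laurentMonomial]

lemma laurentMonomial_add {x : J → F} (hx : ∀ j, x j ≠ 0) (u w : J →₀ ℤ) :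
    laurentMonomial x (u + w) = laurentMonomial x u * laurentMonomial x w := by
  classical
  exact Finsupp.prod_add_index' (fun _ => zpow_zero _) fun j _ _ => zpow_add₀ (hx j) _ _

lemma laurentMonomial_ne_zero {x : J → F} (hx : ∀ j, x j ≠ 0) (u : J →₀ ℤ) :
    laurentMonomial x u ≠ 0 :=
  Finset.prod_ne_zero_iff.2 fun j _ => zpow_ne_zero _ (hx j)

lemma laurentMonomial_nsmul {x : J → F} (hx : ∀ j, x j ≠ 0) (n : ℕ) (u : J →₀ ℤ) :
    laurentMonomial x (n • u) = laurentMonomial x u ^ n := by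
  induction n with
  | zero => simp
  | succ n ih => rw [succ_nsmul, laurentMonomial_add hx, ih, pow_succ]

lemma laurentMonomial_mul (x y : J → F) (u : J →₀ ℤ) :
    laurentMonomial (fun j => x j * y j) u = laurentMonomial x u * laurentMonomial y u := by
  simp only [laurentMonomial, Finsupp.prod, mul_zpow, Finset.prod_mul_distrib]

lemma laurentMonomial_pow (x : J → F) (n : ℕ) (u : J →₀ ℤ) :
    laurentMonomial (fun j => x j ^ n) u = laurentMonomial x u ^ n := by
  simp only [laurentMonomial, Finsupp.prod, ← Finset.prod_pow]
  refine Finset.prod_congr rfl fun j _ => ?_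
  rw [← zpow_natCast, ← zpow_natCast, ← zpow_mul, ← zpow_mul, mul_comm]

lemma map_laurentMonomial (φ : F →+* E) (x : J → F) (u : J →₀ ℤ) :
    φ (laurentMonomial x u) = laurentMonomial (fun j => φ (x j)) u := by
  simp [laurentMonomial, Finsupp.prod]

variable {k : Type*} [Field k] [Algebra k F]

lemma aeval_monomial_eq_laurentMonomial (x : J → F) (u : J →₀ ℕ) (c : k) :
    aeval x (monomial u c) =
      algebraMap k F c * laurentMonomial x (u.mapRange (Nat.cast : ℕ → ℤ) rfl) := by
  rw [aeval_monomial, laurentMonomial, Finsupp.prod_mapRange_index (by simp)]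
  simp

lemma AlgebraicIndependent.eq_of_mul_laurentMonomial_eq {x : J → F}
    (hx : AlgebraicIndependent k x) {u w : J →₀ ℤ} {c d : k} (hc : c ≠ 0)
    (h : algebraMap k F c * laurentMonomial x u = algebraMap k F d * laurentMonomial x w) :
    u = w ∧ c = d := by
  have hx0 : ∀ j, x j ≠ 0 := hx.ne_zero
  set p : J →₀ ℕ := (u - w).mapRange Int.toNat rfl
  set q : J →₀ ℕ := (w - u).mapRange Int.toNat rfl
  have hpq : u + q.mapRange (Nat.cast : ℕ → ℤ) rfl = w + p.mapRange (Nat.cast : ℕ → ℤ) rfl := by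
    ext j
    simp only [p, q, Finsupp.add_apply, Finsupp.mapRange_apply, Finsupp.sub_apply]
    omega
  have h1 : aeval x (monomial p c) = aeval x (monomial q d) := by
    rw [aeval_monomial_eq_laurentMonomial, aeval_monomial_eq_laurentMonomial]
    apply mul_left_cancel₀ (laurentMonomial_ne_zero hx0 w)
    rw [mul_left_comm, ← laurentMonomial_add hx0, ← hpq, laurentMonomial_add hx0, ← mul_assoc, h]
    ring
  rcases monomial_eq_monomial_iff _ _ _ _ |>.1 (hx h1) with ⟨h2, h3⟩ | ⟨h2, -⟩
  · refine ⟨?_, h3⟩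
    rw [h2] at hpq
    exact add_right_cancel hpq
  · exact absurd h2 hc

lemma eq_mul_laurentMonomial_of_mul_monomial_eq {x : J → F} (hx : AlgebraicIndependent k x)
    {P Q : MvPolynomial J k} {u w : J →₀ ℕ} {c : k} (hQ : Q ≠ 0) {a : F}
    (ha : a * aeval x Q = aeval x P) (h : P * monomial u 1 = Q * monomial w c) :
    a = algebraMap k F c * laurentMonomial x
      (w.mapRange (Nat.cast : ℕ → ℤ) rfl - u.mapRange (Nat.cast : ℕ → ℤ) rfl) := by
  have hx0 : ∀ j, x j ≠ 0 := hx.ne_zero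
  have h1 := congrArg (aeval x) h
  rw [map_mul, map_mul, ← ha, aeval_monomial_eq_laurentMonomial,
    aeval_monomial_eq_laurentMonomial, map_one, one_mul] at h1
  have hQ' : aeval x Q ≠ 0 := fun h0 => hQ (hx (by rw [h0, map_zero]))
  set u' := u.mapRange (Nat.cast : ℕ → ℤ) rfl
  set w' := w.mapRange (Nat.cast : ℕ → ℤ) rfl
  apply mul_right_cancel₀ (laurentMonomial_ne_zero hx0 u')
  rw [mul_assoc, ← laurentMonomial_add hx0, sub_add_cancel]
  apply mul_left_cancel₀ hQ'
  rw [← h1]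
  ring

end LaurentMonomial

/-- The sum of the factorials `1! + ⋯ + n!`. -/
def factorialSum : ℕ → ℕ
  | 0 => 0
  | n + 1 => factorialSum n + (n + 1).factorial

lemma factorialSum_le (n : ℕ) : factorialSum n ≤ (n + 1).factorial := by
  induction n with
  | zero => simp [factorialSum]
  | succ n ih =>
    rw [factorialSum, Nat.factorial_succ (n + 1)]
    nlinarith [Nat.zero_le n, Nat.factorial_pos (n + 1)]

lemma factorialSum_mul_le (n : ℕ) : factorialSum n * (n + 1) ≤ 2 * (n + 1).factorial := by
  cases n with
  | zero => simp [factorialSum]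
  | succ n =>
    rw [factorialSum, Nat.factorial_succ (n + 1)]
    nlinarith [factorialSum_le n]

lemma factorialSum_modEq {n m : ℕ} (h : n ≤ m) :
    ((n + 1).factorial : ℤ) ∣ factorialSum m - factorialSum n := by
  induction m, h using Nat.le_induction with
  | base => simp
  | succ m hm ih =>
    rw [factorialSum, Nat.cast_add, add_sub_right_comm]
    exact dvd_add ih (Int.natCast_dvd_natCast.2 (Nat.factorial_dvd_factorial (by omega)))

lemma eq_zero_of_factorial_dvd_add_factorialSum_mul {A B : ℤ} {m : ℕ}
    (h : ∀ n ≥ m, ((n + 1).factorial : ℤ) ∣ A + factorialSum n * B) : B = 0 ∧ A = 0 := by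
  have key : ∀ n : ℕ, m ≤ n → |A| + 2 * |B| ≤ n → A + factorialSum n * B = 0 := by
    intro n hm hn
    refine Int.eq_zero_of_abs_lt_dvd (h n hm) ?_
    have h1 : |A + factorialSum n * B| ≤ |A| + factorialSum n * |B| := by
      refine (abs_add_le _ _).trans ?_
      rw [abs_mul, Nat.abs_cast]
    have h2 : (factorialSum n : ℤ) * (n + 1) ≤ 2 * ((n + 1).factorial : ℤ) := by
      exact_mod_cast factorialSum_mul_le n
    have h3 : (n + 1 : ℤ) ≤ (n + 1).factorial := by exact_mod_cast Nat.self_le_factorial (n + 1)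
    have hA := abs_nonneg A
    have hB := abs_nonneg B
    refine h1.trans_lt ?_
    have h4 : (n + 1 : ℤ) * (|A| + factorialSum n * |B|) < (n + 1) * (n + 1).factorial := by
      nlinarith [mul_le_mul_of_nonneg_right h2 hB, mul_le_mul_of_nonneg_right h3 hA]
    exact lt_of_mul_lt_mul_left h4 (by positivity)
  obtain ⟨n, hn⟩ : ∃ n : ℕ, m ≤ n ∧ |A| + 2 * |B| ≤ n :=
    ⟨m + (|A| + 2 * |B|).toNat, by omega, by
      push_cast
      have := Int.self_le_toNat (|A| + 2 * |B|)
      omega⟩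
  have h1 := key n hn.1 hn.2
  have h2 := key (n + 1) (by omega) (by push_cast; omega)
  rw [factorialSum, Nat.cast_add] at h2
  have h3 : (((n + 1).factorial : ℕ) : ℤ) * B = 0 := by linear_combination h2 - h1
  have hB : B = 0 := (mul_eq_zero.1 h3).resolve_left
    (by exact_mod_cast (Nat.factorial_pos (n + 1)).ne')
  exact ⟨hB, by simpa [hB] using h1⟩

/-- A field `K` exhausted by rational function fields `k(e n j : j ∈ J)`, in which each `e n j` is
`f j` times an `(n + 2)`-nd power of `e (n + 1) j`. -/
structure IsPowerTower {J k K : Type*} [Field k] [Field K] [Algebra k K] (f : J → k)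
    (e : ℕ → J → K) : Prop where
  ne_zero : ∀ j, f j ≠ 0
  indep : ∀ n, AlgebraicIndependent k (e n)
  step : ∀ n j, e n j = algebraMap k K (f j) * e (n + 1) j ^ (n + 2)
  exists_eq : ∀ a, ∃ n, ∃ P Q : MvPolynomial J k, Q ≠ 0 ∧ a * aeval (e n) Q = aeval (e n) P

namespace IsPowerTower

variable {J k K : Type*} [Field k] [Field K] [Algebra k K] {f : J → k} {e : ℕ → J → K}

lemma e_ne_zero (h : IsPowerTower f e) (n : ℕ) (j : J) : e n j ≠ 0 := (h.indep n).ne_zero j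

lemma laurentMonomial_step (h : IsPowerTower f e) (n : ℕ) (u : J →₀ ℤ) :
    laurentMonomial (e n) u = algebraMap k K (laurentMonomial f u) *
      laurentMonomial (e (n + 1)) ((n + 2) • u) := by
  rw [laurentMonomial_nsmul (h.e_ne_zero _), ← laurentMonomial_pow, map_laurentMonomial,
    ← laurentMonomial_mul]
  congr 1
  exact funext (h.step n)

lemma laurentMonomial_zero_level (h : IsPowerTower f e) (n : ℕ) (u : J →₀ ℤ) :
    laurentMonomial (e 0) u = algebraMap k K (laurentMonomial f u ^ factorialSum n) *
      laurentMonomial (e n) ((n + 1).factorial • u) := by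
  induction n with
  | zero => simp [factorialSum]
  | succ n ih =>
    rw [ih, h.laurentMonomial_step, laurentMonomial_nsmul h.ne_zero, ← mul_assoc, ← map_mul,
      factorialSum, pow_add, smul_smul, ← Nat.factorial_succ]

lemma exists_aeval_succ_eq (h : IsPowerTower f e) (n : ℕ) (P : MvPolynomial J k) :
    ∃ P' : MvPolynomial J k, P'.support.card ≤ P.support.card ∧
      aeval (e (n + 1)) P' = aeval (e n) P := by
  classical
  refine ⟨∑ v ∈ P.support, monomial ((n + 2) • v) (coeff v P * v.prod fun j m => f j ^ m), ?_, ?_⟩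
  · refine (Finset.card_le_card (support_sum)).trans (Finset.card_biUnion_le.trans ?_)
    refine (Finset.sum_le_card_nsmul _ _ 1 fun v _ => ?_).trans (by simp)
    exact (Finset.card_le_card support_monomial_subset).trans (by simp)
  · conv_rhs => rw [P.as_sum]
    rw [map_sum, map_sum]
    refine Finset.sum_congr rfl fun v _ => ?_
    have hv : (n + 2) • v = v.mapRange (fun m => (n + 2) * m) (mul_zero _) := by
      ext j
      simp
    rw [aeval_monomial, aeval_monomial, hv, Finsupp.prod_mapRange_index (by simp), map_mul, mul_assoc]
    congr 1
    simp only [Finsupp.prod, map_prod, map_pow, ← Finset.prod_mul_distrib]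
    refine Finset.prod_congr rfl fun j _ => ?_
    rw [h.step n, mul_pow, ← pow_mul]

lemma exists_aeval_eq (h : IsPowerTower f e) {n m : ℕ} (hnm : n ≤ m) (P : MvPolynomial J k) :
    ∃ P' : MvPolynomial J k, P'.support.card ≤ P.support.card ∧
      aeval (e m) P' = aeval (e n) P := by
  induction m, hnm using Nat.le_induction with
  | base => exact ⟨P, le_rfl, rfl⟩
  | succ m hm ih =>
    obtain ⟨P', h1, h2⟩ := ih
    obtain ⟨P'', h3, h4⟩ := h.exists_aeval_succ_eq m P'
    exact ⟨P'', h3.trans h1, h4.trans h2⟩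

lemma aeval_eq_zero_iff (h : IsPowerTower f e) {n : ℕ} {P : MvPolynomial J k} :
    aeval (e n) P = 0 ↔ P = 0 :=
  ⟨fun h0 => h.indep n (by rw [h0, map_zero]), by rintro rfl; simp⟩

lemma exists_eq_of_le (h : IsPowerTower f e) (a : K) :
    ∃ n s, ∀ m ≥ n, ∃ P Q : MvPolynomial J k, P.support.card ≤ s ∧ Q.support.card ≤ s ∧
      Q ≠ 0 ∧ a * aeval (e m) Q = aeval (e m) P := by
  obtain ⟨n, P, Q, hQ, ha⟩ := h.exists_eq a
  refine ⟨n, max P.support.card Q.support.card, fun m hm => ?_⟩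
  obtain ⟨P', h1, h2⟩ := h.exists_aeval_eq hm P
  obtain ⟨Q', h3, h4⟩ := h.exists_aeval_eq hm Q
  refine ⟨P', Q', h1.trans (le_max_left _ _), h3.trans (le_max_right _ _), ?_, ?_⟩
  · rintro rfl
    rw [map_zero, eq_comm, h.aeval_eq_zero_iff] at h4
    exact hQ h4
  · rw [h2, h4, ha]

/-- An element which is a constant times arbitrarily high powers is a constant times a Laurent
monomial. -/
lemma exists_eq_mul_laurentMonomial [CharZero k] (h : IsPowerTower f e) {a : K} (ha : a ≠ 0)
    (hpow : ∀ N, ∃ n ≥ N, ∃ (c : k) (z : K), a = algebraMap k K c * z ^ n) :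
    ∃ m u, ∃ c ≠ 0, a = algebraMap k K c * laurentMonomial (e m) u := by
  obtain ⟨n, s, hs⟩ := h.exists_eq_of_le a
  obtain ⟨N, hN, c, z, hz⟩ := hpow (s + 1)
  obtain ⟨n', s', hs'⟩ := h.exists_eq_of_le z
  obtain ⟨P, Q, hPs, hQs, hQ, hPQ⟩ := hs (max n n') (le_max_left _ _)
  obtain ⟨B, D, -, -, hD, hBD⟩ := hs' (max n n') (le_max_right _ _)
  set m := max n n'
  have hc : c ≠ 0 := by
    rintro rfl
    exact ha (by rw [hz, map_zero, zero_mul])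
  have hz0 : z ≠ 0 := by
    rintro rfl
    exact ha (by rw [hz, zero_pow (by omega), mul_zero])
  have hQ' : aeval (e m) Q ≠ 0 := h.aeval_eq_zero_iff.not.2 hQ
  have hD' : aeval (e m) D ≠ 0 := h.aeval_eq_zero_iff.not.2 hD
  have hP : P ≠ 0 := by
    rw [ne_eq, ← h.aeval_eq_zero_iff (n := m), ← hPQ]
    exact mul_ne_zero ha hQ'
  have hB : B ≠ 0 := by
    rw [ne_eq, ← h.aeval_eq_zero_iff (n := m), ← hBD]
    exact mul_ne_zero hz0 hD'
  have hCQ : (C c * Q).support.card ≤ N := by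
    rw [C_mul', support_smul_eq hc]
    omega
  obtain ⟨u, w, d, hd, hmon⟩ := exists_mul_monomial_eq_of_mul_pow_eq hP
    (mul_ne_zero (C_ne_zero.2 hc) hQ) hB hD (by omega) hCQ (h.indep m (by
      simp only [map_mul, map_pow, ← hPQ, ← hBD, hz, algHom_C, mul_pow]
      ring))
  refine ⟨m, _, c * d, mul_ne_zero hc hd, eq_mul_laurentMonomial_of_mul_monomial_eq (h.indep m)
    hQ hPQ (u := u) (w := w) ?_⟩
  rw [hmon, mul_right_comm, mul_comm _ Q, C_mul_monomial]

/-- A root of a Laurent monomial is a Laurent monomial. -/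
lemma exists_eq_of_pow_eq (h : IsPowerTower f e) {N : ℕ} (hN : N ≠ 0) {z : K} {m : ℕ}
    {c : k} (hc : c ≠ 0) {u : J →₀ ℤ} (hz : z ^ N = algebraMap k K c * laurentMonomial (e m) u) (L : ℕ) :
    ∃ M ≥ L, ∃ w, ∃ d ≠ 0, z = algebraMap k K d * laurentMonomial (e M) w := by
  have hlift : ∀ M ≥ m, ∃ c' ≠ 0, ∃ u', algebraMap k K c * laurentMonomial (e m) u =
      algebraMap k K c' * laurentMonomial (e M) u' := by
    intro M hM
    induction M, hM using Nat.le_induction with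
    | base => exact ⟨c, hc, u, rfl⟩
    | succ M hM ih =>
      obtain ⟨c', hc', u', h'⟩ := ih
      refine ⟨c' * laurentMonomial f u', mul_ne_zero hc' (laurentMonomial_ne_zero h.ne_zero _),
        (M + 2) • u', ?_⟩
      rw [h', h.laurentMonomial_step, map_mul, mul_assoc]
  obtain ⟨n, s, hs⟩ := h.exists_eq_of_le z
  obtain ⟨R, T, -, -, hT, hRT⟩ := hs (max n (max m L)) (by simp)
  obtain ⟨c', hc', u', hu'⟩ := hlift (max n (max m L)) (by simp)
  set M := max n (max m L) with hM
  rw [hu'] at hz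
  have hz0 : z ≠ 0 := by
    rintro rfl
    rw [zero_pow hN, eq_comm, mul_eq_zero] at hz
    exact hz.elim (by simpa using hc') (laurentMonomial_ne_zero (h.e_ne_zero _) _)
  have hR : R ≠ 0 := by
    rw [ne_eq, ← h.aeval_eq_zero_iff (n := M), ← hRT]
    exact mul_ne_zero hz0 (h.aeval_eq_zero_iff.not.2 hT)
  set p : J →₀ ℕ := u'.mapRange Int.toNat rfl
  set q : J →₀ ℕ := (-u').mapRange Int.toNat rfl
  have hpq : u' + q.mapRange (Nat.cast : ℕ → ℤ) rfl = p.mapRange (Nat.cast : ℕ → ℤ) rfl := by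
    ext j
    simp only [p, q, Finsupp.add_apply, Finsupp.mapRange_apply, Finsupp.neg_apply]
    omega
  obtain ⟨a, b, d, hd, hmon⟩ := exists_mul_monomial_eq_of_pow_mul_eq hN hR hT one_ne_zero hc'
    (u := q) (w := p) (h.indep M (by
      rw [map_mul, map_pow, ← hRT, mul_pow, hz, map_mul, map_pow,
        aeval_monomial_eq_laurentMonomial, aeval_monomial_eq_laurentMonomial, ← hpq,
        laurentMonomial_add (h.e_ne_zero _), map_one]
      ring))
  exact ⟨M, by omega, _, d, hd,
    eq_mul_laurentMonomial_of_mul_monomial_eq (h.indep M) hT hRT hmon⟩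

lemma exists_root_of_exists_root (h : IsPowerTower f e) {c : k} (hc : c ≠ 0) {N : ℕ} (hN : N ≠ 0)
    (hz : ∃ z, algebraMap k K c = z ^ N) : ∃ d, c = d ^ N := by
  obtain ⟨z, hz⟩ := hz
  obtain ⟨M, -, w, d, hd, rfl⟩ := h.exists_eq_of_pow_eq hN (m := 0) (u := 0) hc
    (by rw [laurentMonomial_zero, mul_one, hz]) 0
  refine ⟨d, ((h.indep M).eq_of_mul_laurentMonomial_eq (u := 0) (w := N • w) hc ?_).2⟩
  rw [laurentMonomial_zero, mul_one, hz, mul_pow, map_pow, laurentMonomial_nsmul (h.e_ne_zero _)]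

section Order

variable {ord : k → ℤ}

lemma _root_.ord_one_of_mul (hord : ∀ a b, a ≠ 0 → b ≠ 0 → ord (a * b) = ord a + ord b) :
    ord 1 = 0 := by
  have := hord 1 1 one_ne_zero one_ne_zero
  rw [mul_one] at this
  omega

lemma _root_.ord_pow_of_mul (hord : ∀ a b, a ≠ 0 → b ≠ 0 → ord (a * b) = ord a + ord b)
    {a : k} (ha : a ≠ 0) (n : ℕ) : ord (a ^ n) = n * ord a := by
  induction n with
  | zero => simp [ord_one_of_mul hord]
  | succ n ih =>
    rw [pow_succ, hord _ _ (pow_ne_zero _ ha) ha, ih]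
    push_cast
    ring

lemma _root_.ord_zpow_of_mul (hord : ∀ a b, a ≠ 0 → b ≠ 0 → ord (a * b) = ord a + ord b)
    {a : k} (ha : a ≠ 0) (n : ℤ) : ord (a ^ n) = n * ord a := by
  obtain ⟨m, rfl | rfl⟩ := n.eq_nat_or_neg
  · rw [zpow_natCast, ord_pow_of_mul hord ha]
  · rw [zpow_neg, zpow_natCast]
    have := hord _ _ (pow_ne_zero m ha) (inv_ne_zero (pow_ne_zero m ha))
    rw [mul_inv_cancel₀ (pow_ne_zero m ha), ord_one_of_mul hord, ord_pow_of_mul hord ha] at this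
    linarith

lemma _root_.ord_laurentMonomial_of_mul
    (hord : ∀ a b, a ≠ 0 → b ≠ 0 → ord (a * b) = ord a + ord b)
    {x : J → k} (hx : ∀ j, x j ≠ 0) (u : J →₀ ℤ) :
    ord (laurentMonomial x u) = u.sum fun j z => z * ord (x j) := by
  induction u using Finsupp.induction with
  | zero => simp [ord_one_of_mul hord]
  | single_add j z u hj hz ih =>
    classical
    rw [laurentMonomial_add hx, hord _ _ (laurentMonomial_ne_zero hx _)
      (laurentMonomial_ne_zero hx _), ih, laurentMonomial_single, ord_zpow_of_mul hord (hx j),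
      Finsupp.sum_add_index' (by simp) (by intros; ring), Finsupp.sum_single_index (by simp)]

end Order

/-- If `s` behaves like a bottom element of the tower attached to `F ∈ k`, then it is a Laurent
monomial, and every discrete valuation of `k` links its exponents to `F`. -/
lemma exists_eq_and_sum_ord_eq [CharZero k] (h : IsPowerTower f e) {s : K} (hs : s ≠ 0) {F : k}
    (hF : F ≠ 0)
    (hroot : ∀ n, ∃ z, s = algebraMap k K F ^ factorialSum n * z ^ (n + 1).factorial) :
    ∃ m u, ∃ c ≠ 0, s = algebraMap k K c * laurentMonomial (e m) u ∧
      ∀ ord : k → ℤ, (∀ a b, a ≠ 0 → b ≠ 0 → ord (a * b) = ord a + ord b) →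
        (u.sum fun j z => z * ord (f j)) = (m + 1).factorial * ord F := by
  obtain ⟨m, u, c, hc, hsc⟩ := h.exists_eq_mul_laurentMonomial hs (fun N => by
    obtain ⟨z, hz⟩ := hroot N
    refine ⟨(N + 1).factorial, by linarith [Nat.self_le_factorial (N + 1)],
      F ^ factorialSum N, z, by rw [hz, map_pow]⟩)
  refine ⟨m, u, c, hc, hsc, fun ord hord => ?_⟩
  set φ := u.sum fun j z => z * ord (f j) with hφ
  have key : ∀ n ≥ m, ((n + 1).factorial : ℤ) ∣
      ((m + 1).factorial * ord c - factorialSum m * φ) +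
        factorialSum n * (φ - (m + 1).factorial * ord F) := by
    intro n hn
    obtain ⟨z, hz⟩ := hroot n
    have hFn : F ^ factorialSum n ≠ 0 := pow_ne_zero _ hF
    have hFK : algebraMap k K F ≠ 0 := by simpa using hF
    obtain ⟨M, hM, w, d, hd, hzd⟩ := h.exists_eq_of_pow_eq (Nat.factorial_ne_zero (n + 1))
      (z := z) (m := m) (c := c * (F ^ factorialSum n)⁻¹) (u := u)
      (mul_ne_zero hc (inv_ne_zero hFn)) (by
        rw [map_mul, map_inv₀, map_pow, mul_right_comm, ← hsc, hz]
        field_simp) n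
    have hlev : algebraMap k K (laurentMonomial f u ^ factorialSum m) *
        laurentMonomial (e m) u ^ (m + 1).factorial =
        algebraMap k K (laurentMonomial f u ^ factorialSum M) *
          laurentMonomial (e M) ((M + 1).factorial • u) := by
      rw [← laurentMonomial_nsmul (h.e_ne_zero _), ← h.laurentMonomial_zero_level,
        ← h.laurentMonomial_zero_level]
    have hfu : laurentMonomial f u ≠ 0 := laurentMonomial_ne_zero h.ne_zero u
    obtain ⟨-, hconst⟩ := (h.indep M).eq_of_mul_laurentMonomial_eq
      (c := c ^ (m + 1).factorial * laurentMonomial f u ^ factorialSum M)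
      (u := (M + 1).factorial • u)
      (d := laurentMonomial f u ^ factorialSum m *
        (F ^ factorialSum n * d ^ (n + 1).factorial) ^ (m + 1).factorial)
      (w := (m + 1).factorial • ((n + 1).factorial • w))
      (mul_ne_zero (pow_ne_zero _ hc) (pow_ne_zero _ hfu)) (by
        have h1 := congrArg (fun x => algebraMap k K (laurentMonomial f u ^ factorialSum m) *
          x ^ (m + 1).factorial) (hsc.symm.trans hz)
        simp only [mul_pow] at h1
        rw [mul_left_comm, hlev] at h1
        rw [map_mul, map_pow, mul_assoc, h1, laurentMonomial_nsmul (h.e_ne_zero _),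
          laurentMonomial_nsmul (h.e_ne_zero _), hzd]
        simp only [map_mul, map_pow, mul_pow]
        ring)
    have h2 := congrArg ord hconst
    have hp : ∀ (x : k), x ≠ 0 → ∀ n : ℕ, ord (x ^ n) = n * ord x :=
      fun x hx n => ord_pow_of_mul hord hx n
    rw [hord _ _ (pow_ne_zero _ hc) (pow_ne_zero _ hfu), hp _ hc, hp _ hfu,
      hord _ _ (pow_ne_zero _ hfu)
        (pow_ne_zero _ (mul_ne_zero hFn (pow_ne_zero _ hd))), hp _ hfu,
      hp _ (mul_ne_zero hFn (pow_ne_zero _ hd)), hord _ _ hFn (pow_ne_zero _ hd), hp _ hF, hp _ hd,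
      ord_laurentMonomial_of_mul hord h.ne_zero, ← hφ] at h2
    obtain ⟨t, ht⟩ := factorialSum_modEq hM
    refine ⟨(m + 1).factorial * ord d - t * φ, ?_⟩
    linear_combination h2 - φ * ht
  have h3 := (eq_zero_of_factorial_dvd_add_factorialSum_mul key).1
  omega

/-- An element with all roots, whose constant part is seen by enough valuations, is an element of
`k` with all roots. -/
lemma exists_eq_algebraMap_of_forall_root [CharZero k] (h : IsPowerTower f e) {s : K} (hs : s ≠ 0)
    (hroot : ∀ N ≠ 0, ∃ z, s = z ^ N)
    (hsep : ∀ j, ∃ ord : k → ℤ, (∀ a b, a ≠ 0 → b ≠ 0 → ord (a * b) = ord a + ord b) ∧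
      ∀ i, ord (f i) ≠ 0 ↔ i = j) :
    ∃ c : k, c ≠ 0 ∧ s = algebraMap k K c ∧ ∀ N ≠ 0, ∃ z, c = z ^ N := by
  obtain ⟨m, u, c, hc, hsc, hsum⟩ := h.exists_eq_and_sum_ord_eq hs one_ne_zero (fun n => by
    obtain ⟨z, hz⟩ := hroot (n + 1).factorial (Nat.factorial_ne_zero _)
    exact ⟨z, by simpa using hz⟩)
  have hu : u = 0 := by
    ext j
    obtain ⟨ord, hord, hj⟩ := hsep j
    have h1 := hsum ord hord
    rw [ord_one_of_mul hord, mul_zero, Finsupp.sum_eq_single j, mul_eq_zero] at h1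
    · exact h1.resolve_right ((hj j).2 rfl)
    · intro i _ hij
      rw [not_not.1 ((hj i).not.2 hij), mul_zero]
    · simp
  subst hu
  rw [laurentMonomial_zero, mul_one] at hsc
  refine ⟨c, hc, hsc, fun N hN => ?_⟩
  exact h.exists_root_of_exists_root hc hN (hsc ▸ hroot N hN)

end IsPowerTower

end

lemma Nat.Prime.eq_of_rat_mul_log_eq {p q : ℕ} (hp : p.Prime) (hq : q.Prime) {r : ℚ}
    (h : (r : ℝ) * Real.log p = Real.log q) : p = q := by
  have hp0 : 0 < Real.log p := Real.log_pos (by exact_mod_cast hp.one_lt)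
  have hq0 : 0 < Real.log q := Real.log_pos (by exact_mod_cast hq.one_lt)
  have hr : 0 < r := by
    have : (0 : ℝ) < r := pos_of_mul_pos_left (h ▸ hq0) hp0.le
    exact_mod_cast this
  obtain ⟨n, hn⟩ := Int.eq_ofNat_of_zero_le (Rat.num_pos.2 hr).le
  have hn0 : n ≠ 0 := by
    have := Rat.num_pos.2 hr
    omega
  have h1 : (n : ℝ) * Real.log p = r.den * Real.log q := by
    have h2 : (r : ℝ) = n / r.den := by
      rw [Rat.cast_def, hn]
      simp
    have h3 : (r.den : ℝ) ≠ 0 := by exact_mod_cast r.den_nz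
    rw [← h, h2]
    field_simp
  rw [← Real.log_pow, ← Real.log_pow] at h1
  have hp1 : (0 : ℝ) < p := by exact_mod_cast hp.pos
  have hq1 : (0 : ℝ) < q := by exact_mod_cast hq.pos
  have h2 : p ^ n = q ^ r.den := by
    exact_mod_cast Real.log_injOn_pos (Set.mem_Ioi.2 (pow_pos hp1 n))
      (Set.mem_Ioi.2 (pow_pos hq1 r.den)) h1
  exact (Nat.prime_dvd_prime_iff_eq hp hq).1
    (hp.dvd_of_dvd_pow (h2 ▸ dvd_pow_self p hn0))

/-- A generic embedding of a countable rational vector space into the real numbers that sends `w` to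
the logarithm of `p`. -/
lemma exists_linearMap_eq_log_iff {V : Type} [AddCommGroup V] [Module ℚ V] [Countable V] {w : V}
    (hw : w ≠ 0) {p : ℕ} (hp : p.Prime) :
    ∃ L : V →ₗ[ℚ] ℝ, Function.Injective L ∧
      ∀ v, ∀ q : ℕ, q.Prime → (L v = Real.log q ↔ v = w ∧ q = p) := by
  obtain ⟨T, hT⟩ : ∃ T : V →ₗ[ℚ] ℝ, Function.Injective T := by
    refine Module.Free.exists_linearMap_injective_of_rank_lt ?_
    rw [Real.rank_rat_real]
    exact (rank_le_card ℚ V).trans_lt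
      ((Cardinal.mk_le_aleph0_iff.2 inferInstance).trans_lt Cardinal.aleph0_lt_continuum)
  obtain ⟨l, hl⟩ := Module.Projective.exists_dual_eq_one ℚ hw
  have hlp : Real.log p ≠ 0 := (Real.log_pos (by exact_mod_cast hp.one_lt)).ne'
  obtain ⟨τ, hτ⟩ : ∃ τ : ℝ, τ ∉ Set.range fun x : V × ℕ =>
      (Real.log x.2 - l x.1 * Real.log p) / T (x.1 - l x.1 • w) := by
    by_contra! h
    exact Set.not_countable_univ ((Set.countable_range _).mono fun x _ => h x)
  have key : ∀ v, ∀ q : ℕ, l v * Real.log p + τ * T (v - l v • w) = Real.log q →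
      v = l v • w := by
    intro v q h
    by_contra hne
    have h1 : T (v - l v • w) ≠ 0 := by
      rw [Ne, map_eq_zero_iff T hT, sub_eq_zero]
      exact hne
    exact hτ ⟨(v, q), by simp only; rw [div_eq_iff h1]; linarith⟩
  let L : V →ₗ[ℚ] ℝ := (LinearMap.toSpanSingleton ℚ ℝ (Real.log p)).comp l +
    τ • T.comp (LinearMap.id - (LinearMap.toSpanSingleton ℚ V w).comp l)
  have hL : ∀ v, L v = l v * Real.log p + τ * T (v - l v • w) := by
    intro v
    simp [L, Rat.smul_def]
  refine ⟨L, ?_, fun v q hq => ⟨fun h => ?_, ?_⟩⟩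
  · rw [injective_iff_map_eq_zero]
    intro v hv
    rw [hL] at hv
    have h1 := key v 1 (by simpa using hv)
    rw [← h1, sub_self, map_zero, mul_zero, add_zero, mul_eq_zero] at hv
    rw [h1, Rat.cast_eq_zero.1 (hv.resolve_right hlp), zero_smul]
  · rw [hL] at h
    have h1 := key v q h
    rw [← h1, sub_self, map_zero, mul_zero, add_zero] at h
    obtain rfl := hp.eq_of_rat_mul_log_eq hq h
    have h2 : (l v : ℝ) = 1 := mul_right_cancel₀ hlp (by rw [h, one_mul])
    rw [show l v = 1 by exact_mod_cast h2, one_smul] at h1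
    exact ⟨h1, rfl⟩
  · rintro ⟨rfl, rfl⟩
    simp [hL, hl]

open PowerSeries in
/-- The order of a power series, as a Laurent series, is nonzero exactly when its constant
coefficient vanishes. -/
lemma PowerSeries.order_coe_ne_zero_iff {F : Type*} [Field F] {f : PowerSeries F} (hf : f ≠ 0) :
    HahnSeries.order (f : LaurentSeries F) ≠ 0 ↔ constantCoeff f = 0 := by
  have hf' : (f : LaurentSeries F) ≠ 0 := by
    rw [Ne, HahnSeries.ofPowerSeries_injective.eq_iff' (map_zero _)]
    exact hf
  have h1 := HahnSeries.coeff_order_eq_zero.not.2 hf'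
  constructor
  · intro h
    by_contra hc
    have h2 : (f : LaurentSeries F).coeff 0 ≠ 0 := by
      rw [PowerSeries.coeff_coe]
      simpa using hc
    have h3 := HahnSeries.order_le_of_coeff_ne_zero h2
    rw [PowerSeries.coeff_coe, if_pos (lt_of_le_of_ne h3 h)] at h1
    exact h1 rfl
  · intro hc h
    rw [h, PowerSeries.coeff_coe] at h1
    simp [hc] at h1

open PowerSeries in
/-- The exponential embedding of a rational group algebra in the ring of real power series. -/
noncomputable def AddMonoidAlgebra.expHom {V : Type*} [AddCommGroup V] [Module ℚ V]
    (L : V →ₗ[ℚ] ℝ) : AddMonoidAlgebra ℚ V →ₐ[ℚ] PowerSeries ℝ :=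
  AddMonoidAlgebra.lift ℚ (PowerSeries ℝ) V
    { toFun := fun v => C (Real.exp (L v.toAdd)) * rescale (L v.toAdd) (exp ℝ)
      map_one' := by simp [rescale_zero]
      map_mul' := fun v w => by
        rw [toAdd_mul, map_add, Real.exp_add, map_mul, ← exp_mul_exp_eq_exp_add]
        ring }

open PowerSeries in
lemma AddMonoidAlgebra.expHom_injective {V : Type*} [AddCommGroup V] [Module ℚ V]
    (L : V →ₗ[ℚ] ℝ) (hL : Function.Injective L) : Function.Injective (expHom L) := by
  rw [injective_iff_map_eq_zero]
  intro a ha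
  rw [expHom, AddMonoidAlgebra.lift_apply] at ha
  have hind : LinearIndependent ℝ fun v : V => (powersHom ℝ (L v) : Multiplicative ℕ → ℝ) :=
    (linearIndependent_monoidHom (Multiplicative ℕ) ℝ).comp (fun v => powersHom ℝ (L v))
      ((powersHom ℝ).injective.comp hL)
  have h0 := linearIndependent_iff'.1 hind a.coeff.support
    (fun v => (a.coeff v : ℝ) * Real.exp (L v)) (by
      ext n
      have h1 := congrArg (PowerSeries.coeff n.toAdd) ha
      simp only [Finsupp.sum, map_sum, map_zero] at h1
      simp only [Finset.sum_apply, Pi.smul_apply, powersHom_apply, smul_eq_mul, Pi.zero_apply]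
      have h2 : (n.toAdd.factorial : ℝ) ≠ 0 := by exact_mod_cast Nat.factorial_ne_zero _
      rw [← mul_left_inj' (inv_ne_zero h2), zero_mul, ← h1, Finset.sum_mul]
      refine Finset.sum_congr rfl fun v _ => ?_
      rw [Algebra.smul_def, PowerSeries.algebraMap_apply, coeff_C_mul]
      simp only [MonoidHom.coe_mk, OneHom.coe_mk, toAdd_ofAdd, coeff_C_mul, coeff_rescale, coeff_exp]
      simp
      ring)
  ext v
  by_contra hv
  have := h0 v (by simpa using hv)
  rw [mul_eq_zero] at this
  exact this.elim (fun h => hv (by simpa using h)) (Real.exp_ne_zero _)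


lemma exists_ord_fractionRing_ne_zero_iff {V : Type} [AddCommGroup V] [Module ℚ V] [Countable V]
    [IsDomain (AddMonoidAlgebra ℚ V)] {w : V} (hw : w ≠ 0) {p : ℕ} (hp : p.Prime) :
    ∃ ord : FractionRing (AddMonoidAlgebra ℚ V) → ℤ,
      (∀ a b, a ≠ 0 → b ≠ 0 → ord (a * b) = ord a + ord b) ∧
      ∀ v ≠ 0, ∀ q : ℕ, q.Prime →
        (ord (algebraMap (AddMonoidAlgebra ℚ V) _ (AddMonoidAlgebra.single v 1) - q) ≠ 0 ↔
          v = w ∧ q = p) := by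
  obtain ⟨L, hL, hLw⟩ := exists_linearMap_eq_log_iff hw hp
  have hinj : Function.Injective ((HahnSeries.ofPowerSeries ℤ ℝ).comp
      (AddMonoidAlgebra.expHom L).toRingHom) :=
    HahnSeries.ofPowerSeries_injective.comp (AddMonoidAlgebra.expHom_injective L hL)
  let φ : FractionRing (AddMonoidAlgebra ℚ V) →+* LaurentSeries ℝ := IsFractionRing.lift hinj
  refine ⟨fun a => (φ a).order, fun a b ha hb => ?_, fun v hv q hq => ?_⟩
  · simp only
    rw [map_mul, HahnSeries.order_mul ((map_ne_zero φ).2 ha) ((map_ne_zero φ).2 hb)]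
  · set a : AddMonoidAlgebra ℚ V := AddMonoidAlgebra.single v 1 - (q : AddMonoidAlgebra ℚ V) with ha
    have ha0 : AddMonoidAlgebra.expHom L a ≠ 0 := by
      rw [Ne, map_eq_zero_iff _ (AddMonoidAlgebra.expHom_injective L hL), ha, sub_eq_zero]
      intro h
      have h1 := congrArg (fun x : AddMonoidAlgebra ℚ V => x.coeff v) h
      rw [AddMonoidAlgebra.natCast_def] at h1
      simp [hv.symm] at h1
    have h1 : φ (algebraMap (AddMonoidAlgebra ℚ V) _ (AddMonoidAlgebra.single v 1) - q) =
        (AddMonoidAlgebra.expHom L a : PowerSeries ℝ) := by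
      rw [← map_natCast (algebraMap (AddMonoidAlgebra ℚ V) _), ← map_sub]
      exact IsFractionRing.lift_algebraMap hinj _
    simp only
    rw [h1, PowerSeries.order_coe_ne_zero_iff ha0, ← hLw v q hq, ha, map_sub, map_natCast, map_sub,
      sub_eq_zero, map_natCast]
    have hq0 : (0 : ℝ) < q := by exact_mod_cast hq.pos
    rw [← Real.exp_injective.eq_iff (a := L v), Real.exp_log hq0]
    have h2 : PowerSeries.constantCoeff (PowerSeries.rescale (L v) (PowerSeries.exp ℝ)) = 1 := by
      rw [← PowerSeries.coeff_zero_eq_constantCoeff_apply, PowerSeries.coeff_rescale]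
      simp
    simp [AddMonoidAlgebra.expHom, h2]

/-- The fraction field of the rational group algebra of `V`. -/
abbrev GroupAlgebraField (V : Type*) [AddCommGroup V] [IsDomain (AddMonoidAlgebra ℚ V)] : Type _ :=
  FractionRing (AddMonoidAlgebra ℚ V)

namespace GroupAlgebraField

section Basic

variable {V : Type*} [AddCommGroup V] [IsDomain (AddMonoidAlgebra ℚ V)]

instance : CharZero (GroupAlgebraField V) :=
  charZero_of_injective_algebraMap (algebraMap ℚ (GroupAlgebraField V)).injective

instance [Countable V] : Countable (GroupAlgebraField V) := by
  have h1 : Countable (AddMonoidAlgebra ℚ V) :=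
    Function.Injective.countable (β := V →₀ ℚ) (f := fun a => a.coeff)
      fun a b h => AddMonoidAlgebra.ext h
  have h2 : Function.Surjective fun x : AddMonoidAlgebra ℚ V × AddMonoidAlgebra ℚ V =>
      (algebraMap _ (GroupAlgebraField V) x.1 / algebraMap _ (GroupAlgebraField V) x.2) := by
    intro a
    obtain ⟨x, y, -, rfl⟩ := IsFractionRing.div_surjective (A := AddMonoidAlgebra ℚ V) a
    exact ⟨(x, y), rfl⟩
  exact h2.countable

/-- The monomial with exponent `v`. -/
noncomputable def monomial (v : V) : GroupAlgebraField V :=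
  algebraMap (AddMonoidAlgebra ℚ V) _ (AddMonoidAlgebra.single v 1)

@[simp] lemma monomial_zero : monomial (0 : V) = 1 := by
  rw [monomial, ← AddMonoidAlgebra.one_def, map_one]

lemma monomial_add (v w : V) : monomial (v + w) = monomial v * monomial w := by
  rw [monomial, monomial, monomial, ← map_mul, AddMonoidAlgebra.single_mul_single, one_mul]

lemma monomial_injective : Function.Injective (monomial : V → GroupAlgebraField V) := by
  intro v w h
  have h1 := IsFractionRing.injective (AddMonoidAlgebra ℚ V) (GroupAlgebraField V) h
  have h2 := congrArg (fun x => x.coeff) h1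
  simp only [AddMonoidAlgebra.coeff_single] at h2
  exact Finsupp.single_left_injective one_ne_zero h2

lemma monomial_ne_zero (v : V) : monomial v ≠ 0 := by
  rw [monomial, Ne, IsFractionRing.to_map_eq_zero_iff, AddMonoidAlgebra.single_eq_zero]
  exact one_ne_zero

lemma monomial_ne_natCast {v : V} (hv : v ≠ 0) (n : ℕ) : monomial v ≠ n := by
  intro h
  rw [monomial, ← map_natCast (algebraMap (AddMonoidAlgebra ℚ V) _)] at h
  have h1 := congrArg (fun x => x.coeff v)
    (IsFractionRing.injective (AddMonoidAlgebra ℚ V) (GroupAlgebraField V) h)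
  rw [AddMonoidAlgebra.natCast_def] at h1
  simp [hv.symm] at h1

lemma monomial_nsmul (n : ℕ) (v : V) : monomial (n • v) = monomial v ^ n := by
  rw [monomial, monomial, ← map_pow, AddMonoidAlgebra.single_pow, one_pow]

lemma monomial_zsmul (n : ℤ) (v : V) : monomial (n • v) = monomial v ^ n := by
  have hneg : ∀ w : V, monomial (-w) = (monomial w)⁻¹ := fun w =>
    eq_inv_of_mul_eq_one_left (by rw [← monomial_add, neg_add_cancel, monomial_zero])
  obtain ⟨m, rfl | rfl⟩ := n.eq_nat_or_neg
  · rw [natCast_zsmul, monomial_nsmul, zpow_natCast]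
  · rw [neg_smul, natCast_zsmul, hneg, monomial_nsmul, zpow_neg, zpow_natCast]

lemma exists_monomial_eq_pow [Module ℚ V] (v : V) {N : ℕ} (hN : N ≠ 0) :
    ∃ z, monomial v = z ^ N := by
  refine ⟨monomial ((N : ℚ)⁻¹ • v), ?_⟩
  rw [← monomial_nsmul, ← Nat.cast_smul_eq_nsmul ℚ, smul_smul,
    mul_inv_cancel₀ (by exact_mod_cast hN), one_smul]

lemma exists_laurentMonomial_eq_monomial {J : Type*} (w : J → V) (u : J →₀ ℤ) :
    ∃ v, laurentMonomial (fun j => monomial (w j)) u = monomial v := by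
  induction u using Finsupp.induction_linear with
  | zero => exact ⟨0, by simp⟩
  | add u₁ u₂ h₁ h₂ =>
    obtain ⟨v₁, h₁⟩ := h₁
    obtain ⟨v₂, h₂⟩ := h₂
    exact ⟨v₁ + v₂, by rw [laurentMonomial_add fun j => monomial_ne_zero _, h₁, h₂, monomial_add]⟩
  | single j z => exact ⟨z • w j, by rw [laurentMonomial_single, monomial_zsmul]⟩

/-- Two ring homomorphisms from `GroupAlgebraField V` agreeing on monomials are equal. -/
lemma ringHom_ext {R : Type*} [Field R] {φ ψ : GroupAlgebraField V →+* R}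
    (h : ∀ v, φ (monomial v) = ψ (monomial v)) : φ = ψ := by
  refine IsLocalization.ringHom_ext (nonZeroDivisors (AddMonoidAlgebra ℚ V)) ?_
  refine AddMonoidAlgebra.ringHom_ext (fun r => ?_) fun v => ?_
  · exact RingHom.congr_fun (Subsingleton.elim
      ((φ.comp (algebraMap (AddMonoidAlgebra ℚ V) _)).comp (algebraMap ℚ _))
      ((ψ.comp (algebraMap (AddMonoidAlgebra ℚ V) _)).comp (algebraMap ℚ _))) r
  · exact h v

/-- The ring homomorphism induced by an injective additive map of exponents. -/
noncomputable def map {W : Type*} [AddCommGroup W] [IsDomain (AddMonoidAlgebra ℚ W)] (α : V →+ W)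
    (hα : Function.Injective α) : GroupAlgebraField V →+* GroupAlgebraField W :=
  IsFractionRing.map (j := AddMonoidAlgebra.mapDomainRingHom ℚ α)
    (AddMonoidAlgebra.mapDomain_injective hα)

lemma map_monomial {W : Type*} [AddCommGroup W] [IsDomain (AddMonoidAlgebra ℚ W)] (α : V →+ W)
    (hα : Function.Injective α) (v : V) : map α hα (monomial v) = monomial (α v) := by
  unfold map monomial IsFractionRing.map
  rw [IsLocalization.map_eq]
  simp

end Basic

lemma _root_.Rat.eq_one_of_forall_root {c : ℚ} (hc : c ≠ 0) (h : ∀ N ≠ 0, ∃ d : ℚ, c = d ^ N) :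
    c = 1 := by
  have key : ∀ a : ℕ, a ≠ 0 → (∀ N ≠ 0, ∃ d : ℕ, a = d ^ N) → a = 1 := by
    intro a ha h
    obtain ⟨d, hd⟩ := h a ha
    have h2 : d < 2 := by
      by_contra! h3
      exact absurd (Nat.lt_two_pow_self (n := a))
        (not_lt.2 ((Nat.pow_le_pow_left h3 a).trans_eq hd.symm))
    interval_cases d
    · rw [zero_pow ha] at hd
      exact absurd hd ha
    · rwa [one_pow] at hd
  have hnum : c.num.natAbs = 1 := key _ (by simpa using hc) fun N hN => by
    obtain ⟨d, rfl⟩ := h N hN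
    exact ⟨d.num.natAbs, by rw [Rat.num_pow, Int.natAbs_pow]⟩
  have hden : c.den = 1 := key _ c.den_nz fun N hN => by
    obtain ⟨d, rfl⟩ := h N hN
    exact ⟨d.den, by rw [Rat.den_pow]⟩
  have hpos : 0 < c := by
    obtain ⟨d, rfl⟩ := h 2 two_ne_zero
    positivity
  have := Rat.num_pos.2 hpos
  rw [← Rat.num_div_den c, hden, show c.num = 1 by omega]
  norm_num

section Free

variable {G : Type*}

open MvPolynomial in
lemma isPowerTower : IsPowerTower (k := ℚ) (fun _ : G => 1) fun n g =>
    monomial (Finsupp.single g (((n + 1).factorial : ℚ)⁻¹)) where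
  ne_zero _ := one_ne_zero
  indep n := by
    let ι : (G →₀ ℕ) →+ (G →₀ ℚ) := Finsupp.mapRange.addMonoidHom
      ((AddMonoidHom.mulLeft ((n + 1).factorial : ℚ)⁻¹).comp (Nat.castAddMonoidHom ℚ))
    have hι : Function.Injective ι := by
      refine Finsupp.mapRange_injective _ (map_zero _) fun a b h => ?_
      have h1 : ((n + 1).factorial : ℚ)⁻¹ ≠ 0 :=
        inv_ne_zero (by exact_mod_cast Nat.factorial_ne_zero _)
      simpa [h1] using h
    have h1 : aeval (fun g : G => monomial (Finsupp.single g (((n + 1).factorial : ℚ)⁻¹))) =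
        (IsScalarTower.toAlgHom ℚ (AddMonoidAlgebra ℚ (G →₀ ℚ)) (GroupAlgebraField (G →₀ ℚ))).comp
          (AddMonoidAlgebra.mapDomainAlgHom ℚ ℚ ι) := by
      refine MvPolynomial.algHom_ext fun g => ?_
      rw [aeval_X]
      simp [monomial, X, MvPolynomial.monomial, ι]
    rw [AlgebraicIndependent, h1]
    exact (IsFractionRing.injective _ _).comp (AddMonoidAlgebra.mapDomain_injective hι)
  step n g := by
    rw [map_one, one_mul, ← monomial_nsmul, Finsupp.smul_single, nsmul_eq_mul,
      Nat.factorial_succ (n + 1)]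
    congr 2
    have h1 : ((n + 1).factorial : ℚ) ≠ 0 := by exact_mod_cast Nat.factorial_ne_zero _
    push_cast
    field_simp
    ring
  exists_eq a := by
    let F : ℕ → IntermediateField ℚ (GroupAlgebraField (G →₀ ℚ)) := fun n =>
      IntermediateField.adjoin ℚ (Set.range fun g : G =>
        monomial (Finsupp.single g (((n + 1).factorial : ℚ)⁻¹)))
    suffices h : ∃ n, a ∈ F n by
      obtain ⟨n, hn⟩ := h
      obtain ⟨P, Q, hPQ⟩ := (IntermediateField.mem_adjoin_range_iff ℚ _ a).1 hn
      by_cases hQ : aeval (fun g : G =>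
          monomial (Finsupp.single g (((n + 1).factorial : ℚ)⁻¹))) Q = 0
      · exact ⟨n, 0, 1, one_ne_zero, by rw [hPQ, hQ]; simp⟩
      · exact ⟨n, P, Q, fun h => hQ (by rw [h, map_zero]), by rw [hPQ, div_mul_cancel₀ _ hQ]⟩
    have hF : Monotone F := by
      refine monotone_nat_of_le_succ fun n => ?_
      refine IntermediateField.adjoin_le_iff.2 ?_
      rintro _ ⟨g, rfl⟩
      have h1 : Finsupp.single g (((n + 1).factorial : ℚ)⁻¹) =
          (n + 2) • Finsupp.single g (((n + 1 + 1).factorial : ℚ)⁻¹) := by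
        rw [Finsupp.smul_single, nsmul_eq_mul, Nat.factorial_succ (n + 1)]
        congr 1
        have h1 : ((n + 1).factorial : ℚ) ≠ 0 := by exact_mod_cast Nat.factorial_ne_zero _
        push_cast
        field_simp
        ring
      simp only [SetLike.mem_coe]
      rw [h1, monomial_nsmul]
      exact pow_mem (IntermediateField.subset_adjoin _ _ (Set.mem_range_self g)) _
    have hmem : ∀ b, b ∈ ⨆ n, F n ↔ ∃ n, b ∈ F n := by
      intro b
      rw [← SetLike.mem_coe, IntermediateField.coe_iSup_of_directed hF.directed_le]
      simp
    rw [← hmem]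
    have hmono : ∀ v, monomial v ∈ ⨆ n, F n := by
      intro v
      induction v using Finsupp.induction_linear with
      | zero => rw [monomial_zero]; exact one_mem _
      | add v w hv hw => rw [monomial_add]; exact mul_mem hv hw
      | single g q =>
        obtain ⟨d, hd⟩ := Nat.dvd_factorial q.den_pos (Nat.le_succ q.den)
        have h1 : Finsupp.single g q =
            (q.num * d) • Finsupp.single g (((q.den + 1).factorial : ℚ)⁻¹) := by
          rw [Finsupp.smul_single, zsmul_eq_mul, hd]
          congr 1
          have h2 : (d : ℚ) ≠ 0 := by
            rintro h
            rw [Nat.cast_eq_zero.1 h, mul_zero] at hd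
            exact Nat.factorial_ne_zero _ hd
          have h3 : (q.den : ℚ) ≠ 0 := by exact_mod_cast q.den_nz
          nth_rewrite 1 [← Rat.num_div_den q]
          push_cast
          field_simp
        rw [h1, monomial_zsmul]
        exact zpow_mem ((hmem _).2 ⟨q.den, IntermediateField.subset_adjoin _ _ ⟨g, rfl⟩⟩) _
    have halg : ∀ b : AddMonoidAlgebra ℚ (G →₀ ℚ),
        algebraMap _ (GroupAlgebraField (G →₀ ℚ)) b ∈ ⨆ n, F n := by
      intro b
      induction b using AddMonoidAlgebra.induction_on with
      | of v => exact hmono v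
      | add x y hx hy => rw [map_add]; exact add_mem hx hy
      | smul r x hx =>
        have h1 := eq_ratCast ((algebraMap (AddMonoidAlgebra ℚ (G →₀ ℚ))
          (GroupAlgebraField (G →₀ ℚ))).comp (algebraMap ℚ _)) r
        rw [Algebra.smul_def, map_mul, ← RingHom.comp_apply, h1]
        exact mul_mem (SubfieldClass.ratCast_mem _ r) hx
    obtain ⟨x, y, -, rfl⟩ := IsFractionRing.div_surjective (A := AddMonoidAlgebra ℚ (G →₀ ℚ)) a
    exact div_mem (halg x) (halg y)

/-- The elements of `GroupAlgebraField (G →₀ ℚ)` with roots of all orders are the monomials. -/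
lemma exists_eq_monomial_of_forall_root {c : GroupAlgebraField (G →₀ ℚ)} (hc : c ≠ 0)
    (hroot : ∀ N ≠ 0, ∃ z, c = z ^ N) : ∃ v, c = monomial v := by
  obtain ⟨m, u, q, hq, h⟩ := isPowerTower.exists_eq_mul_laurentMonomial hc fun N => by
    obtain ⟨z, hz⟩ := hroot (N + 1) N.succ_ne_zero
    exact ⟨N + 1, N.le_succ, 1, z, by rw [map_one, one_mul, hz]⟩
  obtain ⟨v, hv⟩ := exists_laurentMonomial_eq_monomial
    (fun g : G => Finsupp.single g (((m + 1).factorial : ℚ)⁻¹)) u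
  rw [hv] at h
  have hq1 : q = 1 := by
    refine Rat.eq_one_of_forall_root hq fun N hN => ?_
    refine isPowerTower.exists_root_of_exists_root (J := G) hq hN ?_
    obtain ⟨z, hz⟩ := hroot N hN
    obtain ⟨y, hy⟩ := exists_monomial_eq_pow v hN
    exact ⟨z / y, by rw [div_pow, ← hz, ← hy, h, mul_div_cancel_right₀ _ (monomial_ne_zero v)]⟩
  exact ⟨v, by rw [h, hq1, map_one, one_mul]⟩

end Free

end GroupAlgebraField

/-- The sequential colimit of a sequence of endomorphisms of a field. -/
lemma exists_field_colimit {L : Type} [Field L] (φ : ℕ → L →+* L) :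
    ∃ (K : Type) (_ : Field K) (ι : ℕ → L →+* K),
      (∀ n x, ι (n + 1) (φ n x) = ι n x) ∧ (∀ a, ∃ n x, a = ι n x) ∧
      ∀ g : ℕ → L →+* K, (∀ n x, g (n + 1) (φ n x) = g n x) →
        ∃ ψ : K →+* K, ∀ n x, ψ (ι n x) = g n x := by
  let comp : ℕ → ℕ → (L →+* L) := fun n d =>
    Nat.rec (RingHom.id L) (fun d ψ => (φ (n + d)).comp ψ) d
  have hcomp : ∀ n a b x, comp n (a + b) x = comp (n + a) b (comp n a x) := by
    intro n a b x
    induction b with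
    | zero => rfl
    | succ b ih =>
      change φ (n + (a + b)) (comp n (a + b) x) = φ (n + a + b) (comp (n + a) b (comp n a x))
      rw [ih, add_assoc]
  let T : ∀ n m : ℕ, n ≤ m → (L →+* L) := fun n m _ => comp n (m - n)
  have hT : DirectedSystem (fun _ : ℕ => L) (fun _ _ h => T _ _ h) :=
    { map_self := fun n x => by
        change comp n (n - n) x = x
        rw [Nat.sub_self]
        rfl
      map_map := fun c b a hab hbc x => by
        obtain ⟨i, rfl⟩ := Nat.exists_eq_add_of_le hab
        obtain ⟨j, rfl⟩ := Nat.exists_eq_add_of_le hbc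
        change comp (a + i) (a + i + j - (a + i)) (comp a (a + i - a) x) = comp a (a + i + j - a) x
        rw [Nat.add_sub_cancel_left, Nat.add_sub_cancel_left, add_assoc, Nat.add_sub_cancel_left,
          hcomp] }
  have hg : ∀ (K : Type) [Field K] (g : ℕ → L →+* K), (∀ n x, g (n + 1) (φ n x) = g n x) →
      ∀ n m h x, g m (T n m h x) = g n x := by
    intro K _ g hg n m h x
    obtain ⟨d, rfl⟩ := Nat.exists_eq_add_of_le h
    change g (n + d) (comp n (n + d - n) x) = g n x
    rw [Nat.add_sub_cancel_left]
    induction d with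
    | zero => rfl
    | succ d ih => exact (hg (n + d) _).trans (ih (Nat.le_add_right n d))
  refine ⟨DirectLimit (fun _ : ℕ => L) T, inferInstance, DirectLimit.Ring.of (fun _ : ℕ => L) T,
    fun n x => ?_, fun a => DirectLimit.exists_eq_mk T a, fun g h =>
      ⟨DirectLimit.Ring.lift (fun _ : ℕ => L) T _ g (hg _ g h), fun n x => rfl⟩⟩
  have h1 : φ n x = T n (n + 1) n.le_succ x := by
    change φ n x = comp n (n + 1 - n) x
    rw [Nat.add_sub_cancel_left]
    rfl
  rw [h1]
  exact DirectLimit.Ring.of_f (G := fun _ : ℕ => L) (f := T) n.le_succ x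

section

open MvPolynomial

lemma algebraicIndependent_C_mul_X_pow {J k : Type*} [Field k] {f : J → k} (hf : ∀ j, f j ≠ 0)
    {n : ℕ} (hn : n ≠ 0) :
    AlgebraicIndependent k fun j => (C (f j) * X j ^ n : MvPolynomial J k) := by
  let p : J → Polynomial k := fun j => Polynomial.C (f j) * Polynomial.X ^ n
  have hp : ∀ j, Transcendental k (p j) := by
    intro j
    refine Polynomial.transcendental _ ?_ ?_
    · rw [Polynomial.natDegree_C_mul_X_pow _ _ (hf j)]
      exact hn
    · simpa [p, Polynomial.leadingCoeff_C_mul_X_pow] using hf j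
  have := AlgebraicIndependent.polynomial_aeval_of_transcendental
    (MvPolynomial.algebraicIndependent_X J k) (f := p) hp
  simpa [p, MvPolynomial.algebraMap_eq] using this

/-- Every family of nonzero elements has a power tower, and the tower is functorial. -/
theorem exists_isPowerTower {J k : Type} [Field k] {f : J → k} (hf : ∀ j, f j ≠ 0) :
    ∃ (K : Type) (_ : Field K) (_ : Algebra k K) (e : ℕ → J → K), IsPowerTower f e ∧
      ∀ (θ : k →+* k) (π : J → J), Function.Injective π → (∀ j, θ (f j) = f (π j)) →
        ∃ ψ : K →+* K, (∀ c, ψ (algebraMap k K c) = algebraMap k K (θ c)) ∧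
          ∀ n j, ψ (e n j) = e n (π j) := by
  have hinj : ∀ n : ℕ, Function.Injective
      (aeval (R := k) fun j => (C (f j) * X j ^ (n + 2) : MvPolynomial J k)).toRingHom :=
    fun n => algebraicIndependent_C_mul_X_pow hf (by omega)
  let i : MvPolynomial J k →+* FractionRing (MvPolynomial J k) := algebraMap _ _
  have hi : Function.Injective i := IsFractionRing.injective _ _
  let φ : ℕ → FractionRing (MvPolynomial J k) →+* FractionRing (MvPolynomial J k) :=
    fun n => IsFractionRing.map (hinj n)
  have hφ : ∀ n P, φ n (i P) = i (aeval (fun j => C (f j) * X j ^ (n + 2)) P) := fun n P =>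
    IsLocalization.map_eq _ P
  obtain ⟨K, hK, ι, hι, hsurj, hlift⟩ := exists_field_colimit φ
  let A : Algebra k K := ((ι 0).comp (i.comp C)).toAlgebra
  have hA : ∀ n c, algebraMap k K c = ι n (i (C c)) := by
    intro n c
    induction n with
    | zero => rfl
    | succ n ih => rw [ih, ← hι, hφ, aeval_C, MvPolynomial.algebraMap_eq]
  have haeval : ∀ n P, aeval (fun j => ι n (i (X j))) P = ι n (i P) := by
    intro n P
    have : (aeval (R := k) fun j => ι n (i (X j))).toRingHom = (ι n).comp i :=
      MvPolynomial.ringHom_ext (fun c => by simp [hA n]) fun j => by simp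
    exact RingHom.congr_fun this P
  refine ⟨K, hK, A, fun n j => ι n (i (X j)), ⟨hf, fun n => ?_, fun n j => ?_, fun a => ?_⟩, ?_⟩
  · intro P Q h
    rw [haeval, haeval] at h
    exact hi ((ι n).injective h)
  · rw [hA (n + 1), ← map_pow, ← map_pow, ← map_mul, ← map_mul, ← hι, hφ, aeval_X]
  · obtain ⟨n, x, rfl⟩ := hsurj a
    obtain ⟨P, Q, hQ, rfl⟩ := IsFractionRing.div_surjective (A := MvPolynomial J k) x
    have hQ0 : Q ≠ 0 := nonZeroDivisors.ne_zero hQ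
    refine ⟨n, P, Q, hQ0, ?_⟩
    rw [haeval, haeval, ← map_mul, div_mul_cancel₀]
    exact (map_ne_zero_iff i hi).2 hQ0
  · intro θ π hπ hθ
    have hinj' : Function.Injective
        ((rename π).toRingHom.comp (MvPolynomial.map (σ := J) θ)) :=
      (rename_injective π hπ).comp (MvPolynomial.map_injective θ θ.injective)
    let ψ : FractionRing (MvPolynomial J k) →+* FractionRing (MvPolynomial J k) :=
      IsFractionRing.map hinj'
    have hψ : ∀ P, ψ (i P) = i (rename π (MvPolynomial.map θ P)) := fun P =>
      IsLocalization.map_eq _ P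
    have hcomm : ∀ n, (φ n).comp ψ = ψ.comp (φ n) := by
      intro n
      refine IsLocalization.ringHom_ext (nonZeroDivisors (MvPolynomial J k)) ?_
      refine MvPolynomial.ringHom_ext (fun c => ?_) fun j => ?_
      · change φ n (ψ (i (C c))) = ψ (φ n (i (C c)))
        rw [hψ, hφ, hφ, hψ]
        simp [MvPolynomial.algebraMap_eq]
      · change φ n (ψ (i (X j))) = ψ (φ n (i (X j)))
        rw [hψ, hφ, hφ, hψ]
        simp [hθ]
    obtain ⟨Ψ, hΨ⟩ := hlift (fun n => (ι n).comp ψ) fun n x => by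
      rw [RingHom.comp_apply, ← RingHom.comp_apply ψ, ← hcomm, RingHom.comp_apply, hι,
        RingHom.comp_apply]
    refine ⟨Ψ, fun c => ?_, fun n j => ?_⟩
    · rw [hA 0, hΨ, RingHom.comp_apply, hψ, map_C, rename_C, hA 0]
    · rw [hΨ, RingHom.comp_apply, hψ, map_X, rename_X]

namespace IsPowerTower

variable {J k K : Type*} [Field k] [Field K] [Algebra k K] {f : J → k} {e : ℕ → J → K}

lemma ringHom_ext (h : IsPowerTower f e) {R : Type*} [Field R] {φ ψ : K →+* R}
    (hk : ∀ c, φ (algebraMap k K c) = ψ (algebraMap k K c)) (he : ∀ n j, φ (e n j) = ψ (e n j)) :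
    φ = ψ := by
  have key : ∀ n (P : MvPolynomial J k), φ (aeval (e n) P) = ψ (aeval (e n) P) := by
    intro n P
    have : φ.comp (aeval (R := k) (e n)).toRingHom = ψ.comp (aeval (R := k) (e n)).toRingHom :=
      MvPolynomial.ringHom_ext (fun c => by simpa using hk c) fun j => by simpa using he n j
    exact RingHom.congr_fun this P
  ext a
  obtain ⟨n, P, Q, hQ, ha⟩ := h.exists_eq a
  have hQ' : φ (aeval (e n) Q) ≠ 0 := (map_ne_zero φ).2 (mt h.aeval_eq_zero_iff.1 hQ)
  refine mul_right_cancel₀ hQ' ?_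
  rw [← map_mul, ha, key, ← ha, map_mul, key]

lemma countable [Countable J] [Countable k] (h : IsPowerTower f e) : Countable K := by
  have h1 : Countable (MvPolynomial J k) :=
    Function.Injective.countable (β := (J →₀ ℕ) →₀ k) (f := AddMonoidAlgebra.coeff)
      fun a b h => AddMonoidAlgebra.ext h
  have h2 : Function.Surjective fun x : ℕ × MvPolynomial J k × MvPolynomial J k =>
      aeval (e x.1) x.2.1 / aeval (e x.1) x.2.2 := by
    intro a
    obtain ⟨n, P, Q, hQ, ha⟩ := h.exists_eq a
    exact ⟨(n, P, Q), (eq_div_of_mul_eq (mt h.aeval_eq_zero_iff.1 hQ) ha).symm⟩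
  exact h2.countable

end IsPowerTower

end

section ColoredVectors

lemma eq_of_single_add_single_eq {X : Type*} {g h g' h' : X} (hne : g ≠ h) (hne' : g' ≠ h') {a b : ℚ}
    (ha : a ≠ 0) (hb1 : b ≠ 1)
    (H : Finsupp.single g 1 + Finsupp.single h a = Finsupp.single g' 1 + Finsupp.single h' b) :
    g = g' ∧ h = h' ∧ a = b := by
  classical
  have hg := DFunLike.congr_fun H g
  have hh := DFunLike.congr_fun H h
  simp only [Finsupp.add_apply, Finsupp.single_apply] at hg hh
  grind

variable {G : Type*} [Group G]

/-- The graph of the coloured Cayley graph of `G`, encoded by vectors labelled with primes: the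
basis vectors have label `2`, and the edge from `g` to `h` is a vector with label `3` in which the
colour `c (g⁻¹ * h)` appears as a coefficient. -/
def coloredVectors (c : G → ℕ) : Set ((G →₀ ℚ) × ℕ) :=
  {x | (∃ g, x = (Finsupp.single g 1, 2)) ∨
    ∃ g h, g ≠ h ∧ x = (Finsupp.single g 1 + Finsupp.single h (c (g⁻¹ * h) : ℚ), 3)}

variable {c : G → ℕ}

lemma prime_of_mem_coloredVectors {x : (G →₀ ℚ) × ℕ} (hx : x ∈ coloredVectors c) :
    x.2.Prime := by
  obtain ⟨g, rfl⟩ | ⟨g, h, -, rfl⟩ := hx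
  exacts [Nat.prime_two, Nat.prime_three]

lemma ne_zero_of_mem_coloredVectors {x : (G →₀ ℚ) × ℕ} (hx : x ∈ coloredVectors c) :
    x.1 ≠ 0 := by
  obtain ⟨g, rfl⟩ | ⟨g, h, hne, rfl⟩ := hx <;> intro h0 <;> have := DFunLike.congr_fun h0 g
  · simp at this
  · simp [hne.symm] at this

lemma mapDomain_mem_coloredVectors (γ : G) {x : (G →₀ ℚ) × ℕ} (hx : x ∈ coloredVectors c) :
    (Finsupp.mapDomain (γ * ·) x.1, x.2) ∈ coloredVectors c := by
  obtain ⟨g, rfl⟩ | ⟨g, h, hne, rfl⟩ := hx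
  · exact Or.inl ⟨γ * g, by simp [Finsupp.mapDomain_single]⟩
  · refine Or.inr ⟨γ * g, γ * h, by simpa using hne, ?_⟩
    simp [Finsupp.mapDomain_add, Finsupp.mapDomain_single, mul_assoc]

/-- Injective additive maps preserving the coloured vectors come from left translations. -/
lemma exists_eq_mapDomain_of_mem_coloredVectors (hc : Function.Injective c) (hc2 : ∀ g, 2 ≤ c g)
    (α : (G →₀ ℚ) →+ (G →₀ ℚ)) (hα : Function.Injective α)
    (h : ∀ x ∈ coloredVectors c, (α x.1, x.2) ∈ coloredVectors c) :
    ∃ γ : G, ∀ v, α v = Finsupp.mapDomain (γ * ·) v := by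
  have hbasis : ∀ g, ∃ g', α (Finsupp.single g 1) = Finsupp.single g' 1 := by
    intro g
    obtain ⟨g', hg'⟩ | ⟨_, _, -, hg'⟩ := h _ (Or.inl ⟨g, rfl⟩)
    · exact ⟨g', congrArg Prod.fst hg'⟩
    · exact absurd (congrArg Prod.snd hg') (by norm_num)
  choose π hπ using hbasis
  have hedge : ∀ g h', g ≠ h' → (π g)⁻¹ * π h' = g⁻¹ * h' := by
    intro g h' hne
    have hne' : π g ≠ π h' := by
      intro heq
      have := hα ((hπ g).trans (heq ▸ (hπ h').symm))
      exact hne (Finsupp.single_left_injective one_ne_zero this)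
    have hsingle : Finsupp.single h' (c (g⁻¹ * h') : ℚ) =
        c (g⁻¹ * h') • Finsupp.single h' (1 : ℚ) := by simp
    obtain ⟨_, hx⟩ | ⟨x, y, hxy, hx⟩ := h _ (Or.inr ⟨g, h', hne, rfl⟩)
    · exact absurd (congrArg Prod.snd hx) (by norm_num)
    · have h1 := congrArg Prod.fst hx
      simp only at h1
      rw [map_add, hπ, hsingle, map_nsmul, hπ, Finsupp.smul_single, nsmul_one] at h1
      have h2 := hc2 (g⁻¹ * h')
      have h3 := hc2 (x⁻¹ * y)
      obtain ⟨rfl, rfl, h4⟩ := eq_of_single_add_single_eq hne' hxy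
        (by norm_cast; omega) (by norm_cast; omega) h1
      exact (hc (by exact_mod_cast h4)).symm
  refine ⟨π 1, fun v => ?_⟩
  have hlin : α.toRatLinearMap = Finsupp.lmapDomain ℚ ℚ (π 1 * ·) := by
    refine Finsupp.lhom_ext' fun g => LinearMap.ext_ring ?_
    change α (Finsupp.single g 1) = Finsupp.mapDomain _ (Finsupp.single g 1)
    rw [hπ, Finsupp.mapDomain_single]
    congr 1
    by_cases hg : 1 = g
    · rw [← hg, mul_one]
    · have := hedge 1 g hg
      rw [inv_one, one_mul] at this
      exact inv_mul_eq_iff_eq_mul.1 this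
  exact LinearMap.congr_fun hlin v

end ColoredVectors

/-- The element of `GroupAlgebraField (G →₀ ℚ)` attached to a coloured vector. -/
noncomputable def coloredElement {G : Type*} [Group G] (c : G → ℕ) (j : coloredVectors c) :
    GroupAlgebraField (G →₀ ℚ) :=
  GroupAlgebraField.monomial j.1.1 - (j.1.2 : GroupAlgebraField (G →₀ ℚ))

lemma coloredElement_ne_zero {G : Type*} [Group G] {c : G → ℕ} (j : coloredVectors c) :
    coloredElement c j ≠ 0 :=
  sub_ne_zero.2 (GroupAlgebraField.monomial_ne_natCast (ne_zero_of_mem_coloredVectors j.2) _)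

section Automorphisms

open GroupAlgebraField

variable {G : Type} [Group G] [Countable G] {c : G → ℕ}

lemma exists_ord_coloredElement {w : G →₀ ℚ} (hw : w ≠ 0) {p : ℕ} (hp : p.Prime) :
    ∃ ord : GroupAlgebraField (G →₀ ℚ) → ℤ,
      (∀ a b, a ≠ 0 → b ≠ 0 → ord (a * b) = ord a + ord b) ∧
      ord (monomial w - (p : GroupAlgebraField (G →₀ ℚ))) ≠ 0 ∧
      ∀ j : coloredVectors c, ord (coloredElement c j) ≠ 0 ↔ j.1 = (w, p) := by
  obtain ⟨ord, hmul, h⟩ := exists_ord_fractionRing_ne_zero_iff hw hp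
  refine ⟨ord, hmul, (h w hw p hp).2 ⟨rfl, rfl⟩, fun j => ?_⟩
  rw [Prod.ext_iff]
  exact h j.1.1 (ne_zero_of_mem_coloredVectors j.2) j.1.2 (prime_of_mem_coloredVectors j.2)

variable {K : Type} [Field K] [Algebra (GroupAlgebraField (G →₀ ℚ)) K]
  {e : ℕ → coloredVectors c → K}

/-- Over `GroupAlgebraField (G →₀ ℚ)`, the elements with roots of all orders are the monomials. -/
lemma exists_eq_algebraMap_monomial (h : IsPowerTower (coloredElement c) e) {s : K} (hs : s ≠ 0)
    (hroot : ∀ N ≠ 0, ∃ z, s = z ^ N) :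
    ∃ v, s = algebraMap (GroupAlgebraField (G →₀ ℚ)) K (monomial v) := by
  obtain ⟨d, hd, hsd, hd'⟩ := h.exists_eq_algebraMap_of_forall_root hs hroot fun j => by
    obtain ⟨ord, h1, -, h2⟩ := exists_ord_coloredElement (c := c)
      (ne_zero_of_mem_coloredVectors j.2) (prime_of_mem_coloredVectors j.2)
    exact ⟨ord, h1, fun i => by rw [h2, Subtype.ext_iff]⟩
  obtain ⟨v, rfl⟩ := exists_eq_monomial_of_forall_root hd hd'
  exact ⟨v, hsd⟩

/-- Every endomorphism acts on the exponents of monomials by a left translation. -/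
lemma exists_forall_map_monomial_eq (hc : Function.Injective c) (hc2 : ∀ g, 2 ≤ c g)
    (h : IsPowerTower (coloredElement c) e) (σ : K →+* K) :
    ∃ γ : G, ∀ v, σ (algebraMap (GroupAlgebraField (G →₀ ℚ)) K (monomial v)) =
      algebraMap (GroupAlgebraField (G →₀ ℚ)) K (monomial (Finsupp.mapDomain (γ * ·) v)) := by
  have hinj : Function.Injective fun v => algebraMap (GroupAlgebraField (G →₀ ℚ)) K (monomial v) :=
    (algebraMap (GroupAlgebraField (G →₀ ℚ)) K).injective.comp monomial_injective
  have hex : ∀ v, ∃ w, σ (algebraMap (GroupAlgebraField (G →₀ ℚ)) K (monomial v)) =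
      algebraMap (GroupAlgebraField (G →₀ ℚ)) K (monomial w) := fun v =>
    exists_eq_algebraMap_monomial h
      (by rw [← RingHom.comp_apply]; exact (map_ne_zero _).2 (monomial_ne_zero v))
      fun N hN => by
        obtain ⟨z, hz⟩ := exists_monomial_eq_pow v hN
        exact ⟨σ (algebraMap _ K z), by rw [hz, map_pow, map_pow]⟩
  choose α₀ hα₀ using hex
  let α : (G →₀ ℚ) →+ (G →₀ ℚ) := AddMonoidHom.mk' α₀ fun v w => hinj (by
    simp only
    rw [← hα₀, monomial_add, monomial_add, map_mul, map_mul, map_mul, hα₀, hα₀])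
  have hα : Function.Injective α := fun v w hvw => hinj (σ.injective (by
    simp only
    rw [hα₀, hα₀]
    exact congrArg (fun x => algebraMap (GroupAlgebraField (G →₀ ℚ)) K (monomial x)) hvw))
  obtain ⟨γ, hγ⟩ := exists_eq_mapDomain_of_mem_coloredVectors hc hc2 α hα fun x hx => by
    have hx0 : α x.1 ≠ 0 := (map_ne_zero_iff α hα).2 (ne_zero_of_mem_coloredVectors hx)
    have hp := prime_of_mem_coloredVectors hx
    have hσF : σ (algebraMap _ K (coloredElement c ⟨x, hx⟩)) =
        algebraMap _ K (monomial (α x.1) - (x.2 : GroupAlgebraField (G →₀ ℚ))) := by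
      rw [coloredElement, map_sub, map_sub, map_sub, map_natCast, map_natCast, hα₀]
      rfl
    obtain ⟨ord, hmul, hF, hord⟩ := exists_ord_coloredElement (c := c) hx0 hp
    have hF0 : monomial (α x.1) - (x.2 : GroupAlgebraField (G →₀ ℚ)) ≠ 0 := by
      intro h0
      rw [h0, map_zero, ← RingHom.comp_apply, map_eq_zero] at hσF
      exact h.ne_zero _ hσF
    obtain ⟨m, u, -, -, -, hsum⟩ := h.exists_eq_and_sum_ord_eq
      ((map_ne_zero σ).2 (h.e_ne_zero 0 ⟨x, hx⟩)) hF0 fun n => by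
        have h1 := h.laurentMonomial_zero_level n (Finsupp.single ⟨x, hx⟩ 1)
        rw [Finsupp.smul_single, laurentMonomial_single, laurentMonomial_single,
          laurentMonomial_single, zpow_one, zpow_one, nsmul_one, zpow_natCast, map_pow] at h1
        exact ⟨σ (e n ⟨x, hx⟩), by rw [h1, map_mul, map_pow, map_pow, hσF]⟩
    have hne : (u.sum fun j z => z * ord (coloredElement c j)) ≠ 0 := by
      rw [hsum ord hmul]
      exact mul_ne_zero (by exact_mod_cast Nat.factorial_ne_zero _) hF
    obtain ⟨j, -, hj⟩ := Finset.exists_ne_zero_of_sum_ne_zero hne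
    rw [← (hord j).1 (right_ne_zero_of_mul hj)]
    exact j.2
  exact ⟨γ, fun v => by rw [hα₀, ← hγ]; rfl⟩

/-- An endomorphism fixing the base field acts on the generators through monomials. -/
lemma exists_map_eq_monomial_mul (h : IsPowerTower (coloredElement c) e) {σ : K →+* K}
    (hσ : ∀ a, σ (algebraMap (GroupAlgebraField (G →₀ ℚ)) K a) = algebraMap _ K a) (n : ℕ)
    (j : coloredVectors c) :
    ∃ v, σ (e n j) = algebraMap (GroupAlgebraField (G →₀ ℚ)) K (monomial v) * e n j := by
  have hstep : ∀ n, σ (e n j) / e n j = (σ (e (n + 1) j) / e (n + 1) j) ^ (n + 2) := by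
    intro n
    have h1 : algebraMap _ K (coloredElement c j) ≠ 0 := (map_ne_zero _).2 (h.ne_zero j)
    rw [h.step n j, map_mul, hσ, map_pow, mul_div_mul_left _ _ h1, div_pow]
  have hpow : ∀ d, σ (e n j) / e n j =
      (σ (e (n + d) j) / e (n + d) j) ^ (n + 2).ascFactorial d := by
    intro d
    induction d with
    | zero => simp
    | succ d ih =>
      rw [ih, hstep, ← pow_mul, Nat.ascFactorial_succ, show n + 2 + d = n + d + 2 by ring]
      rfl
  obtain ⟨v, hv⟩ := exists_eq_algebraMap_monomial h (s := σ (e n j) / e n j)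
    (div_ne_zero ((map_ne_zero σ).2 (h.e_ne_zero n j)) (h.e_ne_zero n j)) fun N hN => by
      obtain ⟨q, hq⟩ := (Nat.dvd_factorial (Nat.pos_of_ne_zero hN) le_rfl).trans
        (Nat.factorial_dvd_ascFactorial (n + 2) N)
      exact ⟨(σ (e (n + N) j) / e (n + N) j) ^ q, by rw [hpow N, hq, ← pow_mul, mul_comm]⟩
  exact ⟨v, (div_eq_iff (h.e_ne_zero n j)).1 hv⟩

lemma eq_one_of_isOfFinOrder (h : IsPowerTower (coloredElement c) e) {σ : K ≃+* K}
    (hσ : ∀ a, σ (algebraMap (GroupAlgebraField (G →₀ ℚ)) K a) = algebraMap _ K a)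
    (hfin : IsOfFinOrder σ) : σ = 1 := by
  obtain ⟨N, hN, hσN⟩ := isOfFinOrder_iff_pow_eq_one.1 hfin
  refine RingEquiv.toRingHom_injective (h.ringHom_ext hσ fun n j => ?_)
  obtain ⟨v, hv⟩ := exists_map_eq_monomial_mul h (σ := σ.toRingHom) hσ n j
  change σ (e n j) = e n j
  replace hv : σ (e n j) = algebraMap (GroupAlgebraField (G →₀ ℚ)) K (monomial v) * e n j := hv
  have hpow : ∀ M : ℕ, (σ ^ M) (e n j) =
      algebraMap (GroupAlgebraField (G →₀ ℚ)) K (monomial (M • v)) * e n j := by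
    intro M
    induction M with
    | zero => simp
    | succ M ih =>
      rw [pow_succ', RingAut.mul_apply, ih, map_mul, hσ, hv, succ_nsmul, monomial_add, map_mul,
        mul_assoc]
  have h1 := hpow N
  rw [hσN, RingAut.one_apply, eq_comm, mul_eq_right₀ (h.e_ne_zero n j)] at h1
  have h2 : N • v = 0 := monomial_injective ((algebraMap _ K).injective (by
    rw [h1, monomial_zero, map_one]))
  rw [hv, (smul_eq_zero.1 h2).resolve_left hN.ne', monomial_zero, map_one, one_mul]

end Automorphisms

open GroupAlgebraField in
/-- For every countable group `G` there is a countable field of characteristic zero whose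
automorphism group contains `G` and maps to `G` with a kernel without torsion. -/
theorem exists_field_ringEquiv_toGroup (G : Type) [Group G] [Countable G] :
    ∃ (K : Type) (_ : Field K), CharZero K ∧ Countable K ∧
      (∃ ι : G →* (K ≃+* K), Function.Injective ι) ∧
      ∃ γ : (K ≃+* K) →* G, ∀ σ, γ σ = 1 → IsOfFinOrder σ → σ = 1 := by
  obtain ⟨c₀, hc₀⟩ := exists_injective_nat G
  obtain ⟨c, hc, hc2⟩ : ∃ c : G → ℕ, Function.Injective c ∧ ∀ g, 2 ≤ c g :=
    ⟨fun g => c₀ g + 2, fun a b h => hc₀ (by simpa using h), fun g => by simp⟩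
  obtain ⟨K, _, _, e, h, hlift⟩ := exists_isPowerTower (coloredElement_ne_zero (c := c))
  have hk : Function.Injective (algebraMap (GroupAlgebraField (G →₀ ℚ)) K) :=
    (algebraMap (GroupAlgebraField (G →₀ ℚ)) K).injective
  have hmono : Function.Injective fun g : G =>
      algebraMap (GroupAlgebraField (G →₀ ℚ)) K (monomial (Finsupp.single g 1)) :=
    hk.comp (monomial_injective.comp (Finsupp.single_left_injective one_ne_zero))
  refine ⟨K, inferInstance, charZero_of_injective_algebraMap hk, h.countable, ?_, ?_⟩
  · have htrans : ∀ g : G, Function.Injective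
        (Finsupp.mapDomain.addMonoidHom (M := ℚ) (g * · : G → G)) := fun g =>
      Finsupp.mapDomain_injective (mul_right_injective g)
    have hex : ∀ g : G, ∃ ψ : K →+* K,
        (∀ v, ψ (algebraMap _ K (monomial v)) =
          algebraMap (GroupAlgebraField (G →₀ ℚ)) K (monomial (Finsupp.mapDomain (g * ·) v))) ∧
        ∀ n j, ψ (e n j) = e n ⟨_, mapDomain_mem_coloredVectors g j.2⟩ := by
      intro g
      obtain ⟨ψ, h1, h2⟩ := hlift (GroupAlgebraField.map _ (htrans g))
        (fun j => ⟨_, mapDomain_mem_coloredVectors g j.2⟩)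
        (fun i j hij => by
          have h1 := Prod.ext_iff.1 (Subtype.ext_iff.1 hij)
          exact Subtype.ext (Prod.ext (htrans g h1.1) h1.2))
        fun j => by
          rw [coloredElement, map_sub, map_natCast, map_monomial]
          rfl
      exact ⟨ψ, fun v => by rw [h1, map_monomial]; rfl, h2⟩
    choose ψ hψ hψe using hex
    have hψ_ext : ∀ φ₁ φ₂ : K →+* K, (∀ v, φ₁ (algebraMap _ K (monomial v)) =
        φ₂ (algebraMap (GroupAlgebraField (G →₀ ℚ)) K (monomial v))) →
        (∀ n j, φ₁ (e n j) = φ₂ (e n j)) → φ₁ = φ₂ := fun φ₁ φ₂ h1 h2 =>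
      h.ringHom_ext (RingHom.congr_fun (GroupAlgebraField.ringHom_ext
        (φ := φ₁.comp (algebraMap _ K)) (ψ := φ₂.comp (algebraMap _ K)) h1)) h2
    have hψ_mul : ∀ g₁ g₂, ψ (g₁ * g₂) = (ψ g₁).comp (ψ g₂) := by
      intro g₁ g₂
      have hcomp : ((g₁ * g₂) * · : G → G) = (g₁ * ·) ∘ (g₂ * ·) := by
        ext x
        simp [mul_assoc]
      refine hψ_ext _ _ (fun v => ?_) fun n j => ?_
      · rw [RingHom.comp_apply, hψ, hψ, hψ, hcomp, Finsupp.mapDomain_comp]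
      · rw [RingHom.comp_apply, hψe, hψe, hψe]
        congr 2
        simp only [hcomp, Finsupp.mapDomain_comp]
    have hψ_one : ψ 1 = RingHom.id K := by
      have hone : (1 * · : G → G) = id := by
        ext x
        simp
      refine hψ_ext _ _ (fun v => ?_) fun n j => ?_
      · rw [hψ, hone, Finsupp.mapDomain_id, RingHom.id_apply]
      · rw [hψe, RingHom.id_apply]
        congr 1
        simp only [hone, Finsupp.mapDomain_id]
    refine ⟨MonoidHom.mk' (fun g => RingEquiv.ofRingHom (ψ g) (ψ g⁻¹)
      (by rw [← hψ_mul, mul_inv_cancel, hψ_one]) (by rw [← hψ_mul, inv_mul_cancel, hψ_one]))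
      fun g₁ g₂ => RingEquiv.ext fun x => RingHom.congr_fun (hψ_mul g₁ g₂) x, fun g₁ g₂ hg => ?_⟩
    have h1 : ψ g₁ = ψ g₂ := congrArg RingEquiv.toRingHom hg
    have h2 := hψ g₁ (Finsupp.single 1 1)
    rw [h1, hψ, Finsupp.mapDomain_single, Finsupp.mapDomain_single, mul_one, mul_one] at h2
    exact (hmono h2).symm
  · have hex : ∀ σ : K ≃+* K, ∃ γ : G, ∀ v,
        σ (algebraMap (GroupAlgebraField (G →₀ ℚ)) K (monomial v)) =
          algebraMap (GroupAlgebraField (G →₀ ℚ)) K (monomial (Finsupp.mapDomain (γ * ·) v)) :=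
      fun σ => exists_forall_map_monomial_eq hc hc2 h σ.toRingHom
    choose γ hγ using hex
    refine ⟨MonoidHom.mk' γ fun σ τ => hmono ?_, fun σ hσ hfin => ?_⟩
    · have h1 := hγ (σ * τ) (Finsupp.single 1 1)
      rw [RingAut.mul_apply, hγ, hγ, Finsupp.mapDomain_single, Finsupp.mapDomain_single,
        Finsupp.mapDomain_single, mul_one, mul_one] at h1
      exact h1.symm
    · have hone : (γ σ * · : G → G) = id := by
        ext x
        change γ σ * x = x
        rw [show γ σ = 1 from hσ, one_mul]
      refine eq_one_of_isOfFinOrder h (RingHom.congr_fun (GroupAlgebraField.ringHom_ext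
        (φ := σ.toRingHom.comp (algebraMap _ K)) (ψ := algebraMap _ K) fun v => ?_)) hfin
      change σ (algebraMap (GroupAlgebraField (G →₀ ℚ)) K (monomial v)) = _
      rw [hγ, hone, Finsupp.mapDomain_id]

open Cardinal in
lemma Field.nonempty_ringHom_complex_of_countable (K : Type) [Field K] [CharZero K] [Countable K] :
    Nonempty (K →+* ℂ) := by
  let R := FractionRing (MvPolynomial ℂ K)
  let M := AlgebraicClosure R
  have hR : #R = 𝔠 := by
    rw [FractionRing.cardinalMk, MvPolynomial.cardinalMk_eq_max, mk_complex, max_assoc,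
      max_eq_left aleph0_le_continuum, max_eq_right (mk_le_aleph0.trans aleph0_le_continuum)]
  have hM : #M = 𝔠 := by
    apply le_antisymm
    · have := Algebra.IsAlgebraic.cardinalMk_le_max R M
      rwa [hR, max_eq_left aleph0_le_continuum] at this
    · rw [← hR]
      exact mk_le_of_injective (algebraMap R M).injective
  have : CharZero R := inferInstance
  have : CharZero M := charZero_of_injective_algebraMap (algebraMap R M).injective
  obtain ⟨e⟩ := IsAlgClosed.ringEquiv_of_equiv_of_charZero (K := M) (L := ℂ)
    (hM ▸ aleph0_lt_continuum) (Cardinal.eq.1 (hM.trans mk_complex.symm))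
  exact ⟨e.toRingHom.comp ((algebraMap R M).comp ((algebraMap (MvPolynomial ℂ K) R).comp
    MvPolynomial.C))⟩

/-- The ring automorphism groups of isomorphic rings are isomorphic. -/
def RingEquiv.ringAutCongr {R S : Type*} [Semiring R] [Semiring S] (e : R ≃+* S) :
    (R ≃+* R) ≃* (S ≃+* S) where
  toFun σ := (e.symm.trans σ).trans e
  invFun σ := (e.trans σ).trans e.symm
  left_inv σ := by ext; simp
  right_inv σ := by ext; simp
  map_mul' σ τ := by ext; simp

lemma Monoid.CoprodI.countable {ι : Type*} {M : ι → Type*} [Countable ι] [∀ i, Group (M i)]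
    [∀ i, Countable (M i)] : Countable (CoprodI M) :=
  Function.Surjective.countable (f := listProd (M := M)) fun x =>
    (exists_listProd_eq x).imp fun _ h => h.2

/-- For every non-empty set `𝒩` of positive integers that is closed
under taking divisors, there is a countable subfield `K` of `ℂ` such that the set of
orders of finite subgroups of the automorphism group of the field `K` is exactly `𝒩`. -/
theorem exists_countable_subfield_with_prescribed_finite_subgroup_orders
    (𝒩 : Set ℕ) (hne : 𝒩.Nonempty) (hpos : ∀ n ∈ 𝒩, 0 < n)
    (hdiv : ∀ n ∈ 𝒩, ∀ m, m ∣ n → m ∈ 𝒩) :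
    ∃ K : Subfield ℂ, Countable K ∧
      {m : ℕ | ∃ G : Subgroup (K ≃+* K), Finite G ∧ Nat.card G = m} = 𝒩 := by
  have : Nonempty 𝒩 := hne.to_subtype
  have hN (n : 𝒩) : NeZero (n : ℕ) := ⟨(hpos n n.2).ne'⟩
  let M : 𝒩 → Type := fun n => Multiplicative (ZMod n)
  have hcount (n : 𝒩) : Countable (M n) := Finite.to_countable
  have hcard (n : 𝒩) : Nat.card (M n) = n := by
    simp [M]
  have : Countable (Monoid.CoprodI M) := Monoid.CoprodI.countable
  obtain ⟨F, _, _, _, ⟨ι, hι⟩, γ, hγ⟩ := exists_field_ringEquiv_toGroup (Monoid.CoprodI M)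
  obtain ⟨f⟩ := Field.nonempty_ringHom_complex_of_countable F
  let e : F ≃+* f.fieldRange := f.rangeRestrictFieldEquiv
  let c := e.ringAutCongr
  refine ⟨f.fieldRange, e.symm.injective.countable, Set.ext fun m => ⟨?_, fun hm => ?_⟩⟩
  · rintro ⟨H, hH, rfl⟩
    let g : (f.fieldRange ≃+* f.fieldRange) →* Monoid.CoprodI M := γ.comp c.symm.toMonoidHom
    have hinj : Function.Injective (g.comp H.subtype) := by
      refine (injective_iff_map_eq_one _).2 fun σ hσ => ?_
      have hfin : IsOfFinOrder (c.symm (σ : f.fieldRange ≃+* f.fieldRange)) :=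
        (c.symm.toMonoidHom.comp H.subtype).isOfFinOrder (isOfFinOrder_of_finite σ)
      have h1 := hγ _ hσ hfin
      exact Subtype.ext (by simpa using h1)
    have hfinite : Finite (g.comp H.subtype).range := Finite.of_surjective _
      (g.comp H.subtype).rangeRestrict_surjective
    obtain ⟨n, hn⟩ := Monoid.CoprodI.exists_card_dvd_of_finite (g.comp H.subtype).range
    rw [hcard, ← Nat.card_congr (MonoidHom.ofInjective hinj).toEquiv] at hn
    exact hdiv n n.2 _ hn
  · let i : M ⟨m, hm⟩ →* (f.fieldRange ≃+* f.fieldRange) :=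
      (c.toMonoidHom.comp ι).comp Monoid.CoprodI.of
    have hi : Function.Injective i :=
      (c.injective.comp hι).comp (Monoid.CoprodI.of_injective _)
    have hfin : Finite (M ⟨m, hm⟩) := Nat.finite_of_card_ne_zero (by
      rw [hcard]; exact (hpos m hm).ne')
    exact ⟨i.range, Finite.of_surjective _ i.rangeRestrict_surjective,
      (Nat.card_congr (MonoidHom.ofInjective hi).toEquiv).symm.trans (hcard _)⟩
end

section
/- With Γ = Γ₁ *_Σ Γ₂ = SL(3,ℚ) *_Σ SL(3,K) as in the context: every automorphism δ of Γ is of the form δ = Ad(g) ∘ (δ₁ * δ₂), where g ∈ Γ, δ₁ ∈ Aut(Γ₁) and δ₂ ∈ Aut(Γ₂) satisfy δ₁(Σ) = Σ, δ₂(Σ) = Σ and δ₁|_Σ = δ₂|_Σ, and where δ₁ * δ₂ denotes the automorphism of Γ that restricts to δᵢ on Γᵢ (well-defined by the universal property of the amalgamated free product), and Ad(g) denotes conjugation by g. -/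
open Matrix

/-- The matrix `A = [[1,0,0],[1,q,0],[1,0,q⁻¹]]` as an element of `SL(3,F)`. -/
def AmatSL (F : Type) [Field F] [CharZero F] (q : ℚ) (hq : q ≠ 0) :
    Matrix.SpecialLinearGroup (Fin 3) F :=
  ⟨!![1, 0, 0; 1, (q : F), 0; 1, 0, (q : F)⁻¹], by
    have hq' : (q : F) ≠ 0 := by exact_mod_cast hq
    simp [Matrix.det_fin_three, Matrix.vecHead, Matrix.vecTail]
    field_simp⟩

/-- The upper unitriangular matrix `[[1,a,b],[0,1,c],[0,0,1]]` with integer entries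
as an element of `SL(3,F)`. -/
def unitriSL (F : Type) [Field F] (a b c : ℤ) : Matrix.SpecialLinearGroup (Fin 3) F :=
  ⟨!![1, (a : F), (b : F); 0, 1, (c : F); 0, 0, 1], by simp [Matrix.det_fin_three, Matrix.vecHead, Matrix.vecTail]⟩

lemma unitriSL_mul (F : Type) [Field F] (a b c a' b' c' : ℤ) :
    unitriSL F a b c * unitriSL F a' b' c'
      = unitriSL F (a + a') (b + b' + a * c') (c + c') := by
  apply Subtype.ext
  show (unitriSL F a b c).val * (unitriSL F a' b' c').val = _
  ext i j
  fin_cases i <;> fin_cases j <;>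
    simp [unitriSL, Matrix.mul_apply, Fin.sum_univ_three, Matrix.vecHead, Matrix.vecTail] <;> push_cast <;> ring

/-- The group `Λᵢ` of upper unitriangular matrices with integer entries,
as a subgroup of `SL(3,F)`. -/
def unitriSubgroup (F : Type) [Field F] : Subgroup (Matrix.SpecialLinearGroup (Fin 3) F) where
  carrier := {M | ∃ a b c : ℤ, M = unitriSL F a b c}
  one_mem' := ⟨0, 0, 0, by
    apply Subtype.ext
    show (1 : Matrix (Fin 3) (Fin 3) F) = _
    ext i j
    fin_cases i <;> fin_cases j <;> simp [unitriSL, Matrix.vecHead, Matrix.vecTail]⟩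
  mul_mem' := by
    rintro _ _ ⟨a, b, c, rfl⟩ ⟨a', b', c', rfl⟩
    exact ⟨a + a', b + b' + a * c', c + c', (unitriSL_mul F a b c a' b' c').symm ▸ rfl⟩
  inv_mem' := by
    rintro _ ⟨a, b, c, rfl⟩
    refine ⟨-a, a * c - b, -c, ?_⟩
    rw [inv_eq_iff_mul_eq_one, unitriSL_mul]
    apply Subtype.ext
    show (unitriSL F _ _ _).val = (1 : Matrix (Fin 3) (Fin 3) F)
    ext i j
    fin_cases i <;> fin_cases j <;> simp [unitriSL, Matrix.vecHead, Matrix.vecTail] <;> push_cast <;> ring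

/-- The pair of factors `Γ₁ = SL(3,ℚ)` (index `false`) and `Γ₂ = SL(3,K)` (index `true`). -/
def SLfam (K : Type) [Field K] : Bool → Type
  | false => Matrix.SpecialLinearGroup (Fin 3) ℚ
  | true => Matrix.SpecialLinearGroup (Fin 3) K

instance (K : Type) [Field K] : (i : Bool) → Group (SLfam K i)
  | false => inferInstanceAs (Group (Matrix.SpecialLinearGroup (Fin 3) ℚ))
  | true => inferInstanceAs (Group (Matrix.SpecialLinearGroup (Fin 3) K))

/-- The element `A`, in each of the two factors. -/
def AmatFam (K : Type) [Field K] [CharZero K] (q : ℚ) (hq : q ≠ 0) :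
    (i : Bool) → SLfam K i
  | false => AmatSL ℚ q hq
  | true => AmatSL K q hq

/-- The embeddings of `Σ = ℤ` into the two factors, sending the generator to `A`. -/
def sigmaMaps (K : Type) [Field K] [CharZero K] (q : ℚ) (hq : q ≠ 0) :
    (i : Bool) → Multiplicative ℤ →* SLfam K i :=
  fun i => zpowersHom (SLfam K i) (AmatFam K q hq i)

/-- The amalgamated free product `Γ = SL(3,ℚ) *_Σ SL(3,K)`. -/
abbrev AmalGamma (K : Type) [Field K] [CharZero K] (q : ℚ) (hq : q ≠ 0) : Type :=
  Monoid.PushoutI (sigmaMaps K q hq)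

/-- The canonical embeddings `Γᵢ → Γ`. -/
def amalInc (K : Type) [Field K] [CharZero K] (q : ℚ) (hq : q ≠ 0) (i : Bool) :
    SLfam K i →* AmalGamma K q hq :=
  Monoid.PushoutI.of (φ := sigmaMaps K q hq) i

/-- The subgroup of `Γᵢ` corresponding to `Λᵢ`, the integer unitriangular matrices. -/
def unitriFam (K : Type) [Field K] : (i : Bool) → Subgroup (SLfam K i)
  | false => unitriSubgroup ℚ
  | true => unitriSubgroup K

/-- The subgroup `Λ = Λ₁ * Λ₂` of `Γ` generated by the images of `Λ₁` and `Λ₂`. -/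
def amalLambda (K : Type) [Field K] [CharZero K] (q : ℚ) (hq : q ≠ 0) :
    Subgroup (AmalGamma K q hq) :=
  ((unitriFam K false).map (amalInc K q hq false)) ⊔ ((unitriFam K true).map (amalInc K q hq true))

/-- The subgroup `Σ = {Aᵏ} ≤ Γ` (the common image of the two copies of `Σ`). -/
def amalSigma (K : Type) [Field K] [CharZero K] (q : ℚ) (hq : q ≠ 0) :
    Subgroup (AmalGamma K q hq) :=
  Subgroup.zpowers (amalInc K q hq false (AmatFam K q hq false))

namespace Monoid.PushoutI

variable {G : Bool → Type*} {H : Type*} [∀ i, Group (G i)] [Group H] (φ : ∀ i, H →* G i)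

/-- `IsReducedProd φ i j n g` says that `g` is a product of `n ≥ 1` letters taken alternately from
the two factors, none of them in the amalgamated subgroup, the first one from the factor `i` and
the last one from the factor `j`. -/
inductive IsReducedProd : Bool → Bool → ℕ → PushoutI φ → Prop
  | single (i : Bool) (x : G i) (hx : x ∉ (φ i).range) : IsReducedProd i i 1 (of i x)
  | cons (i j : Bool) (n : ℕ) (x : G i) (g : PushoutI φ) (hx : x ∉ (φ i).range)
      (hg : IsReducedProd (!i) j n g) : IsReducedProd i j (n + 1) (of i x * g)

variable {φ}

namespace IsReducedProd

theorem pos {i j : Bool} {n : ℕ} {g : PushoutI φ} (h : IsReducedProd φ i j n g) : 1 ≤ n := by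
  cases h <;> omega

theorem mul {i j k : Bool} {m n : ℕ} {g h : PushoutI φ} (hg : IsReducedProd φ i j m g)
    (hh : IsReducedProd φ (!j) k n h) : IsReducedProd φ i k (m + n) (g * h) := by
  induction hg with
  | single i x hx =>
    rw [add_comm]
    exact .cons i k n x h hx hh
  | cons i j m x g hx _ ih =>
    rw [mul_assoc, add_right_comm]
    exact .cons i k _ x _ hx (ih hh)

theorem inv {i j : Bool} {n : ℕ} {g : PushoutI φ} (hg : IsReducedProd φ i j n g) :
    IsReducedProd φ j i n g⁻¹ := by
  induction hg with
  | single i x hx =>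
    rw [← map_inv]
    exact .single i _ (by simpa using hx)
  | cons i j n x g hx _ ih =>
    rw [_root_.mul_inv_rev, ← map_inv]
    refine ih.mul ?_
    rw [Bool.not_not]
    exact .single i _ (by simpa using hx)

theorem base_mul {i j : Bool} {n : ℕ} {g : PushoutI φ} (hg : IsReducedProd φ i j n g) (h : H) :
    IsReducedProd φ i j n (base φ h * g) := by
  cases hg with
  | single i x hx =>
    rw [← of_apply_eq_base φ i, ← map_mul]
    exact .single i _ (by rwa [Subgroup.mul_mem_cancel_left _ (MonoidHom.mem_range.2 ⟨h, rfl⟩)])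
  | cons i j n x g hx hg =>
    rw [← of_apply_eq_base φ i, ← mul_assoc, ← map_mul]
    exact .cons i j n _ g
      (by rwa [Subgroup.mul_mem_cancel_left _ (MonoidHom.mem_range.2 ⟨h, rfl⟩)]) hg

theorem exists_word {i j : Bool} {n : ℕ} {g : PushoutI φ} (hg : IsReducedProd φ i j n g) :
    ∃ w : CoprodI.Word G, Reduced φ w ∧ ofCoprodI w.prod = g ∧ w.toList.length = n ∧
      w.fstIdx = some i := by
  induction hg with
  | single i x hx =>
    refine ⟨⟨[⟨i, x⟩], ?_, by simp⟩, ?_, ?_, rfl, rfl⟩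
    · simp only [List.mem_singleton, forall_eq]
      exact fun h => hx (h ▸ one_mem _)
    · intro g hg
      simp only [List.mem_singleton] at hg
      subst hg
      exact hx
    · simp [CoprodI.Word.prod]
  | cons i j n x g hx _ ih =>
    obtain ⟨w, hw, rfl, hn, hi⟩ := ih
    refine ⟨CoprodI.Word.cons x w (by simp [hi]) ?_, ?_, ?_, ?_, ?_⟩
    · rintro rfl
      exact hx (one_mem _)
    · intro g hg
      simp only [CoprodI.Word.cons, List.mem_cons] at hg
      rcases hg with rfl | hg
      · exact hx
      · exact hw g hg
    · simp
    · simp [CoprodI.Word.cons, hn]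
    · simp [CoprodI.Word.fstIdx, CoprodI.Word.cons]

theorem notMem_base (hφ : ∀ i, Function.Injective (φ i)) {i j : Bool} {n : ℕ} {g : PushoutI φ}
    (hg : IsReducedProd φ i j n g) : g ∉ (base φ).range := by
  obtain ⟨w, hw, rfl, hn, hi⟩ := hg.exists_word
  intro h
  rw [hw.eq_empty_of_mem_range hφ h] at hi
  simp [CoprodI.Word.fstIdx, CoprodI.Word.empty] at hi

theorem unique (hφ : ∀ i, Function.Injective (φ i)) {i j i' j' : Bool} {n n' : ℕ}
    {g : PushoutI φ} (hg : IsReducedProd φ i j n g) (hg' : IsReducedProd φ i' j' n' g) :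
    i = i' ∧ n = n' := by
  obtain ⟨w, hw, hwg, rfl, hi⟩ := hg.exists_word
  obtain ⟨w', hw', hwg', rfl, hi'⟩ := hg'.exists_word
  obtain ⟨d⟩ := NormalWord.transversal_nonempty φ hφ
  obtain ⟨v, hv, hvl⟩ := hw.exists_normalWord_prod_eq d
  obtain ⟨v', hv', hvl'⟩ := hw'.exists_normalWord_prod_eq d
  have hvv : v = v' := NormalWord.prod_injective (by rw [hv, hv', hwg, hwg'])
  subst hvv
  rw [hvl] at hvl'
  refine ⟨?_, by simpa using congrArg List.length hvl'⟩
  have := congrArg List.head? hvl'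
  rw [List.head?_map, List.head?_map] at this
  rw [CoprodI.Word.fstIdx] at hi hi'
  rw [hi, hi'] at this
  simpa using this

theorem pow {i : Bool} {n : ℕ} {g : PushoutI φ} (hg : IsReducedProd φ i (!i) n g) (m : ℕ) :
    IsReducedProd φ i (!i) ((m + 1) * n) (g ^ (m + 1)) := by
  induction m with
  | zero => simpa using hg
  | succ m ih =>
    rw [pow_succ, add_mul (m + 1), one_mul]
    refine ih.mul ?_
    rwa [Bool.not_not]

theorem mul_base {i j : Bool} {n : ℕ} {g : PushoutI φ} (hg : IsReducedProd φ i j n g) (h : H) :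
    IsReducedProd φ i j n (g * base φ h) := by
  simpa using (hg.inv.base_mul h⁻¹).inv

theorem eq_of_or_eq_mul_of {i j : Bool} {n : ℕ} {g : PushoutI φ}
    (hg : IsReducedProd φ i j n g) :
    (i = j ∧ ∃ x : G j, g = of j x) ∨ ∃ (m : ℕ) (w : PushoutI φ) (x : G j),
      n = m + 1 ∧ g = w * of j x ∧ x ∉ (φ j).range ∧ IsReducedProd φ i (!j) m w := by
  obtain ⟨v, hv⟩ : ∃ v, v = g⁻¹ := ⟨_, rfl⟩
  have hi := hg.inv
  rw [← hv] at hi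
  obtain rfl : g = v⁻¹ := by rw [hv, inv_inv]
  cases hi with
  | single _ x hx => exact .inl ⟨rfl, x⁻¹, (map_inv _ _).symm⟩
  | cons _ _ m x w hx hw =>
    exact .inr ⟨m, w⁻¹, x⁻¹, rfl, by rw [_root_.mul_inv_rev, map_inv], by simpa using hx, hw.inv⟩

/-- An element of one factor is not a reduced product of length at least two. -/
theorem of_eq (hφ : ∀ i, Function.Injective (φ i)) {i j k : Bool} {n : ℕ} {x : G k}
    (hg : IsReducedProd φ i j n (of k x)) : i = k ∧ n = 1 := by
  by_cases hx : x ∈ (φ k).range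
  · obtain ⟨h, rfl⟩ := hx
    exact absurd ⟨h, (of_apply_eq_base φ k h).symm⟩ (hg.notMem_base hφ)
  · exact hg.unique hφ (.single k x hx)

theorem conj {i j : Bool} {n : ℕ} {g : PushoutI φ} (hg : IsReducedProd φ i (!j) n g) {x : G j}
    (hx : x ∉ (φ j).range) : IsReducedProd φ i i (n + (1 + n)) (g * (of j x * g⁻¹)) := by
  refine hg.mul ?_
  rw [Bool.not_not]
  exact (single j x hx).mul hg.inv

end IsReducedProd

theorem mem_base_or_isReducedProd_of_mul (i : Bool) (x : G i) {g : PushoutI φ}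
    (hg : g ∈ (base φ).range ∨ ∃ k j n, IsReducedProd φ k j n g) :
    of i x * g ∈ (base φ).range ∨ ∃ k j n, IsReducedProd φ k j n (of i x * g) := by
  by_cases hx : x ∈ (φ i).range
  · obtain ⟨h, rfl⟩ := hx
    rw [of_apply_eq_base]
    rcases hg with hg | ⟨k, j, n, hg⟩
    · exact .inl (mul_mem ⟨h, rfl⟩ hg)
    · exact .inr ⟨k, j, n, hg.base_mul h⟩
  rcases hg with ⟨h, rfl⟩ | ⟨k, j, n, hg⟩
  · right
    rw [← of_apply_eq_base φ i, ← map_mul]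
    exact ⟨i, i, 1, .single i _ (by rwa [Subgroup.mul_mem_cancel_right _ (MonoidHom.mem_range.2 ⟨h, rfl⟩)])⟩
  · obtain rfl | hk := eq_or_ne k i
    · have key (y : G k) : of (φ := φ) k y ∈ (base φ).range ∨
          IsReducedProd φ k k 1 (of (φ := φ) k y) := by
        by_cases hy : y ∈ (φ k).range
        · obtain ⟨h, rfl⟩ := hy
          exact .inl ⟨h, (of_apply_eq_base φ k h).symm⟩
        · exact .inr (.single k y hy)
      cases hg with
      | single _ y hy =>
        rw [← map_mul]
        exact (key _).imp id fun h => ⟨_, _, _, h⟩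
      | cons _ _ n y g hy hg =>
        rw [← mul_assoc, ← map_mul]
        rcases key (x * y) with ⟨h, hh⟩ | h
        · rw [← hh]
          exact .inr ⟨_, _, _, hg.base_mul h⟩
        · exact .inr ⟨_, _, _, h.mul hg⟩
    · obtain rfl : k = !i := by cases k <;> cases i <;> simp_all
      exact .inr ⟨_, _, _, .cons i j n x g hx hg⟩

theorem mem_base_or_isReducedProd (g : PushoutI φ) :
    g ∈ (base φ).range ∨ ∃ i j n, IsReducedProd φ i j n g := by
  suffices ∀ h : PushoutI φ, (h ∈ (base φ).range ∨ ∃ i j n, IsReducedProd φ i j n h) →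
      (g * h ∈ (base φ).range ∨ ∃ i j n, IsReducedProd φ i j n (g * h)) by
    simpa using this 1 (.inl (one_mem _))
  induction g using PushoutI.induction_on with
  | of i x => exact fun h hh => mem_base_or_isReducedProd_of_mul i x hh
  | base k =>
    intro h hh
    rw [← of_apply_eq_base φ false]
    exact mem_base_or_isReducedProd_of_mul false _ hh
  | mul x y hx hy =>
    intro h hh
    rw [mul_assoc]
    exact hx _ (hy _ hh)

theorem exists_eq_of_mul (g : PushoutI φ) (i : Bool) :
    ∃ (x : G i) (w : PushoutI φ), g = of i x * w ∧
      (w = 1 ∨ ∃ j n, IsReducedProd φ (!i) j n w) := by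
  rcases mem_base_or_isReducedProd g with ⟨h, rfl⟩ | ⟨k, j, n, hg⟩
  · exact ⟨φ i h, 1, by rw [mul_one, of_apply_eq_base], .inl rfl⟩
  · obtain rfl | hk := eq_or_ne k i
    · cases hg with
      | single _ y hy => exact ⟨y, 1, by simp, .inl rfl⟩
      | cons _ _ n y g hy hg => exact ⟨y, g, rfl, .inr ⟨_, _, hg⟩⟩
    · obtain rfl : k = !i := by cases k <;> cases i <;> simp_all
      exact ⟨1, g, by simp, .inr ⟨_, _, hg⟩⟩

theorem exists_eq_mul_of (g : PushoutI φ) (i : Bool) :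
    ∃ (x : G i) (w : PushoutI φ), g = w * of i x ∧
      (w = 1 ∨ ∃ j n, IsReducedProd φ j (!i) n w) := by
  obtain ⟨x, w, hg, hw⟩ := exists_eq_of_mul g⁻¹ i
  refine ⟨x⁻¹, w⁻¹, by rw [map_inv, ← _root_.mul_inv_rev, ← hg, inv_inv], ?_⟩
  rcases hw with rfl | ⟨j, n, hw⟩
  · simp
  · exact .inr ⟨j, n, hw.inv⟩

theorem exists_eq_of_mul_mul_of (g : PushoutI φ) :
    ∃ (x : G false) (y : G true) (w : PushoutI φ), g = of false x * w * of true y ∧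
      (w = 1 ∨ ∃ n, IsReducedProd φ true false n w) := by
  obtain ⟨x, w, rfl, rfl | ⟨j, n, hw⟩⟩ := exists_eq_of_mul g false
  · exact ⟨x, 1, 1, by simp, .inl rfl⟩
  · cases j with
    | false => exact ⟨x, 1, w, by simp, .inr ⟨n, hw⟩⟩
    | true =>
      rcases hw.eq_of_or_eq_mul_of with ⟨-, y, rfl⟩ | ⟨m, v, y, -, rfl, -, hv⟩
      · exact ⟨x, y, 1, by simp, .inl rfl⟩
      · exact ⟨x, y, v, by simp [mul_assoc], .inr ⟨m, hv⟩⟩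

/-- The conjugates of the factors are malnormal away from the conjugates of the
amalgamated subgroup. -/
theorem of_conj_mem_range (hφ : ∀ i, Function.Injective (φ i)) {i j : Bool} {x : G i} {y : G j}
    (hx : ∀ g : PushoutI φ, g * of i x * g⁻¹ ∉ (base φ).range) {c : PushoutI φ}
    (h : c * of i x * c⁻¹ = of j y) : i = j ∧ c ∈ (of (φ := φ) i).range := by
  obtain ⟨z, w, rfl, hw⟩ := exists_eq_mul_of c i
  have hz : z * x * z⁻¹ ∉ (φ i).range := by
    rintro ⟨t, ht⟩
    exact hx (of i z) ⟨t, by rw [← of_apply_eq_base φ i, ht]; simp⟩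
  have h' : w * (of i (z * x * z⁻¹) * w⁻¹) = of j y := by
    rw [← h]; simp [mul_assoc]
  rcases hw with rfl | ⟨k, n, hw⟩
  · have := IsReducedProd.single i _ hz
    simp only [one_mul, inv_one, mul_one] at h'
    rw [h'] at this
    exact ⟨(this.of_eq hφ).1, by simp⟩
  · have := hw.conj hz
    rw [h'] at this
    have h1 := (this.of_eq hφ).2
    have h2 := hw.pos
    omega

theorem IsReducedProd.conj_mem_or_pow {i j : Bool} {n : ℕ} {g : PushoutI φ}
    (hg : IsReducedProd φ i j n g) :
    (∃ (c : PushoutI φ) (k : Bool) (x : G k), g = c * of k x * c⁻¹) ∨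
      ∀ m : ℕ, ∃ p, m + 1 ≤ p ∧ IsReducedProd φ i j p (g ^ (m + 1)) := by
  induction n using Nat.strong_induction_on generalizing i j g with
  | _ n ih =>
  obtain rfl | hij := eq_or_ne j i
  · cases hg with
    | single _ x hx => exact .inl ⟨1, j, x, by simp⟩
    | cons _ _ n x g hx hg =>
      rcases hg.eq_of_or_eq_mul_of with ⟨hj, -⟩ | ⟨m, w, y, rfl, rfl, hy, hw⟩
      · simp at hj
      by_cases hyx : y * x ∈ (φ j).range
      · obtain ⟨h, hh⟩ := hyx
        have hg' : of j x * (w * of j y) = of j x * (w * base φ h) * (of j x)⁻¹ := by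
          rw [← of_apply_eq_base φ j, hh]
          simp [mul_assoc]
        rcases ih m (by omega) (hw.mul_base h) with ⟨c, k, z, hc⟩ | H
        · exact .inl ⟨of j x * c, k, z, by rw [hg', hc]; simp [mul_assoc]⟩
        · refine .inr fun k => ?_
          obtain ⟨p, hp, hr⟩ := H k
          refine ⟨1 + (p + 1), by omega, ?_⟩
          rw [hg', conj_pow, mul_assoc, ← map_inv]
          refine (IsReducedProd.single j x hx).mul (hr.mul ?_)
          rw [Bool.not_not]
          exact .single j _ (by simpa using hx)
      · refine .inr fun k => ?_
        have hs : IsReducedProd φ (!j) j (m + 1) (w * of j (y * x)) :=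
          hw.mul (by rw [Bool.not_not]; exact .single j _ hyx)
        have H : ∃ p, k + 1 ≤ p ∧
            IsReducedProd φ (!j) j p ((w * of j (y * x)) ^ k * (w * of j y)) := by
          induction k with
          | zero => exact ⟨m + 1, by omega, by simpa using hg⟩
          | succ k ihk =>
            obtain ⟨p, hp, hr⟩ := ihk
            refine ⟨m + 1 + p, by omega, ?_⟩
            rw [pow_succ', mul_assoc]
            exact hs.mul hr
        obtain ⟨p, hp, hr⟩ := H
        refine ⟨1 + p, by omega, ?_⟩
        have : (of j x * (w * of j y)) ^ (k + 1)
            = of j x * ((w * of j (y * x)) ^ k * (w * of j y)) := by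
          clear hr
          induction k with
          | zero => simp
          | succ k ihk =>
            rw [pow_succ', ihk (by omega), pow_succ' _ k]
            simp only [map_mul, mul_assoc]
        rw [this]
        exact (IsReducedProd.single j x hx).mul hr
  · obtain rfl : j = !i := by cases i <;> cases j <;> simp_all
    refine .inr fun m => ⟨_, ?_, hg.pow m⟩
    exact Nat.le_mul_of_pos_right _ hg.pos

/-- An element with roots of all orders is conjugate into one of the factors. -/
theorem exists_conj_of_forall_pow (hφ : ∀ i, Function.Injective (φ i)) {u : PushoutI φ}
    (hu : ∀ n : ℕ, ∃ r, r ^ (n + 1) = u) :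
    ∃ (c : PushoutI φ) (k : Bool) (x : G k), u = c * of k x * c⁻¹ := by
  rcases mem_base_or_isReducedProd u with ⟨h, rfl⟩ | ⟨i, j, n, hn⟩
  · exact ⟨1, true, φ true h, by simp [of_apply_eq_base]⟩
  obtain ⟨r, rfl⟩ := hu n
  rcases mem_base_or_isReducedProd r with ⟨h, rfl⟩ | ⟨i', j', n', hn'⟩
  · exact ⟨1, true, φ true (h ^ (n + 1)), by simp [of_apply_eq_base]⟩
  rcases hn'.conj_mem_or_pow with ⟨c, k, x, rfl⟩ | H
  · exact ⟨c, k, x ^ (n + 1), by rw [conj_pow, map_pow]⟩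
  · obtain ⟨p, hp, hr⟩ := H n
    have := (hr.unique hφ hn).2
    omega

theorem of_mem_base_range_iff (hφ : ∀ i, Function.Injective (φ i)) {i : Bool} {x : G i} :
    of (φ := φ) i x ∈ (base φ).range ↔ x ∈ (φ i).range := by
  constructor
  · rintro ⟨h, hh⟩
    rw [← of_apply_eq_base φ i] at hh
    exact ⟨h, of_injective hφ i hh⟩
  · rintro ⟨h, rfl⟩
    exact ⟨h, (of_apply_eq_base φ i h).symm⟩

theorem base_mem_range_of (i : Bool) (a : H) : base φ a ∈ (of (φ := φ) i).range :=
  ⟨φ i a, of_apply_eq_base φ i a⟩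

/-- If an endomorphism stabilizes the first factor and maps the second one into its conjugate by
`w`, where `w` is in normal form, then it maps the amalgamated subgroup into itself. -/
theorem apply_base_of_reduced (hφ : ∀ i, Function.Injective (φ i)) {δ : PushoutI φ →* PushoutI φ}
    {w : PushoutI φ} (hw : w = 1 ∨ ∃ n, IsReducedProd φ true false n w)
    (h₁ : ∀ x : G false, δ (of false x) ∈ (of (φ := φ) false).range)
    (h₂ : ∀ y : G true, ∃ y' : G true, δ (of true y) = w * of true y' * w⁻¹) (a : H) :
    ∃ b b' : H, δ (base φ a) = base φ b ∧ base φ b = w * base φ b' * w⁻¹ := by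
  obtain ⟨x, hx⟩ := h₁ (φ false a)
  obtain ⟨y, hy⟩ := h₂ (φ true a)
  rw [of_apply_eq_base] at hx hy
  rcases hw with rfl | ⟨n, hw⟩
  · have : δ (base φ a) ∈ (of (φ := φ) false).range ⊓ (of (φ := φ) true).range :=
      ⟨⟨x, hx⟩, ⟨y, by simpa using hy.symm⟩⟩
    rw [inf_of_range_eq_base_range hφ (by decide)] at this
    obtain ⟨b, hb⟩ := this
    exact ⟨b, b, hb.symm, by simp⟩
  · have hn := hw.pos
    by_cases hyr : y ∈ (φ true).range
    · obtain ⟨b', rfl⟩ := hyr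
      rw [of_apply_eq_base] at hy
      by_cases hxr : x ∈ (φ false).range
      · obtain ⟨b, rfl⟩ := hxr
        rw [of_apply_eq_base] at hx
        exact ⟨b, b', hx.symm, hx.trans hy⟩
      · have := hw.inv.conj (j := false) (x := x) hxr
        rw [hx, hy] at this
        simp only [mul_assoc, inv_mul_cancel_left, inv_inv, inv_mul_cancel, mul_one] at this
        exact absurd (base_mem_range_of true b') fun h => by
          obtain ⟨z, hz⟩ := h
          rw [← hz] at this
          have := (this.of_eq hφ).2
          omega
    · have := hw.conj (j := true) hyr
      rw [← mul_assoc, ← hy, ← hx] at this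
      have := (this.of_eq hφ).2
      omega

theorem isReducedProd_apply {δ : PushoutI φ →* PushoutI φ}
    {w : PushoutI φ} {m : ℕ} (hw : IsReducedProd φ true false m w)
    (h₁ : ∀ x : G false, x ∉ (φ false).range →
      ∃ x' ∉ (φ false).range, δ (of false x) = of false x')
    (h₂ : ∀ y : G true, y ∉ (φ true).range →
      ∃ y' ∉ (φ true).range, δ (of true y) = w * of true y' * w⁻¹)
    {i j : Bool} {n : ℕ} {g : PushoutI φ} (hg : IsReducedProd φ i j n g) :
    ∃ p, IsReducedProd φ i j p (δ g) ∧ (i = true → 3 ≤ p) := by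
  have hm := hw.pos
  have key (i : Bool) (x : G i) (hx : x ∉ (φ i).range) :
      ∃ p, IsReducedProd φ i i p (δ (of i x)) ∧ (i = true → 3 ≤ p) := by
    cases i with
    | false =>
      obtain ⟨x', hx', h⟩ := h₁ x hx
      exact ⟨1, h ▸ .single _ _ hx', by simp⟩
    | true =>
      obtain ⟨y', hy', h⟩ := h₂ x hx
      rw [h, mul_assoc]
      exact ⟨_, hw.conj (j := true) hy', by omega⟩
  induction hg with
  | single i x hx => exact key i x hx
  | cons i j n x g hx hg ih =>
    obtain ⟨p, hp, -⟩ := ih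
    obtain ⟨r, hr, hr'⟩ := key i x hx
    rw [map_mul]
    exact ⟨r + p, hr.mul hp, fun h => (hr' h).trans (by omega)⟩

variable {ψ : ∀ i, Multiplicative ℤ →* G i}

theorem exists_zpow_of_factor_conj (hψ : ∀ i, Function.Injective (ψ i))
    {δ : PushoutI ψ →* PushoutI ψ} {h : PushoutI ψ}
    (h₁ : ∀ x : G false, δ (of false x) ∈ (of (φ := ψ) false).range)
    (h₂ : ∀ y : G true, ∃ y' : G true, δ (of true y) = h * of true y' * h⁻¹) :
    ∃ (x : G false) (y : G true) (w : PushoutI ψ) (k l : ℤ),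
      h = of false x * w * of true y ∧
      (w = 1 ∨ ∃ n, IsReducedProd ψ true false n w) ∧
      δ (base ψ (.ofAdd 1)) = of false x * base ψ (.ofAdd l) * (of false x)⁻¹ ∧
      base ψ (.ofAdd l) = w * base ψ (.ofAdd k) * w⁻¹ := by
  obtain ⟨x, y, w, rfl, hw⟩ := exists_eq_of_mul_mul_of h
  obtain ⟨b, b', hb, hb'⟩ := apply_base_of_reduced hψ
    (δ := (MulAut.conj (of false x)⁻¹).toMonoidHom.comp δ) hw
    (fun z => by
      obtain ⟨z', hz'⟩ := h₁ z
      exact ⟨x⁻¹ * z' * x, by simp [← hz']⟩)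
    (fun z => by
      obtain ⟨z', hz'⟩ := h₂ z
      exact ⟨y * z' * y⁻¹, by simp [hz', mul_assoc]⟩) (.ofAdd 1)
  refine ⟨x, y, w, b'.toAdd, b.toAdd, rfl, hw, ?_, hb'⟩
  rw [ofAdd_toAdd, ← hb]
  simp [mul_assoc]

theorem exists_conj_factors (hψ : ∀ i, Function.Injective (ψ i))
    (hconj : ∀ k l : ℤ, IsConj (base ψ (.ofAdd k)) (base ψ (.ofAdd l)) → k = l ∨ k = -l)
    (hne : ∃ y : G true, y ∉ (ψ true).range) (δ : PushoutI ψ ≃* PushoutI ψ) (h : PushoutI ψ)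
    (h₁ : ∀ z, δ z ∈ (of (φ := ψ) false).range ↔ z ∈ (of (φ := ψ) false).range)
    (h₂ : ∀ z, h⁻¹ * δ z * h ∈ (of (φ := ψ) true).range ↔ z ∈ (of (φ := ψ) true).range) :
    ∃ (g : PushoutI ψ) (l : ℤ), (l = 1 ∨ l = -1) ∧
      (∀ i z, g⁻¹ * δ z * g ∈ (of (φ := ψ) i).range ↔ z ∈ (of (φ := ψ) i).range) ∧
      δ (base ψ (.ofAdd 1)) = g * base ψ (.ofAdd l) * g⁻¹ := by
  have hpow (k l : ℤ) : base ψ (.ofAdd (k * l)) = base ψ (.ofAdd k) ^ l := by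
    rw [← map_zpow, ← ofAdd_zsmul, smul_eq_mul, mul_comm]
  have hpow1 (l : ℤ) : base ψ (.ofAdd l) = base ψ (.ofAdd 1) ^ l := by
    rw [← hpow, one_mul]
  obtain ⟨x, y, w, k, l, rfl, hw, hl, hk⟩ := exists_zpow_of_factor_conj hψ
    (δ := δ.toMonoidHom) (h := h) (fun x => (h₁ _).2 ⟨x, rfl⟩) (fun y => by
      obtain ⟨y', hy'⟩ := (h₂ (of true y)).2 ⟨y, rfl⟩
      exact ⟨y', by rw [hy']; simp [mul_assoc]⟩)
  obtain ⟨x', -, -, -, l', -, -, hl', -⟩ := exists_zpow_of_factor_conj hψ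
    (δ := δ.symm.toMonoidHom) (h := δ.symm (of false x * w * of true y)⁻¹)
    (fun x => (h₁ _).1 (by simp)) (fun z => by
      obtain ⟨z', hz'⟩ := (h₂ (δ.symm ((of false x * w * of true y) * of true z *
        (of false x * w * of true y)⁻¹))).1 ⟨z, by simp [mul_assoc]⟩
      refine ⟨z', ?_⟩
      rw [hz']
      simp [mul_assoc])
  have hll : l = 1 ∨ l = -1 := by
    have : IsConj (base ψ (.ofAdd (l * l'))) (base ψ (.ofAdd 1)) := by
      rw [isConj_iff]
      refine ⟨δ (of false x') * of false x, ?_⟩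
      have := congrArg δ hl'
      simp only [MulEquiv.toMonoidHom_eq_coe, MonoidHom.coe_coe, MulEquiv.apply_symm_apply,
        map_mul, map_inv] at this hl
      rw [hpow1 l', map_zpow, hl, conj_zpow, ← hpow] at this
      rw [this]
      simp [mul_assoc]
    rcases hconj _ _ this with h | h
    · exact Int.isUnit_iff.1 (IsUnit.of_mul_eq_one _ h)
    · exact Int.isUnit_iff.1 (IsUnit.of_mul_eq_one (-l') (by linarith))
  have hw1 : w = 1 := by
    refine hw.resolve_right ?_
    rintro ⟨n, hw⟩
    have hkk : k = 1 ∨ k = -1 := by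
      have := hconj k l (isConj_iff.2 ⟨w, hk.symm⟩)
      omega
    set δ' : PushoutI ψ ≃* PushoutI ψ := δ.trans (MulAut.conj (of false x)⁻¹) with hδ'
    have hδ'l : δ' (base ψ (.ofAdd 1)) = base ψ (.ofAdd 1) ^ l := by
      have : δ (base ψ (.ofAdd 1)) = _ := hl
      simp [hδ', this, mul_assoc, ← hpow1]
    have hl2 : l * l = 1 := by rcases hll with rfl | rfl <;> rfl
    have hk2 : k * k = 1 := by rcases hkk with rfl | rfl <;> rfl
    have hbase (c : Multiplicative ℤ) : ∃ a, δ' (base ψ a) = base ψ c := by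
      refine ⟨.ofAdd (l * c.toAdd), ?_⟩
      rw [hpow1, map_zpow, hδ'l, ← _root_.zpow_mul, ← mul_assoc, hl2, one_mul, ← hpow1, ofAdd_toAdd]
    have hbase' (c : Multiplicative ℤ) : ∃ a, δ' (base ψ a) = w * base ψ c * w⁻¹ := by
      obtain ⟨a, ha⟩ := hbase (.ofAdd (l * k * c.toAdd))
      refine ⟨a, ha.trans ?_⟩
      rw [mul_assoc, hpow, hk, conj_zpow, ← hpow, ← mul_assoc, hk2, one_mul, ofAdd_toAdd]
    have H := fun {i j : Bool} {m : ℕ} {g : PushoutI ψ} => isReducedProd_apply (i := i) (j := j)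
      (n := m) (g := g) (δ := δ'.toMonoidHom) hw
      (fun z hz => by
        obtain ⟨z', hz'⟩ := (h₁ (of false z)).2 ⟨z, rfl⟩
        refine ⟨x⁻¹ * z' * x, ?_, ?_⟩
        · rintro ⟨c, hc⟩
          obtain ⟨a, ha⟩ := hbase c
          rw [← of_apply_eq_base ψ false c, hc] at ha
          have : base ψ a = of false z := δ'.injective (by rw [ha]; simp [hδ', ← hz'])
          exact hz ((of_mem_base_range_iff hψ).1 ⟨a, this⟩)
        · simp [hδ', ← hz'])
      (fun z hz => by
        obtain ⟨z', hz'⟩ := (h₂ (of true z)).2 ⟨z, rfl⟩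
        have hz'' : δ' (of true z) = w * of true (y * z' * y⁻¹) * w⁻¹ := by
          simp [hδ', hz', mul_assoc]
        refine ⟨y * z' * y⁻¹, ?_, hz''⟩
        rintro ⟨c, hc⟩
        obtain ⟨a, ha⟩ := hbase' c
        rw [← of_apply_eq_base ψ true c, hc] at ha
        have : base ψ a = of true z := δ'.injective (by rw [ha, hz''])
        exact hz ((of_mem_base_range_iff hψ).1 ⟨a, this⟩))
    obtain ⟨t, ht⟩ := hne
    obtain ⟨g, hg⟩ := δ'.surjective (of true t)
    rcases mem_base_or_isReducedProd g with ⟨a, rfl⟩ | ⟨i, j, m, hgr⟩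
    · rw [← ofAdd_toAdd a, hpow1, map_zpow, hδ'l, ← _root_.zpow_mul, ← hpow1] at hg
      exact ht ((of_mem_base_range_iff hψ).1 ⟨_, hg⟩)
    · obtain ⟨p, hp, hp'⟩ := H hgr
      have hp2 : IsReducedProd ψ i j p (of true t) := hg ▸ hp
      obtain ⟨rfl, rfl⟩ := hp2.of_eq hψ
      exact absurd (hp' rfl) (by omega)
  subst hw1
  refine ⟨of false x, l, hll, ?_, hl⟩
  intro i z
  cases i with
  | false =>
    rw [← h₁ z, Subgroup.mul_mem_cancel_right _ (MonoidHom.mem_range.2 ⟨x, rfl⟩),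
      Subgroup.mul_mem_cancel_left _ (inv_mem (MonoidHom.mem_range.2 ⟨x, rfl⟩))]
  | true =>
    rw [← h₂ z]
    have : (of false x * 1 * of true y)⁻¹ * δ z * (of false x * 1 * of true y)
      = (of true y)⁻¹ * ((of false x)⁻¹ * δ z * of false x) * of true y := by simp [mul_assoc]
    rw [this, Subgroup.mul_mem_cancel_right _ (MonoidHom.mem_range.2 ⟨y, rfl⟩),
      Subgroup.mul_mem_cancel_left _ (inv_mem (MonoidHom.mem_range.2 ⟨y, rfl⟩))]

theorem exists_mulEquiv_of_range (hφ : ∀ i, Function.Injective (φ i))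
    (δ : PushoutI φ ≃* PushoutI φ) (c : PushoutI φ) (i j : Bool)
    (h : ∀ z, c⁻¹ * δ z * c ∈ (of (φ := φ) j).range ↔ z ∈ (of (φ := φ) i).range) :
    ∃ e : G i ≃* G j, ∀ x, δ (of i x) = c * of j (e x) * c⁻¹ := by
  choose f hf using fun x : G i => (h (of i x)).2 ⟨x, rfl⟩
  have hf' (x : G i) : δ (of i x) = c * of j (f x) * c⁻¹ := by rw [hf]; simp [mul_assoc]
  let F : G i →* G j := MonoidHom.mk' f fun a b => of_injective hφ j (by
    rw [hf, map_mul, map_mul, map_mul, hf, hf]; simp [mul_assoc])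
  refine ⟨MulEquiv.ofBijective F ⟨fun a b hab => ?_, fun y => ?_⟩, hf'⟩
  · refine of_injective hφ i (δ.injective ?_)
    rw [hf', hf']
    exact congrArg (fun t => c * of j t * c⁻¹) hab
  · obtain ⟨x, hx⟩ := (h (δ.symm (c * of j y * c⁻¹))).1 ⟨y, by simp [mul_assoc]⟩
    refine ⟨x, of_injective hφ j ((hf x).trans ?_)⟩
    rw [hx]
    simp [mul_assoc]

end Monoid.PushoutI

namespace Matrix.SpecialLinearGroup

variable {F : Type*} [Field F]

theorem diag2n_conj_transvection {ι : Type*} [Fintype ι] [DecidableEq ι] {i j k l : ι}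
    (hij : i ≠ j) (hkl : k ≠ l) {c : F} (hc : c ≠ 0) (b : F) :
    diag2n hij c hc * transvection hkl b * (diag2n hij c hc)⁻¹ =
      transvection hkl ((if k = i then c else if k = j then c⁻¹ else 1) * b *
        (if l = i then c else if l = j then c⁻¹ else 1)⁻¹) := by
  rw [mul_inv_eq_iff_eq_mul]
  have hl : (if l = i then c else if l = j then c⁻¹ else 1) ≠ 0 := by
    split_ifs <;> simp [hc]
  apply Subtype.ext
  simp only [coe_mul, transvection_coe, diag2n_coe, mul_add, add_mul, one_mul, mul_one]
  congr 1
  ext r s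
  rw [Matrix.diagonal_mul, Matrix.mul_diagonal, Matrix.single_apply, Matrix.single_apply]
  by_cases h : k = r ∧ l = s
  · obtain ⟨rfl, rfl⟩ := h
    simp only [and_self, if_true]
    rw [inv_mul_cancel_right₀ hl]
  · simp [h]

theorem commute_transvection {ι : Type*} [Fintype ι] [DecidableEq ι] {i j k l : ι}
    (hij : i ≠ j) (hkl : k ≠ l) (hjk : j ≠ k) (hil : i ≠ l) (a b : F) :
    Commute (transvection hij a) (transvection hkl b) := by
  apply Subtype.ext
  simp [transvection_coe, mul_add, add_mul, Matrix.single_mul_single_of_ne _ _ _ _ hjk,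
    Matrix.single_mul_single_of_ne _ _ _ _ hil.symm, add_comm, add_left_comm]

theorem isConj_transvection {i j : Fin 3} (hij : i ≠ j) {a b : F} (ha : a ≠ 0) (hb : b ≠ 0) :
    IsConj (transvection hij a) (transvection hij b) := by
  obtain ⟨k, hik, hjk⟩ : ∃ k, i ≠ k ∧ j ≠ k := by revert i j; decide
  refine isConj_iff.2 ⟨diag2n hik (b / a) (div_ne_zero hb ha), ?_⟩
  rw [diag2n_conj_transvection]
  simp [hij.symm, hjk, ha]

theorem transvection_pow {ι : Type*} [Fintype ι] [DecidableEq ι] {i j : ι} (hij : i ≠ j) (a : F)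
    (n : ℕ) : transvection hij a ^ n = transvection hij (n * a) := by
  induction n with
  | zero => simp
  | succ n ih => rw [pow_succ, ih, ← transvection_add]; push_cast; ring_nf

theorem transvection_ne_one {ι : Type*} [Fintype ι] [DecidableEq ι] {i j : ι} (hij : i ≠ j) {a : F}
    (ha : a ≠ 0) : transvection hij a ≠ 1 := by
  intro h
  refine ha ((transvection_mem_center_iff hij a).1 ?_)
  rw [h]
  exact one_mem _

theorem isConj_transvection_pow [CharZero F] {i j : Fin 3} (hij : i ≠ j) {a : F} (ha : a ≠ 0)
    (n : ℕ) : IsConj (transvection hij a) (transvection hij a ^ (n + 1)) := by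
  rw [transvection_pow]
  exact isConj_transvection hij ha (mul_ne_zero (by exact_mod_cast n.succ_ne_zero) ha)

theorem isConj_transvection_inv {i j : Fin 3} (hij : i ≠ j) {a : F} (ha : a ≠ 0) :
    IsConj (transvection hij a) (transvection hij a)⁻¹ := by
  rw [transvection_inv]
  exact isConj_transvection hij ha (neg_ne_zero.2 ha)

/-- A subgroup of `SL(3,F)` containing a transvection, and containing every element which
conjugates one of its transvections into itself, is everything. -/
theorem subgroup_eq_top_of_transvection (S : Subgroup (SpecialLinearGroup (Fin 3) F))
    (h₀ : transvection (zero_ne_one (α := Fin 3)) (1 : F) ∈ S)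
    (hS : ∀ (i j : Fin 3) (hij : i ≠ j) (x : F), x ≠ 0 → transvection hij x ∈ S →
      ∀ g, g * transvection hij x * g⁻¹ ∈ S → g ∈ S) : S = ⊤ := by
  have step {i j k l : Fin 3} (hij : i ≠ j) (hkl : k ≠ l) (hjk : j ≠ k) (hil : i ≠ l)
      (h : transvection hij (1 : F) ∈ S) (x : F) : transvection hkl x ∈ S := by
    refine hS i j hij 1 one_ne_zero h _ ?_
    rwa [(commute_transvection hij hkl hjk hil 1 x).symm.eq, mul_inv_cancel_right]
  have h01 : ∀ x : F, transvection (show (0 : Fin 3) ≠ 1 by decide) x ∈ S :=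
    step _ _ (by decide) (by decide) h₀
  have h02 : ∀ x : F, transvection (show (0 : Fin 3) ≠ 2 by decide) x ∈ S :=
    step _ _ (by decide) (by decide) (h01 1)
  have h12 : ∀ x : F, transvection (show (1 : Fin 3) ≠ 2 by decide) x ∈ S :=
    step _ _ (by decide) (by decide) (h02 1)
  have h10 : ∀ x : F, transvection (show (1 : Fin 3) ≠ 0 by decide) x ∈ S :=
    step _ _ (by decide) (by decide) (h12 1)
  have h20 : ∀ x : F, transvection (show (2 : Fin 3) ≠ 0 by decide) x ∈ S :=
    step _ _ (by decide) (by decide) (h10 1)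
  have h21 : ∀ x : F, transvection (show (2 : Fin 3) ≠ 1 by decide) x ∈ S :=
    step _ _ (by decide) (by decide) (h20 1)
  rw [eq_top_iff]
  rintro M -
  refine diagonal_transvection_induction' (· ∈ S) M (fun i j hij c hc => ?_)
    (fun i j hij a => ?_) (fun _ _ => S.mul_mem)
  · refine hS 0 1 zero_ne_one 1 one_ne_zero h₀ _ ?_
    rw [diag2n_conj_transvection]
    exact h01 _
  · fin_cases i <;> fin_cases j
    · exact absurd rfl hij
    · exact h01 a
    · exact h02 a
    · exact h10 a
    · exact absurd rfl hij
    · exact h12 a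
    · exact h20 a
    · exact h21 a
    · exact absurd rfl hij

end Matrix.SpecialLinearGroup

namespace Monoid.PushoutI

open Matrix.SpecialLinearGroup
variable {G : Bool → Type*} {H : Type*} [∀ i, Group (G i)] [Group H] {φ : ∀ i, H →* G i}

section

variable {F : Type*} [Field F] [CharZero F]

/-- No nontrivial element conjugate to its square, cube and inverse is conjugate into the
amalgamated subgroup. -/
def BaseAvoidsUnipotents (φ : ∀ i, H →* G i) : Prop :=
  ∀ u : PushoutI φ, IsConj u (u ^ 2) → IsConj u (u ^ 3) → IsConj u u⁻¹ →
    ∀ g, g * u * g⁻¹ ∈ (base φ).range → u = 1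

theorem conj_transvection_notMem_base_range (hφ : BaseAvoidsUnipotents φ)
    {f : Matrix.SpecialLinearGroup (Fin 3) F →* PushoutI φ} (hf : Function.Injective f)
    {i j : Fin 3} (hij : i ≠ j) {a : F} (ha : a ≠ 0) (g : PushoutI φ) :
    g * f (transvection hij a) * g⁻¹ ∉ (base φ).range := by
  intro h
  refine transvection_ne_one hij ha (hf ((hφ _ ?_ ?_ ?_ g h).trans f.map_one.symm))
  · rw [← map_pow]; exact f.map_isConj (isConj_transvection_pow hij ha 1)
  · rw [← map_pow]; exact f.map_isConj (isConj_transvection_pow hij ha 2)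
  · rw [← map_inv]; exact f.map_isConj (isConj_transvection_inv hij ha)

/-- An embedded `SL(3,F)` is conjugate into one of the factors. -/
theorem exists_conj_mem_range (hφ : ∀ i, Function.Injective (φ i)) (hb : BaseAvoidsUnipotents φ)
    (f : Matrix.SpecialLinearGroup (Fin 3) F →* PushoutI φ) (hf : Function.Injective f) :
    ∃ (c : PushoutI φ) (k : Bool), ∀ x, c⁻¹ * f x * c ∈ (of (φ := φ) k).range := by
  obtain ⟨c, k, x, hx⟩ := exists_conj_of_forall_pow hφ
    (u := f (transvection (zero_ne_one (α := Fin 3)) (1 : F))) fun n => by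
      refine ⟨f (transvection zero_ne_one ((n + 1 : ℕ) : F)⁻¹), ?_⟩
      rw [← map_pow, transvection_pow, mul_inv_cancel₀ (by exact_mod_cast n.succ_ne_zero)]
  let f' := (MulAut.conj c⁻¹).toMonoidHom.comp f
  have hf' : Function.Injective f' := (MulAut.conj c⁻¹).injective.comp hf
  have hf'_apply (x) : f' x = c⁻¹ * f x * c := by simp [f']
  refine ⟨c, k, ?_⟩
  suffices h : (of (φ := φ) k).range.comap f' = ⊤ by
    intro x
    rw [← hf'_apply]
    exact Subgroup.mem_comap.1 (h ▸ Subgroup.mem_top x)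
  refine subgroup_eq_top_of_transvection _ ⟨x, ?_⟩ ?_
  · rw [hf'_apply, hx]; group
  · rintro i j hij a ha ⟨y, hy⟩ g ⟨z, hz⟩
    rw [map_mul, map_mul, map_inv, ← hy] at hz
    refine (of_conj_mem_range hφ (x := y) ?_ hz.symm).2
    intro g
    rw [hy]
    exact conj_transvection_notMem_base_range hb hf' hij ha g

end
end Monoid.PushoutI

namespace Matrix.SpecialLinearGroup

variable {F : Type*} [Field F]

theorem trace_eq_of_isConj {n : Type*} [Fintype n] [DecidableEq n] {M N : SpecialLinearGroup n F}
    (h : IsConj M N) : (M : Matrix n n F).trace = (N : Matrix n n F).trace := by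
  obtain ⟨c, rfl⟩ := isConj_iff.1 h
  rw [coe_mul, Matrix.trace_mul_comm, ← coe_mul, inv_mul_cancel_left]

theorem sub_one_cube {R : Type*} [Ring R] (x : R) :
    (x - 1) ^ 3 = x ^ 3 - 3 • x ^ 2 + 3 • x - 1 := by
  noncomm_ring

theorem cube_eq (M : SpecialLinearGroup (Fin 3) F) :
    (M : Matrix (Fin 3) (Fin 3) F) ^ 3 =
      (M : Matrix (Fin 3) (Fin 3) F).trace • (M : Matrix (Fin 3) (Fin 3) F) ^ 2 -
        ((M⁻¹ : SpecialLinearGroup (Fin 3) F) : Matrix (Fin 3) (Fin 3) F).trace •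
          (M : Matrix (Fin 3) (Fin 3) F) + 1 := by
  have h := M.det_coe
  rw [coe_inv]
  generalize (M : Matrix (Fin 3) (Fin 3) F) = M at h ⊢
  rw [← one_smul F (1 : Matrix (Fin 3) (Fin 3) F), ← h]
  simp only [Matrix.adjugate_fin_three, Matrix.det_fin_three, Matrix.trace_fin_three, pow_succ,
    pow_zero, one_mul]
  ext i j
  fin_cases i <;> fin_cases j <;>
    simp [Matrix.mul_apply, Fin.sum_univ_three] <;> ring

/-- An element of `SL(3,F)` which has the same trace as its square, cube and inverse is unipotent. -/
theorem unipotent_of_trace_eq {M : SpecialLinearGroup (Fin 3) F}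
    (h₂ : (M : Matrix (Fin 3) (Fin 3) F).trace = ((M ^ 2 : SpecialLinearGroup (Fin 3) F) :
      Matrix (Fin 3) (Fin 3) F).trace)
    (h₃ : (M : Matrix (Fin 3) (Fin 3) F).trace = ((M ^ 3 : SpecialLinearGroup (Fin 3) F) :
      Matrix (Fin 3) (Fin 3) F).trace)
    (h₁ : (M : Matrix (Fin 3) (Fin 3) F).trace = ((M⁻¹ : SpecialLinearGroup (Fin 3) F) :
      Matrix (Fin 3) (Fin 3) F).trace) :
    (M : Matrix (Fin 3) (Fin 3) F).trace = 3 ∧ ((M : Matrix (Fin 3) (Fin 3) F) - 1) ^ 3 = 0 := by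
  have key := cube_eq M
  rw [← h₁] at key
  rw [coe_pow] at h₂ h₃
  have ht : (M : Matrix (Fin 3) (Fin 3) F).trace = 3 := by
    have := congrArg Matrix.trace key
    rw [Matrix.trace_add, Matrix.trace_sub, Matrix.trace_smul, Matrix.trace_smul, ← h₂, ← h₃,
      Matrix.trace_one] at this
    simpa using this
  refine ⟨ht, ?_⟩
  rw [ht] at key
  generalize (M : Matrix (Fin 3) (Fin 3) F) = N at key ⊢
  have h3 (x : Matrix (Fin 3) (Fin 3) F) : (3 : F) • x = 3 • x := by
    ext; simp
  rw [h3, h3] at key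
  rw [sub_one_cube, key]
  generalize 3 • N ^ 2 = x, 3 • N = y
  abel

theorem unipotent_of_isConj {M : SpecialLinearGroup (Fin 3) F} (h₂ : IsConj M (M ^ 2))
    (h₃ : IsConj M (M ^ 3)) (h₁ : IsConj M M⁻¹) :
    (M : Matrix (Fin 3) (Fin 3) F).trace = 3 ∧ ((M : Matrix (Fin 3) (Fin 3) F) - 1) ^ 3 = 0 :=
  unipotent_of_trace_eq (trace_eq_of_isConj h₂) (trace_eq_of_isConj h₃) (trace_eq_of_isConj h₁)

end Matrix.SpecialLinearGroup

section AmatSL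

variable (F : Type) [Field F] [CharZero F] {q : ℚ} (hq : q ≠ 0)

theorem AmatSL_inv : (((AmatSL F q hq)⁻¹ : Matrix.SpecialLinearGroup (Fin 3) F) :
    Matrix (Fin 3) (Fin 3) F) =
      !![1, 0, 0; -(q : F)⁻¹, (q : F)⁻¹, 0; -(q : F), 0, q] := by
  have hq' : (q : F) ≠ 0 := by exact_mod_cast hq
  rw [Matrix.SpecialLinearGroup.coe_inv, AmatSL, Matrix.adjugate_fin_three]
  ext i j
  fin_cases i <;> fin_cases j <;> simp [hq']

theorem AmatSL_zpow (k : ℤ) : ∃ a b : F, ((AmatSL F q hq ^ k : Matrix.SpecialLinearGroup (Fin 3) F) :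
    Matrix (Fin 3) (Fin 3) F) = !![1, 0, 0; a, (q : F) ^ k, 0; b, 0, (q : F) ^ (-k)] := by
  have hq' : (q : F) ≠ 0 := by exact_mod_cast hq
  induction k with
  | zero =>
    refine ⟨0, 0, ?_⟩
    ext i j
    fin_cases i <;> fin_cases j <;> simp
  | succ k ih =>
    obtain ⟨a, b, h⟩ := ih
    refine ⟨a + q ^ (k : ℤ), b + q ^ (-k : ℤ), ?_⟩
    rw [_root_.zpow_add_one, Matrix.SpecialLinearGroup.coe_mul, h, neg_add, ← sub_eq_add_neg,
      zpow_add_one₀ hq', zpow_sub_one₀ hq']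
    ext i j
    fin_cases i <;> fin_cases j <;> simp [AmatSL, Matrix.mul_apply, Fin.sum_univ_three]
  | pred k ih =>
    obtain ⟨a, b, h⟩ := ih
    refine ⟨a - q ^ (-k : ℤ) * (q : F)⁻¹, b - q ^ (k : ℤ) * q, ?_⟩
    rw [_root_.zpow_sub_one, Matrix.SpecialLinearGroup.coe_mul, h, AmatSL_inv, neg_sub', neg_neg,
      sub_neg_eq_add, zpow_add_one₀ hq', zpow_sub_one₀ hq']
    ext i j
    fin_cases i <;> fin_cases j <;>
      simp [Matrix.mul_apply, Fin.sum_univ_three, sub_eq_add_neg]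

theorem trace_AmatSL_zpow (k : ℤ) :
    ((AmatSL F q hq ^ k : Matrix.SpecialLinearGroup (Fin 3) F) :
      Matrix (Fin 3) (Fin 3) F).trace = 1 + (q : F) ^ k + (q : F) ^ (-k) := by
  obtain ⟨a, b, h⟩ := AmatSL_zpow F hq k
  rw [h, Matrix.trace_fin_three]
  simp

theorem trace_AmatSL_zpow_inj (hq1 : q ≠ 1) (hqm1 : q ≠ -1) {k l : ℤ}
    (h : ((AmatSL F q hq ^ k : Matrix.SpecialLinearGroup (Fin 3) F) :
      Matrix (Fin 3) (Fin 3) F).trace = ((AmatSL F q hq ^ l : Matrix.SpecialLinearGroup (Fin 3) F) :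
      Matrix (Fin 3) (Fin 3) F).trace) : k = l ∨ k = -l := by
  rw [trace_AmatSL_zpow, trace_AmatSL_zpow] at h
  have h' : q ^ k + q ^ (-k) = q ^ l + q ^ (-l) := by
    have : (1 : ℚ) + q ^ k + q ^ (-k) = 1 + q ^ l + q ^ (-l) := by exact_mod_cast h
    linarith
  have hinj {m n : ℤ} (hmn : q ^ m = q ^ n) : m = n := by
    refine zpow_right_injective₀ (a := |q|) (abs_pos.2 hq) (fun h1 => ?_) ?_
    · rcases (abs_eq zero_le_one).1 h1 with h1 | h1 <;> contradiction
    · simp only [← abs_zpow, hmn]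
  have hk : q ^ k ≠ 0 := zpow_ne_zero _ hq
  have hl : q ^ l ≠ 0 := zpow_ne_zero _ hq
  have hprod : (q ^ k - q ^ l) * (q ^ k - q ^ (-l)) = 0 := by
    rw [_root_.zpow_neg, _root_.zpow_neg] at h'
    rw [_root_.zpow_neg]
    field_simp at h' ⊢
    linear_combination h'
  rcases mul_eq_zero.1 hprod with h0 | h0
  · exact Or.inl (hinj (sub_eq_zero.1 h0))
  · exact Or.inr (hinj (sub_eq_zero.1 h0))

theorem AmatSL_zpow_eq_one (hq1 : q ≠ 1) (hqm1 : q ≠ -1) {k : ℤ} (h : AmatSL F q hq ^ k = 1) :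
    k = 0 := by
  have := trace_AmatSL_zpow_inj F hq hq1 hqm1 (k := k) (l := 0) (by rw [h, zpow_zero])
  omega

end AmatSL

section AmalGamma

variable (K : Type) [Field K] [CharZero K] {q : ℚ} (hq : q ≠ 0)

theorem sigmaMaps_injective (hq1 : q ≠ 1) (hqm1 : q ≠ -1) (i : Bool) :
    Function.Injective (sigmaMaps K q hq i) := by
  rw [injective_iff_map_eq_one]
  intro k hk
  cases i
  · exact AmatSL_zpow_eq_one ℚ hq hq1 hqm1 (k := k.toAdd) hk
  · exact AmatSL_zpow_eq_one K hq hq1 hqm1 (k := k.toAdd) hk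

theorem map_AmatSL : Matrix.SpecialLinearGroup.map (algebraMap ℚ K) (AmatSL ℚ q hq) =
    AmatSL K q hq := by
  apply Subtype.ext
  rw [Matrix.SpecialLinearGroup.map_apply_coe, AmatSL, AmatSL]
  ext i j
  fin_cases i <;> fin_cases j <;> simp

/-- The retraction of `Γ` onto its factor `SL(3,K)`. -/
def amalRetract : AmalGamma K q hq →* Matrix.SpecialLinearGroup (Fin 3) K :=
  Monoid.PushoutI.lift
    (fun
      | false => Matrix.SpecialLinearGroup.map (algebraMap ℚ K)
      | true => MonoidHom.id (Matrix.SpecialLinearGroup (Fin 3) K))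
    (zpowersHom _ (AmatSL K q hq)) (by
      rintro (_ | _) <;> apply MonoidHom.ext_mint
      · change Matrix.SpecialLinearGroup.map (algebraMap ℚ K) (AmatSL ℚ q hq ^ (1 : ℤ)) =
          AmatSL K q hq ^ (1 : ℤ)
        rw [map_zpow, map_AmatSL]
      · rfl)

theorem amalRetract_base (k : ℤ) :
    amalRetract K hq (Monoid.PushoutI.base (sigmaMaps K q hq) (.ofAdd k)) = AmatSL K q hq ^ k := by
  rw [amalRetract, Monoid.PushoutI.lift_base]
  rfl

theorem eq_or_eq_neg_of_isConj_base (hq1 : q ≠ 1) (hqm1 : q ≠ -1) {k l : ℤ}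
    (h : IsConj (Monoid.PushoutI.base (sigmaMaps K q hq) (.ofAdd k))
      (Monoid.PushoutI.base (sigmaMaps K q hq) (.ofAdd l))) : k = l ∨ k = -l := by
  have h := Matrix.SpecialLinearGroup.trace_eq_of_isConj ((amalRetract K hq).map_isConj h)
  rw [amalRetract_base, amalRetract_base] at h
  exact trace_AmatSL_zpow_inj K hq hq1 hqm1 h

theorem baseAvoidsUnipotents (hq1 : q ≠ 1) (hqm1 : q ≠ -1) :
    Monoid.PushoutI.BaseAvoidsUnipotents (sigmaMaps K q hq) := by
  rintro u h₂ h₃ h₁ g ⟨k, hk⟩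
  have htr := (Matrix.SpecialLinearGroup.unipotent_of_isConj
    (M := amalRetract K hq u) (by rw [← map_pow]; exact (amalRetract K hq).map_isConj h₂)
    (by rw [← map_pow]; exact (amalRetract K hq).map_isConj h₃)
    (by rw [← map_inv]; exact (amalRetract K hq).map_isConj h₁)).1
  have hc : IsConj (amalRetract K hq u) (AmatSL K q hq ^ k.toAdd) := by
    rw [← amalRetract_base]
    exact (amalRetract K hq).map_isConj (isConj_iff.2 ⟨g, hk.symm⟩)
  rw [Matrix.SpecialLinearGroup.trace_eq_of_isConj hc] at htr
  have hk0 := trace_AmatSL_zpow_inj K hq hq1 hqm1 (k := k.toAdd) (l := 0) (by rw [htr]; simp)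
  have hk1 : k = 1 := by
    change k.toAdd = 0
    omega
  rw [hk1, map_one] at hk
  exact conj_eq_one_iff.1 hk.symm

end AmalGamma

namespace Matrix

variable {F : Type*} [Field F]

theorem isUnit_transpose_of_linearIndependent {v : Fin 3 → Fin 3 → F}
    (h : LinearIndependent F v) : IsUnit (Matrix.of v)ᵀ :=
  linearIndependent_cols_iff_isUnit.1 h

/-- A nonzero `3 × 3` nilpotent matrix has one of two Jordan normal forms. -/
theorem exists_conj_of_pow_three_eq_zero {N : Matrix (Fin 3) (Fin 3) F} (hN : N ≠ 0)
    (h₃ : N ^ 3 = 0) : ∃ S : (Matrix (Fin 3) (Fin 3) F)ˣ,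
      N * (S : Matrix (Fin 3) (Fin 3) F) =
        S * (!![0, 1, 0; 0, 0, 1; 0, 0, 0] : Matrix (Fin 3) (Fin 3) F) ∨
        N * (S : Matrix (Fin 3) (Fin 3) F) =
        S * (!![0, 0, 1; 0, 0, 0; 0, 0, 0] : Matrix (Fin 3) (Fin 3) F) := by
  have hex {A : Matrix (Fin 3) (Fin 3) F} (hA : A ≠ 0) : ∃ v, A *ᵥ v ≠ 0 := by
    by_contra! h
    exact hA (Matrix.ext_of_mulVec_single fun i => by rw [h, zero_mulVec])
  by_cases h₂ : N * N = 0
  · obtain ⟨v, hv⟩ := hex hN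
    have hN2 (x) : N *ᵥ (N *ᵥ x) = 0 := by rw [mulVec_mulVec, h₂, zero_mulVec]
    obtain ⟨w, hw, hwv⟩ : ∃ w, N *ᵥ w = 0 ∧ w ∉ Submodule.span F {N *ᵥ v} := by
      by_contra! h
      have hker : LinearMap.ker N.mulVecLin ≤ Submodule.span F {N *ᵥ v} := fun w hw => h w hw
      have hrange : LinearMap.range N.mulVecLin ≤ LinearMap.ker N.mulVecLin := by
        rintro _ ⟨x, rfl⟩
        exact hN2 x
      have h1 := Submodule.finrank_mono hker
      have h2 := Submodule.finrank_mono hrange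
      have h3 := N.mulVecLin.finrank_range_add_finrank_ker
      rw [finrank_span_singleton hv] at h1
      simp only [Module.finrank_fintype_fun_eq_card, Fintype.card_fin] at h3
      omega
    have hli : LinearIndependent F ![N *ᵥ v, w, v] := by
      rw [Fintype.linearIndependent_iff]
      intro g hg
      simp only [Fin.sum_univ_three, cons_val_zero, cons_val_one, cons_val] at hg
      have h2 : g 2 = 0 := by
        have := congrArg (N *ᵥ ·) hg
        simpa [-mulVec_mulVec, mulVec_add, mulVec_smul, hw, hN2, hv] using this
      have h1 : g 1 = 0 := by
        by_contra h1
        refine hwv (Submodule.mem_span_singleton.2 ⟨-(g 0 / g 1), ?_⟩)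
        rw [h2, zero_smul, add_zero] at hg
        have := congrArg ((g 1)⁻¹ • ·) hg
        simp only [smul_add, smul_smul, inv_mul_cancel₀ h1, one_smul, smul_zero] at this
        rw [neg_smul, div_eq_inv_mul, neg_eq_iff_add_eq_zero, this]
      have h0 : g 0 = 0 := by simpa [-mulVec_mulVec, h1, h2, hv] using hg
      intro i
      fin_cases i <;> assumption
    refine ⟨(isUnit_transpose_of_linearIndependent hli).unit, Or.inr ?_⟩
    rw [IsUnit.unit_spec]
    ext i j
    have key (j : Fin 3) : (N * (Matrix.of ![N *ᵥ v, w, v])ᵀ) i j =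
      (N *ᵥ (![N *ᵥ v, w, v] j)) i := rfl
    rw [key]
    fin_cases j <;> simp [-mulVec_mulVec, hN2, hw, mul_apply, Fin.sum_univ_three]
  · obtain ⟨v, hv⟩ := hex h₂
    rw [← mulVec_mulVec] at hv
    have hN3 : N *ᵥ (N *ᵥ (N *ᵥ v)) = 0 := by
      rw [mulVec_mulVec, mulVec_mulVec, ← pow_three', h₃, zero_mulVec]
    have hli : LinearIndependent F ![N *ᵥ (N *ᵥ v), N *ᵥ v, v] := by
      rw [Fintype.linearIndependent_iff]
      intro g hg
      simp only [Fin.sum_univ_three, cons_val_zero, cons_val_one, cons_val] at hg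
      have h2 : g 2 = 0 := by
        have := congrArg (fun x => N *ᵥ (N *ᵥ x)) hg
        simpa [-mulVec_mulVec, mulVec_add, mulVec_smul, hN3, hv] using this
      have h1 : g 1 = 0 := by
        have := congrArg (N *ᵥ ·) hg
        simpa [-mulVec_mulVec, mulVec_add, mulVec_smul, hN3, hv, h2] using this
      have h0 : g 0 = 0 := by simpa [-mulVec_mulVec, h1, h2, hv] using hg
      intro i
      fin_cases i <;> assumption
    refine ⟨(isUnit_transpose_of_linearIndependent hli).unit, Or.inl ?_⟩
    rw [IsUnit.unit_spec]
    ext i j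
    have key (j : Fin 3) : (N * (Matrix.of ![N *ᵥ (N *ᵥ v), N *ᵥ v, v])ᵀ) i j =
      (N *ᵥ (![N *ᵥ (N *ᵥ v), N *ᵥ v, v] j)) i := rfl
    rw [key]
    fin_cases j <;> simp [-mulVec_mulVec, hN3, mul_apply, Fin.sum_univ_three]

theorem eq_of_commute_jordan {B : Matrix (Fin 3) (Fin 3) F}
    (h : Commute B !![0, 1, 0; 0, 0, 1; 0, 0, 0]) :
    B = !![B 0 0, B 0 1, B 0 2; 0, B 0 0, B 0 1; 0, 0, B 0 0] := by
  have key (i j : Fin 3) := congrFun (congrFun h.eq i) j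
  simp only [mul_apply, Fin.sum_univ_three] at key
  have h00 := key 0 0
  have h10 := key 1 0
  have h01 := key 0 1
  have h02 := key 0 2
  have h11 := key 1 1
  have h12 := key 1 2
  simp at h00 h10 h01 h02 h11 h12
  ext i j
  fin_cases i <;> fin_cases j <;> simp_all

theorem commute_of_commute_jordan {B C : Matrix (Fin 3) (Fin 3) F}
    (hB : Commute B !![0, 1, 0; 0, 0, 1; 0, 0, 0])
    (hC : Commute C !![0, 1, 0; 0, 0, 1; 0, 0, 0]) : Commute B C := by
  rw [eq_of_commute_jordan hB, eq_of_commute_jordan hC]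
  ext i j
  fin_cases i <;> fin_cases j <;> simp [mul_apply, Fin.sum_univ_three] <;> ring

namespace SpecialLinearGroup

/-- Conjugation by an invertible matrix, as an automorphism of the special linear group. -/
def conjUnits (S : (Matrix (Fin 3) (Fin 3) F)ˣ) :
    SpecialLinearGroup (Fin 3) F ≃* SpecialLinearGroup (Fin 3) F where
  toFun M := ⟨(S⁻¹ : (Matrix (Fin 3) (Fin 3) F)ˣ) * (M : Matrix (Fin 3) (Fin 3) F) * S, by
    rw [det_units_conj', M.det_coe]⟩
  invFun M := ⟨S * (M : Matrix (Fin 3) (Fin 3) F) * (S⁻¹ : (Matrix (Fin 3) (Fin 3) F)ˣ), by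
    rw [det_units_conj, M.det_coe]⟩
  left_inv M := Subtype.ext <| by simp [mul_assoc]
  right_inv M := Subtype.ext <| by simp [mul_assoc]
  map_mul' M N := Subtype.ext <| by
    refine Eq.trans ?_ (coe_mul _ _).symm
    simp [mul_assoc]

theorem conjUnits_coe {S : (Matrix (Fin 3) (Fin 3) F)ˣ} {M : SpecialLinearGroup (Fin 3) F}
    {J : Matrix (Fin 3) (Fin 3) F} (h : ((M : Matrix (Fin 3) (Fin 3) F) - 1) * S = S * J) :
    (conjUnits S M : Matrix (Fin 3) (Fin 3) F) = 1 + J := by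
  change (S⁻¹ : (Matrix (Fin 3) (Fin 3) F)ˣ) * (M : Matrix (Fin 3) (Fin 3) F) * S = 1 + J
  rw [sub_mul, one_mul, sub_eq_iff_eq_add'] at h
  rw [mul_assoc, h, mul_add, Units.inv_mul, ← mul_assoc, Units.inv_mul, one_mul]

theorem commute_coe_iff {n : Type*} [Fintype n] [DecidableEq n] {M N : SpecialLinearGroup n F} :
    Commute (M : Matrix n n F) (N : Matrix n n F) ↔ Commute M N :=
  ⟨fun h => Subtype.ext h, fun h => congrArg Subtype.val h.eq⟩

theorem commute_transvection_iff {n : Type*} [Fintype n] [DecidableEq n] {i j : n} (hij : i ≠ j)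
    {x : F} (hx : x ≠ 0) {M : SpecialLinearGroup n F} :
    Commute M (transvection hij x) ↔ Commute (M : Matrix n n F) (Matrix.single i j 1) := by
  rw [← commute_coe_iff, transvection_coe, show Matrix.single i j x = x • Matrix.single i j (1 : F)
    by simp]
  constructor
  · intro h
    have := (h.sub_right (Commute.one_right _)).smul_right x⁻¹
    simpa [smul_smul, hx] using this
  · intro h
    exact (Commute.one_right _).add_right (h.smul_right x)

theorem transvection_zpow {ι : Type*} [Fintype ι] [DecidableEq ι] {i j : ι} (hij : i ≠ j) (a : F)
    (n : ℤ) : transvection hij a ^ n = transvection hij (n * a) := by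
  cases n with
  | ofNat n => simp [transvection_pow]
  | negSucc n => rw [zpow_negSucc, transvection_pow, transvection_inv]; push_cast; ring_nf

theorem transvection_injective {ι : Type*} [Fintype ι] [DecidableEq ι] {i j : ι} (hij : i ≠ j) :
    Function.Injective (transvection (F := F) hij) := by
  intro a b h
  have := congrFun (congrFun (congrArg Subtype.val h) i) j
  simpa [transvection_coe, hij] using this

variable {K : Type*} [Field K]

theorem not_jordan_of_mulEquiv (e : SpecialLinearGroup (Fin 3) K ≃* SpecialLinearGroup (Fin 3) F)
    (h : (e (transvection (show (0 : Fin 3) ≠ 2 by decide) 1) : Matrix (Fin 3) (Fin 3) F) =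
      1 + !![0, 1, 0; 0, 0, 1; 0, 0, 0]) : False := by
  have hc {g : SpecialLinearGroup (Fin 3) K}
      (hg : Commute g (transvection (show (0 : Fin 3) ≠ 2 by decide) 1)) :
      Commute (e g : Matrix (Fin 3) (Fin 3) F) !![0, 1, 0; 0, 0, 1; 0, 0, 0] := by
    have := commute_coe_iff.2 (hg.map e)
    rw [h] at this
    simpa using this.sub_right (Commute.one_right _)
  have h₁ := hc (commute_transvection (show (0 : Fin 3) ≠ 1 by decide) _ (by decide) (by decide)
    (1 : K) 1)
  have h₂ := hc (commute_transvection (show (1 : Fin 3) ≠ 2 by decide) _ (by decide) (by decide)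
    (1 : K) 1)
  have h₃ := commute_coe_iff.1 (commute_of_commute_jordan h₁ h₂)
  have h₄ := commute_coe_iff.2 (h₃.map e.symm)
  simp only [MulEquiv.symm_apply_apply] at h₄
  have := congrFun (congrFun h₄.eq 0) 2
  simp [transvection_coe, mul_apply, Fin.sum_univ_three, Matrix.one_apply, Matrix.single_apply]
    at this

theorem eq_transvection_of_commute {Q : SpecialLinearGroup (Fin 3) ℚ}
    (h₁ : Commute Q (transvection (show (0 : Fin 3) ≠ 1 by decide) 1))
    (h₂ : Commute Q (transvection (show (1 : Fin 3) ≠ 2 by decide) 1)) :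
    ∃ b, Q = transvection (show (0 : Fin 3) ≠ 2 by decide) b := by
  rw [commute_transvection_iff _ one_ne_zero] at h₁ h₂
  have k₁ (i j : Fin 3) := congrFun (congrFun h₁.eq i) j
  have k₂ (i j : Fin 3) := congrFun (congrFun h₂.eq i) j
  simp only [mul_apply, Fin.sum_univ_three, Matrix.single_apply] at k₁ k₂
  have a01 := k₁ 0 1
  have a11 := k₁ 1 1
  have a21 := k₁ 2 1
  have a02 := k₁ 0 2
  have b12 := k₂ 1 2
  have b02 := k₂ 0 2
  have b22 := k₂ 2 2
  simp at a01 a11 a21 a02 b12 b02 b22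
  have hd := Q.det_coe
  rw [det_fin_three, a11, a21, b02, b22, ← a02, ← b12, ← a01] at hd
  have h00 : Q 0 0 = 1 := by
    have h : (Q 0 0 - 1) * (Q 0 0 ^ 2 + Q 0 0 + 1) = 0 := by linear_combination hd
    refine sub_eq_zero.1 ((mul_eq_zero.1 h).resolve_right ?_)
    nlinarith [sq_nonneg (Q 0 0 + 1)]
  have h11 : Q 1 1 = 1 := a01.symm.trans h00
  have h22 : Q 2 2 = 1 := b12.symm.trans h11
  refine ⟨Q 0 2, Subtype.ext ?_⟩
  rw [transvection_coe]
  ext i j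
  fin_cases i <;> fin_cases j <;>
    simp [h00, h11, h22, a11, a21, b02, b22, ← a02]

theorem surjective_ratCast_of_mulEquiv_of_transvection [CharZero K]
    (e : SpecialLinearGroup (Fin 3) K ≃* SpecialLinearGroup (Fin 3) ℚ)
    (h : e (transvection (show (0 : Fin 3) ≠ 2 by decide) 1) =
      transvection (show (0 : Fin 3) ≠ 2 by decide) 1) : Function.Surjective ((↑) : ℚ → K) := by
  intro x
  rcases eq_or_ne x 0 with rfl | hx
  · exact ⟨0, Rat.cast_zero⟩
  have hc {R : SpecialLinearGroup (Fin 3) ℚ}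
      (hR : Commute R (transvection (show (0 : Fin 3) ≠ 2 by decide) 1)) :
      Commute (e (transvection (show (0 : Fin 3) ≠ 2 by decide) x)) R := by
    rw [← h, ← e.apply_symm_apply R] at hR
    have hR' := hR.map e.symm
    simp only [MulEquiv.symm_apply_apply] at hR'
    rw [commute_transvection_iff _ one_ne_zero, ← commute_transvection_iff _ hx] at hR'
    simpa using (hR'.map e).symm
  obtain ⟨b, hb⟩ := eq_transvection_of_commute
    (hc (commute_transvection _ _ (by decide) (by decide) 1 1))
    (hc (commute_transvection _ _ (by decide) (by decide) 1 1))
  refine ⟨b, ?_⟩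
  have hpow : transvection (show (0 : Fin 3) ≠ 2 by decide) x ^ b.den =
      transvection (show (0 : Fin 3) ≠ 2 by decide) 1 ^ b.num := by
    apply e.injective
    rw [map_pow, map_zpow, hb, h, transvection_pow, transvection_zpow, mul_one, mul_comm,
      Rat.mul_den_eq_num]
  rw [transvection_pow, transvection_zpow, mul_one] at hpow
  rw [Rat.cast_def, div_eq_iff (by exact_mod_cast b.den_ne_zero), mul_comm,
    transvection_injective _ hpow]

/-- Among fields of characteristic zero, only `ℚ` has `SL(3)` isomorphic to that of `ℚ`. -/
theorem surjective_ratCast_of_mulEquiv [CharZero K]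
    (e : SpecialLinearGroup (Fin 3) K ≃* SpecialLinearGroup (Fin 3) ℚ) :
    Function.Surjective ((↑) : ℚ → K) := by
  set t : SpecialLinearGroup (Fin 3) K := transvection (show (0 : Fin 3) ≠ 2 by decide) 1 with ht
  have hu := (unipotent_of_isConj (M := e t)
    (by rw [← map_pow]; exact e.toMonoidHom.map_isConj (isConj_transvection_pow _ one_ne_zero 1))
    (by rw [← map_pow]; exact e.toMonoidHom.map_isConj (isConj_transvection_pow _ one_ne_zero 2))
    (by rw [← map_inv]; exact e.toMonoidHom.map_isConj (isConj_transvection_inv _ one_ne_zero))).2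
  have hne : (e t : Matrix (Fin 3) (Fin 3) ℚ) - 1 ≠ 0 := by
    intro h
    refine transvection_ne_one (show (0 : Fin 3) ≠ 2 by decide) one_ne_zero
      ((map_eq_one_iff e e.injective).1 ?_)
    exact Subtype.ext (sub_eq_zero.1 h)
  obtain ⟨S, hS | hS⟩ := exists_conj_of_pow_three_eq_zero hne hu
  · exact (not_jordan_of_mulEquiv (e.trans (conjUnits S)) (conjUnits_coe hS)).elim
  · refine surjective_ratCast_of_mulEquiv_of_transvection (e.trans (conjUnits S)) ?_
    apply Subtype.ext
    refine (conjUnits_coe hS).trans ?_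
    rw [transvection_coe]
    congr 1
    ext i j
    fin_cases i <;> fin_cases j <;> simp

end SpecialLinearGroup

end Matrix

namespace Monoid.PushoutI

variable {G : Bool → Type*} {H : Type*} [∀ i, Group (G i)] [Group H] {φ : ∀ i, H →* G i}

/-- If every automorphism maps each factor into a conjugate of a factor, then it maps each factor
onto a conjugate of a factor. -/
theorem exists_conj_mem_range_iff (hφ : ∀ i, Function.Injective (φ i))
    (hfac : ∀ (i : Bool) (δ : PushoutI φ ≃* PushoutI φ), ∃ (c : PushoutI φ) (k : Bool),
      ∀ x : G i, c⁻¹ * δ (of i x) * c ∈ (of (φ := φ) k).range)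
    (i : Bool) (hi : ∃ t : G i, ∀ g : PushoutI φ, g * of i t * g⁻¹ ∉ (base φ).range)
    (δ : PushoutI φ ≃* PushoutI φ) : ∃ (c : PushoutI φ) (k : Bool),
      ∀ z, c⁻¹ * δ z * c ∈ (of (φ := φ) k).range ↔ z ∈ (of (φ := φ) i).range := by
  obtain ⟨c, k, hc⟩ := hfac i δ
  obtain ⟨c', k', hc'⟩ := hfac k δ.symm
  have hback (z : PushoutI φ) (hz : c⁻¹ * δ z * c ∈ (of (φ := φ) k).range) :
      (δ.symm c * c')⁻¹ * z * (δ.symm c * c') ∈ (of (φ := φ) k').range := by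
    obtain ⟨y, hy⟩ := hz
    have := hc' y
    rw [hy] at this
    simpa [mul_assoc] using this
  obtain ⟨t, ht⟩ := hi
  obtain ⟨s, hs⟩ := hback (of i t) (hc t)
  obtain ⟨rfl, hd⟩ := of_conj_mem_range hφ (c := (δ.symm c * c')⁻¹) (y := s) ht
    (by rw [hs, inv_inv])
  rw [inv_mem_iff] at hd
  refine ⟨c, k, fun z => ⟨fun hz => ?_, ?_⟩⟩
  · have := mul_mem (mul_mem hd (hback z hz)) (inv_mem hd)
    simpa [mul_assoc] using this
  · rintro ⟨x, rfl⟩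
    exact hc x

end Monoid.PushoutI

section AmalGamma

variable (K : Type) [Field K] [CharZero K] {q : ℚ} (hq : q ≠ 0)

theorem amalGamma_exists_conj_mem_range (hq1 : q ≠ 1) (hqm1 : q ≠ -1) (i : Bool)
    (δ : AmalGamma K q hq ≃* AmalGamma K q hq) : ∃ (c : AmalGamma K q hq) (k : Bool),
      ∀ x : SLfam K i, c⁻¹ * δ (amalInc K q hq i x) * c ∈ (amalInc K q hq k).range := by
  have hinj := sigmaMaps_injective K hq hq1 hqm1
  have hb := baseAvoidsUnipotents K hq hq1 hqm1
  have hδ : Function.Injective (δ.toMonoidHom.comp (amalInc K q hq i)) :=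
    δ.injective.comp (Monoid.PushoutI.of_injective hinj i)
  cases i
  · exact Monoid.PushoutI.exists_conj_mem_range (F := ℚ) hinj hb _ hδ
  · exact Monoid.PushoutI.exists_conj_mem_range (F := K) hinj hb _ hδ

theorem amalGamma_exists_notMem_base (hq1 : q ≠ 1) (hqm1 : q ≠ -1) (i : Bool) :
    ∃ t : SLfam K i, ∀ g, g * amalInc K q hq i t * g⁻¹ ∉
      (Monoid.PushoutI.base (sigmaMaps K q hq)).range := by
  have hinj := sigmaMaps_injective K hq hq1 hqm1
  have hb := baseAvoidsUnipotents K hq hq1 hqm1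
  have hi : Function.Injective (amalInc K q hq i) := Monoid.PushoutI.of_injective hinj i
  cases i
  · exact ⟨Matrix.SpecialLinearGroup.transvection zero_ne_one 1,
      Monoid.PushoutI.conj_transvection_notMem_base_range (F := ℚ) hb hi _ one_ne_zero⟩
  · exact ⟨Matrix.SpecialLinearGroup.transvection zero_ne_one 1,
      Monoid.PushoutI.conj_transvection_notMem_base_range (F := K) hb hi _ one_ne_zero⟩

/-- Automorphisms of `Γ` map each factor onto a conjugate of itself. -/
theorem amalGamma_exists_conj_factor (hKQ : ¬ Function.Surjective ((↑) : ℚ → K))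
    (hq1 : q ≠ 1) (hqm1 : q ≠ -1) (δ : AmalGamma K q hq ≃* AmalGamma K q hq) (i : Bool) :
    ∃ c : AmalGamma K q hq,
      ∀ z, c⁻¹ * δ z * c ∈ (amalInc K q hq i).range ↔ z ∈ (amalInc K q hq i).range := by
  have hinj := sigmaMaps_injective K hq hq1 hqm1
  obtain ⟨c, k, hc⟩ := Monoid.PushoutI.exists_conj_mem_range_iff hinj
    (amalGamma_exists_conj_mem_range K hq hq1 hqm1) i
    (amalGamma_exists_notMem_base K hq hq1 hqm1 i) δ
  obtain ⟨e, -⟩ := Monoid.PushoutI.exists_mulEquiv_of_range hinj δ c i k hc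
  have hne (e : SLfam K true ≃* SLfam K false) : False :=
    hKQ (Matrix.SpecialLinearGroup.surjective_ratCast_of_mulEquiv e)
  cases i <;> cases k
  · exact ⟨c, hc⟩
  · exact (hne e.symm).elim
  · exact (hne e).elim
  · exact ⟨c, hc⟩

end AmalGamma

/-- With `Γ = SL(3,ℚ) *_Σ SL(3,K)` as above: every automorphism `δ` of
`Γ` is of the form `Ad(g) ∘ (δ₁ * δ₂)` for some `g ∈ Γ` and automorphisms `δᵢ` of the
factors `Γᵢ` which globally preserve `Σ` and agree on `Σ` (under the identification of the
two copies of `Σ` inside `Γ`). -/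
theorem aut_of_amalgam_is_conj_of_factor_auts
    (K : Type) [Field K] [CharZero K] [Countable K]
    (hKQ : ¬ Function.Surjective ((↑) : ℚ → K))
    (q : ℚ) (hq0 : q ≠ 0) (hq1 : q ≠ 1) (hqm1 : q ≠ -1)
    (δ : AmalGamma K q hq0 ≃* AmalGamma K q hq0) :
    ∃ (g : AmalGamma K q hq0)
      (δ₁ : SLfam K false ≃* SLfam K false) (δ₂ : SLfam K true ≃* SLfam K true),
      Subgroup.map δ₁.toMonoidHom (Subgroup.zpowers (AmatFam K q hq0 false))
        = Subgroup.zpowers (AmatFam K q hq0 false) ∧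
      Subgroup.map δ₂.toMonoidHom (Subgroup.zpowers (AmatFam K q hq0 true))
        = Subgroup.zpowers (AmatFam K q hq0 true) ∧
      (∀ k : ℤ, amalInc K q hq0 false (δ₁ (AmatFam K q hq0 false ^ k))
        = amalInc K q hq0 true (δ₂ (AmatFam K q hq0 true ^ k))) ∧
      (∀ x : SLfam K false,
        δ (amalInc K q hq0 false x) = g * amalInc K q hq0 false (δ₁ x) * g⁻¹) ∧
      (∀ y : SLfam K true,
        δ (amalInc K q hq0 true y) = g * amalInc K q hq0 true (δ₂ y) * g⁻¹) := by
  have hinj := sigmaMaps_injective K hq0 hq1 hqm1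
  have hof (i : Bool) (k : ℤ) : amalInc K q hq0 i (AmatFam K q hq0 i ^ k) =
      Monoid.PushoutI.base (sigmaMaps K q hq0) (.ofAdd k) :=
    Monoid.PushoutI.of_apply_eq_base (sigmaMaps K q hq0) i (.ofAdd k)
  obtain ⟨c, hc⟩ := amalGamma_exists_conj_factor K hq0 hKQ hq1 hqm1 δ false
  obtain ⟨d, hd⟩ := amalGamma_exists_conj_factor K hq0 hKQ hq1 hqm1 δ true
  obtain ⟨t, ht⟩ := amalGamma_exists_notMem_base K hq0 hq1 hqm1 true
  obtain ⟨g, l, hl, hg, hbase⟩ := Monoid.PushoutI.exists_conj_factors hinj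
    (fun _ _ => eq_or_eq_neg_of_isConj_base K hq0 hq1 hqm1)
    ⟨t, fun h => ht 1 (by simpa [amalInc] using (Monoid.PushoutI.of_mem_base_range_iff hinj).2 h)⟩
    (δ.trans (MulAut.conj c⁻¹)) (c⁻¹ * d)
    (fun z => by simpa [amalInc] using hc z) (fun z => by simpa [amalInc, mul_assoc] using hd z)
  have hg' (i : Bool) (z : AmalGamma K q hq0) :
      (c * g)⁻¹ * δ z * (c * g) ∈ (amalInc K q hq0 i).range ↔ z ∈ (amalInc K q hq0 i).range := by
    simpa [amalInc, mul_assoc] using hg i z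
  have hex (i : Bool) : ∃ e : SLfam K i ≃* SLfam K i,
      (∀ x, δ (amalInc K q hq0 i x) = c * g * amalInc K q hq0 i (e x) * (c * g)⁻¹) ∧
        e (AmatFam K q hq0 i) = AmatFam K q hq0 i ^ l := by
    obtain ⟨e, he⟩ := Monoid.PushoutI.exists_mulEquiv_of_range hinj δ (c * g) i i (hg' i)
    refine ⟨e, he, Monoid.PushoutI.of_injective hinj i ?_⟩
    have h₁ := he (AmatFam K q hq0 i)
    have h₂ := hof i 1
    rw [zpow_one] at h₂
    have h₃ : δ (amalInc K q hq0 i (AmatFam K q hq0 i)) =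
        c * g * amalInc K q hq0 i (AmatFam K q hq0 i ^ l) * (c * g)⁻¹ := by
      rw [hof, h₂]
      have := congrArg (fun z => c * z * c⁻¹) hbase
      simpa [mul_assoc] using this
    exact mul_left_cancel (mul_right_cancel (h₁.symm.trans h₃))
  have hmap {i : Bool} {e : SLfam K i ≃* SLfam K i}
      (he : e (AmatFam K q hq0 i) = AmatFam K q hq0 i ^ l) :
      Subgroup.map e.toMonoidHom (Subgroup.zpowers (AmatFam K q hq0 i)) =
        Subgroup.zpowers (AmatFam K q hq0 i) := by
    rw [MonoidHom.map_zpowers]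
    change Subgroup.zpowers (e (AmatFam K q hq0 i)) = _
    rw [he]
    rcases hl with rfl | rfl
    · rw [zpow_one]
    · rw [_root_.zpow_neg_one, Subgroup.zpowers_inv]
  obtain ⟨δ₁, h₁, hA₁⟩ := hex false
  obtain ⟨δ₂, h₂, hA₂⟩ := hex true
  refine ⟨c * g, δ₁, δ₂, hmap hA₁, hmap hA₂, fun k => ?_, h₁, h₂⟩
  rw [map_zpow δ₁, map_zpow δ₂, hA₁, hA₂, ← _root_.zpow_mul, ← _root_.zpow_mul, hof, hof]
end
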